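/- arXiv:1702.03355 — 2 statements merged into one kernel-verified Lean document; each statement's English description precedes it below -/
import Mathlib

section
/- Let S = sgp⟨A | u = v⟩ be the one-relator monoid presented by A = {a_1,…,a_n} where u, v ∈ A^* with |u| = |v| = 3 and u ≠ v. Then S is biautomatic and prefix-automatic. -/
/-!  Common definitions, following the conventions of the paper
"Automaticity of one-relator semigroups with length less than or equal to three".

Words over an alphabet `α` are modelled as `List α`; the empty word is `[]`.
The padded alphabet `A(2,$)` is modelled inside `Option α × Option α`,
where `none` plays the role of the padding symbol `$` (the pair `(none, none)`
never occurs in a padded convolution). -/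

/-- A regular set of words: one accepted by a DFA with finitely many states. -/
abbrev IsReg {α : Type*} (L : Set (List α)) : Prop :=
  Language.IsRegular (L : Language α)

/-- Right-padded convolution `(x,y)δᴿ`: align the two words letter by letter
from the left and pad the shorter one on the right with the padding symbol. -/
def padR {α : Type*} (x y : List α) : List (Option α × Option α) :=
  (x.map some ++ List.replicate (y.length - x.length) none).zip
    (y.map some ++ List.replicate (x.length - y.length) none)

/-- Left-padded convolution `(x,y)δᴸ`: align the two words letter by letter
from the right and pad the shorter one on the left with the padding symbol. -/
def padL {α : Type*} (x y : List α) : List (Option α × Option α) :=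
  (List.replicate (y.length - x.length) none ++ x.map some).zip
    (List.replicate (x.length - y.length) none ++ y.map some)

/-- One elementary rewriting step: replace a factor `u` by `v`
for some defining relation `(u, v) ∈ R` (in either direction via `Relation.EqvGen`). -/
def OneStep {α : Type*} (R : Set (List α × List α)) (x y : List α) : Prop :=
  ∃ p u v s, (u, v) ∈ R ∧ x = p ++ u ++ s ∧ y = p ++ v ++ s

/-- Equality of two words in the semigroup `sgp⁺⟨α ∣ R⟩` (resp. the monoid
`sgp⟨α ∣ R⟩`): the congruence on words generated by the relations `R`. -/
def WordEq {α : Type*} (R : Set (List α × List α)) : List α → List α → Prop :=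
  Relation.EqvGen (OneStep R)

/-- Expansion of a word over an abstract generating set `β` into a word over the
presentation alphabet `α`, where `g b` is a word representing the generator `b`. -/
def expandW {α β : Type*} (g : β → List α) (w : List β) : List α :=
  (w.map g).flatten

/-- `(g, L)` is an automatic structure for the semigroup `sgp⁺⟨α ∣ R⟩` with
respect to the finite generating set indexed by `β`:  each generator `b` is the
element of the semigroup represented by the nonempty word `g b`, the language
`L ⊆ β⁺` is regular and maps onto the semigroup, and `L_ε^$` together with all
`L_b^$` (right multiplication, right padding) are regular. -/
structure SgpAutoStruct {α β : Type*} (R : Set (List α × List α))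
    (g : β → List α) (L : Set (List β)) : Prop where
  gen_ne : ∀ b, g b ≠ []
  reg : IsReg L
  ne : ∀ w ∈ L, w ≠ []
  onto : ∀ w : List α, w ≠ [] → ∃ x ∈ L, WordEq R (expandW g x) w
  eq_reg : IsReg {p | ∃ x ∈ L, ∃ y ∈ L,
      WordEq R (expandW g x) (expandW g y) ∧ p = padR x y}
  mul_reg : ∀ b : β, IsReg {p | ∃ x ∈ L, ∃ y ∈ L,
      WordEq R (expandW g x ++ g b) (expandW g y) ∧ p = padR x y}

/-- A prefix-automatic structure for `sgp⁺⟨α ∣ R⟩`: an automatic structure for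
which moreover `L'_= = {(x,y)δᴿ : x ∈ L, y ∈ Pref(L), x = y in S}` is regular. -/
structure SgpPrefixAutoStruct {α β : Type*} (R : Set (List α × List α))
    (g : β → List α) (L : Set (List β)) extends SgpAutoStruct R g L : Prop where
  pre_reg : IsReg {p | ∃ x ∈ L, ∃ y : List β, (∃ z ∈ L, y <+: z) ∧
      WordEq R (expandW g x) (expandW g y) ∧ p = padR x y}

/-- A biautomatic structure for the semigroup `sgp⁺⟨α ∣ R⟩`: the languages
`L_b^$`, `_bL^$`, `^$L_b` and `_b^$L` are regular for every `b ∈ β ∪ {ε}`. -/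
structure SgpBiautoStruct {α β : Type*} (R : Set (List α × List α))
    (g : β → List α) (L : Set (List β)) : Prop where
  gen_ne : ∀ b, g b ≠ []
  reg : IsReg L
  ne : ∀ w ∈ L, w ≠ []
  onto : ∀ w : List α, w ≠ [] → ∃ x ∈ L, WordEq R (expandW g x) w
  eqR_reg : IsReg {p | ∃ x ∈ L, ∃ y ∈ L,
      WordEq R (expandW g x) (expandW g y) ∧ p = padR x y}
  eqL_reg : IsReg {p | ∃ x ∈ L, ∃ y ∈ L,
      WordEq R (expandW g x) (expandW g y) ∧ p = padL x y}
  mulRR_reg : ∀ b : β, IsReg {p | ∃ x ∈ L, ∃ y ∈ L,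
      WordEq R (expandW g x ++ g b) (expandW g y) ∧ p = padR x y}
  mulLR_reg : ∀ b : β, IsReg {p | ∃ x ∈ L, ∃ y ∈ L,
      WordEq R (g b ++ expandW g x) (expandW g y) ∧ p = padR x y}
  mulRL_reg : ∀ b : β, IsReg {p | ∃ x ∈ L, ∃ y ∈ L,
      WordEq R (expandW g x ++ g b) (expandW g y) ∧ p = padL x y}
  mulLL_reg : ∀ b : β, IsReg {p | ∃ x ∈ L, ∃ y ∈ L,
      WordEq R (g b ++ expandW g x) (expandW g y) ∧ p = padL x y}

/-- The semigroup `sgp⁺⟨α ∣ R⟩` is automatic: it admits an automatic structure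
over some finite generating set. -/
def SgpAutomatic {α : Type*} (R : Set (List α × List α)) : Prop :=
  ∃ (β : Type) (_ : Fintype β) (g : β → List α) (L : Set (List β)),
    SgpAutoStruct R g L

/-- The semigroup `sgp⁺⟨α ∣ R⟩` is prefix-automatic. -/
def SgpPrefixAutomatic {α : Type*} (R : Set (List α × List α)) : Prop :=
  ∃ (β : Type) (_ : Fintype β) (g : β → List α) (L : Set (List β)),
    SgpPrefixAutoStruct R g L

/-- The semigroup `sgp⁺⟨α ∣ R⟩` is biautomatic. -/
def SgpBiautomatic {α : Type*} (R : Set (List α × List α)) : Prop :=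
  ∃ (β : Type) (_ : Fintype β) (g : β → List α) (L : Set (List β)),
    SgpBiautoStruct R g L

/-- `(g, L)` is an automatic structure for the monoid `sgp⟨α ∣ R⟩` with respect
to a finite generating set indexed by `β`; generators may represent any element
of the monoid (in particular the identity, represented by the empty word). -/
structure MonAutoStruct {α β : Type*} (R : Set (List α × List α))
    (g : β → List α) (L : Set (List β)) : Prop where
  reg : IsReg L
  ne : ∀ w ∈ L, w ≠ []
  onto : ∀ w : List α, ∃ x ∈ L, WordEq R (expandW g x) w
  eq_reg : IsReg {p | ∃ x ∈ L, ∃ y ∈ L,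
      WordEq R (expandW g x) (expandW g y) ∧ p = padR x y}
  mul_reg : ∀ b : β, IsReg {p | ∃ x ∈ L, ∃ y ∈ L,
      WordEq R (expandW g x ++ g b) (expandW g y) ∧ p = padR x y}

/-- A prefix-automatic structure for the monoid `sgp⟨α ∣ R⟩`. -/
structure MonPrefixAutoStruct {α β : Type*} (R : Set (List α × List α))
    (g : β → List α) (L : Set (List β)) extends MonAutoStruct R g L : Prop where
  pre_reg : IsReg {p | ∃ x ∈ L, ∃ y : List β, (∃ z ∈ L, y <+: z) ∧
      WordEq R (expandW g x) (expandW g y) ∧ p = padR x y}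

/-- A biautomatic structure for the monoid `sgp⟨α ∣ R⟩`. -/
structure MonBiautoStruct {α β : Type*} (R : Set (List α × List α))
    (g : β → List α) (L : Set (List β)) : Prop where
  reg : IsReg L
  ne : ∀ w ∈ L, w ≠ []
  onto : ∀ w : List α, ∃ x ∈ L, WordEq R (expandW g x) w
  eqR_reg : IsReg {p | ∃ x ∈ L, ∃ y ∈ L,
      WordEq R (expandW g x) (expandW g y) ∧ p = padR x y}
  eqL_reg : IsReg {p | ∃ x ∈ L, ∃ y ∈ L,
      WordEq R (expandW g x) (expandW g y) ∧ p = padL x y}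
  mulRR_reg : ∀ b : β, IsReg {p | ∃ x ∈ L, ∃ y ∈ L,
      WordEq R (expandW g x ++ g b) (expandW g y) ∧ p = padR x y}
  mulLR_reg : ∀ b : β, IsReg {p | ∃ x ∈ L, ∃ y ∈ L,
      WordEq R (g b ++ expandW g x) (expandW g y) ∧ p = padR x y}
  mulRL_reg : ∀ b : β, IsReg {p | ∃ x ∈ L, ∃ y ∈ L,
      WordEq R (expandW g x ++ g b) (expandW g y) ∧ p = padL x y}
  mulLL_reg : ∀ b : β, IsReg {p | ∃ x ∈ L, ∃ y ∈ L,
      WordEq R (g b ++ expandW g x) (expandW g y) ∧ p = padL x y}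

/-- The monoid `sgp⟨α ∣ R⟩` is automatic. -/
def MonAutomatic {α : Type*} (R : Set (List α × List α)) : Prop :=
  ∃ (β : Type) (_ : Fintype β) (g : β → List α) (L : Set (List β)),
    MonAutoStruct R g L

/-- The monoid `sgp⟨α ∣ R⟩` is prefix-automatic. -/
def MonPrefixAutomatic {α : Type*} (R : Set (List α × List α)) : Prop :=
  ∃ (β : Type) (_ : Fintype β) (g : β → List α) (L : Set (List β)),
    MonPrefixAutoStruct R g L

/-- The monoid `sgp⟨α ∣ R⟩` is biautomatic. -/
def MonBiautomatic {α : Type*} (R : Set (List α × List α)) : Prop :=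
  ∃ (β : Type) (_ : Fintype β) (g : β → List α) (L : Set (List β)),
    MonBiautoStruct R g L

/-- The defining relations of `S¹ = sgp⁺⟨α, e ∣ R, ea = ae = a, ee = e⟩`,
the monoid obtained from `S = sgp⁺⟨α ∣ R⟩` by adjoining an identity element,
presented as a semigroup over the alphabet `Option α` where `none` is the new
identity letter `e`. -/
def adjoinOne {α : Type*} (R : Set (List α × List α)) :
    Set (List (Option α) × List (Option α)) :=
  {q | ∃ p ∈ R, q = (p.1.map some, p.2.map some)} ∪
    {q | ∃ a : α, q = ([none, some a], [some a])} ∪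
    {q | ∃ a : α, q = ([some a, none], [some a])} ∪
    {([none, none], [none])}

set_option linter.all false

/-! ## Regularity toolkit -/

theorem isReg_family {γ Q : Type} [Finite Q] (step : Q → γ → Q → Prop) (acc : Q → Prop)
    (Lang : Q → Set (List γ)) (h0 : ∀ q, [] ∈ Lang q ↔ acc q)
    (h1 : ∀ q c w, c :: w ∈ Lang q ↔ ∃ q', step q c q' ∧ w ∈ Lang q') (q : Q) :
    IsReg (Lang q) := by
  classical
  have := Fintype.ofFinite Q
  let N : NFA γ Q := ⟨fun q c => {q' | step q c q'}, {q}, {q | acc q}⟩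
  have key : ∀ (w : List γ) (S : Set Q), w ∈ N.acceptsFrom S ↔ ∃ q ∈ S, w ∈ Lang q := by
    intro w
    induction w with
    | nil => intro S; rw [NFA.nil_mem_acceptsFrom]; simp only [h0]; rfl
    | cons c w ih =>
      intro S
      rw [NFA.cons_mem_acceptsFrom, ih]
      simp only [h1, NFA.mem_stepSet]
      constructor
      · rintro ⟨q', ⟨t, ht, hs⟩, hw⟩; exact ⟨t, ht, q', hs, hw⟩
      · rintro ⟨t, ht, q', hs, hw⟩; exact ⟨q', ⟨t, ht, hs⟩, hw⟩
  refine ⟨Set Q, inferInstance, N.toDFA, ?_⟩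
  rw [NFA.toDFA_correct, NFA.accepts_eq_acceptsFrom_start]
  ext w
  rw [key]
  constructor
  · rintro ⟨q', hq', hw⟩
    have : q' = q := hq'
    rw [this] at hw; exact hw
  · intro hw; exact ⟨q, rfl, hw⟩

/-- unfolding a regular language as a family of derivatives -/
theorem IsReg.family {γ : Type} {L : Set (List γ)} (h : IsReg L) :
    ∃ (Q : Type) (_ : Finite Q) (step : Q → γ → Q) (Lang : Q → Set (List γ)) (q0 : Q),
      Lang q0 = L ∧ ∀ q c w, c :: w ∈ Lang q ↔ w ∈ Lang (step q c) := by
  obtain ⟨Q, _, M, rfl⟩ := h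
  refine ⟨Q, inferInstance, M.step, fun q => M.acceptsFrom q, M.start, rfl, ?_⟩
  intro q c w
  rfl

theorem IsReg.compl' {γ : Type} {L : Set (List γ)} (h : IsReg L) : IsReg Lᶜ :=
  Language.IsRegular.compl h

theorem IsReg.union {γ : Type} {L M : Set (List γ)} (h : IsReg L) (h' : IsReg M) :
    IsReg (L ∪ M) := Language.IsRegular.add h h'

theorem IsReg.inter {γ : Type} {L M : Set (List γ)} (h : IsReg L) (h' : IsReg M) :
    IsReg (L ∩ M) := Language.IsRegular.inf h h'

theorem IsReg.congr {γ : Type} {L M : Set (List γ)} (h : IsReg L) (e : ∀ w, w ∈ M ↔ w ∈ L) :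
    IsReg M := by
  have : M = L := Set.ext e
  rw [this]; exact h

theorem IsReg.rev {γ : Type} {L : Set (List γ)} (h : IsReg L) : IsReg {w | w.reverse ∈ L} :=
  Language.IsRegular.reverse h

theorem isReg_empty {γ : Type} : IsReg (∅ : Set (List γ)) :=
  isReg_family (Q := Unit) (fun _ _ _ => False) (fun _ => False) (fun _ => ∅)
    (by simp) (by simp) ()

theorem isReg_nil {γ : Type} : IsReg ({[]} : Set (List γ)) :=
  isReg_family (Q := Unit) (fun _ _ _ => False) (fun _ => True) (fun _ => {[]})
    (by simp) (by simp) ()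

theorem IsReg.cons {γ : Type} {L : Set (List γ)} (h : IsReg L) (c : γ) :
    IsReg {w | ∃ w' ∈ L, w = c :: w'} := by
  obtain ⟨Q, _, step, Lang, q0, rfl, h1⟩ := h.family
  refine isReg_family (Q := Option Q)
    (fun q d q' => match q with
      | none => d = c ∧ q' = some q0
      | some q => q' = some (step q d))
    (fun q => match q with
      | none => False
      | some q => [] ∈ Lang q)
    (fun q => match q with
      | none => {w | ∃ w' ∈ Lang q0, w = c :: w'}
      | some q => Lang q) ?_ ?_ none
  · rintro (_ | q) <;> simp
  · rintro (_ | q) d w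
    · constructor
      · rintro ⟨w', hw', h⟩
        simp only [List.cons.injEq] at h
        obtain ⟨rfl, rfl⟩ := h
        exact ⟨some q0, ⟨rfl, rfl⟩, hw'⟩
      · rintro ⟨q', ⟨rfl, rfl⟩, hw⟩
        exact ⟨w, hw, rfl⟩
    · simp [h1]

theorem isReg_singleton {γ : Type} (w : List γ) : IsReg ({w} : Set (List γ)) := by
  induction w with
  | nil => exact isReg_nil
  | cons c w ih => exact (ih.cons c).congr (by simp)

theorem isReg_biUnion {γ ι : Type} {I : Set ι} (hI : I.Finite) (L : ι → Set (List γ))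
    (h : ∀ i, IsReg (L i)) : IsReg {w | ∃ i ∈ I, w ∈ L i} := by
  induction I, hI using Set.Finite.induction_on with
  | empty => exact isReg_empty.congr (by simp)
  | @insert a s _ _ ih => exact ((h a).union ih).congr (by simp)

theorem isReg_finite {γ : Type} {I : Set (List γ)} (hI : I.Finite) : IsReg I :=
  (isReg_biUnion hI (fun w => {w}) isReg_singleton).congr (by simp)

theorem IsReg.map {γ δ : Type} {L : Set (List γ)} (h : IsReg L) (f : γ → δ) :
    IsReg {w | ∃ w' ∈ L, w = w'.map f} := by
  obtain ⟨Q, _, step, Lang, q0, rfl, h1⟩ := h.family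
  refine isReg_family (Q := Q) (fun q d q' => ∃ c, f c = d ∧ q' = step q c)
    (fun q => [] ∈ Lang q) (fun q => {w | ∃ w' ∈ Lang q, w = w'.map f}) ?_ ?_ q0
  · intro q
    constructor
    · rintro ⟨w', hw', h⟩
      have : w' = [] := by simpa using h.symm
      rwa [this] at hw'
    · intro h; exact ⟨[], h, rfl⟩
  · intro q d w
    constructor
    · rintro ⟨w', hw', h⟩
      cases w' with
      | nil => simp at h
      | cons c w' =>
        simp only [List.map_cons, List.cons.injEq] at h
        obtain ⟨rfl, rfl⟩ := h
        exact ⟨_, ⟨c, rfl, rfl⟩, w', (h1 _ _ _).1 hw', rfl⟩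
    · rintro ⟨q', ⟨c, rfl, rfl⟩, w', hw', rfl⟩
      exact ⟨c :: w', (h1 _ _ _).2 hw', rfl⟩

theorem IsReg.filterMap {γ δ : Type} {L : Set (List γ)} (h : IsReg L) (f : δ → Option γ) :
    IsReg {w | w.filterMap f ∈ L} := by
  obtain ⟨Q, _, step, Lang, q0, rfl, h1⟩ := h.family
  refine isReg_family (Q := Q) (fun q d q' => q' = match f d with
      | none => q
      | some c => step q c)
    (fun q => [] ∈ Lang q) (fun q => {w | w.filterMap f ∈ Lang q}) ?_ ?_ q0
  · intro q; simp
  · intro q d w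
    simp only [Set.mem_ofPred_eq, exists_eq_left]
    cases hd : f d with
    | none => simp [List.filterMap_cons, hd]
    | some c => simp [List.filterMap_cons, hd, h1]

theorem isReg_facs {γ : Type} (f : List γ) : IsReg {w | f <:+: w} := by
  by_cases hf : f = []
  · subst hf
    exact (isReg_empty.compl').congr (by simp)
  have : Finite {g : List γ // g <:+ f} := by
    have : {g : List γ | g <:+ f}.Finite := by
      refine (List.finite_toSet f.tails).subset ?_
      intro g hg
      simpa using hg
    exact this.to_subtype
  refine isReg_family (Q := Option {g : List γ // g <:+ f})
    (fun q d q' => match q with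
      | none => q' = none ∨ ∃ g, f = d :: g ∧ ∃ h : g <:+ f, q' = some ⟨g, h⟩
      | some q => (q.1 = [] ∧ q' = some q) ∨ ∃ g, q.1 = d :: g ∧ ∃ h : g <:+ f, q' = some ⟨g, h⟩)
    (fun q => match q with
      | none => False
      | some q => q.1 = [])
    (fun q => match q with
      | none => {w | f <:+: w}
      | some q => {w | q.1 <+: w}) ?_ ?_ none
  · rintro (_ | q) <;> simp [hf]
  · rintro (_ | ⟨q, hq⟩) d w
    · simp only [Set.mem_ofPred_eq, List.infix_cons_iff]
      constructor
      · rintro (h | h)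
        · cases f with
          | nil => exact absurd rfl hf
          | cons c g =>
            obtain ⟨rfl, h'⟩ := List.cons_prefix_cons.1 h
            exact ⟨some ⟨g, List.suffix_cons _ _⟩, Or.inr ⟨g, rfl, List.suffix_cons _ _, rfl⟩, h'⟩
        · exact ⟨none, Or.inl rfl, h⟩
      · rintro ⟨q', rfl | ⟨g, hg, h, rfl⟩, hw⟩
        · exact Or.inr hw
        · left; rw [hg]; exact List.cons_prefix_cons.2 ⟨rfl, hw⟩
    · simp only [Set.mem_ofPred_eq]
      constructor
      · intro h
        cases q with
        | nil => exact ⟨some ⟨[], hq⟩, Or.inl ⟨rfl, rfl⟩, by simp⟩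
        | cons c g =>
          obtain ⟨rfl, h'⟩ := List.cons_prefix_cons.1 h
          have hs : g <:+ f := (List.suffix_cons _ _).trans hq
          exact ⟨some ⟨g, hs⟩, Or.inr ⟨g, rfl, hs, rfl⟩, h'⟩
      · rintro ⟨q', ⟨rfl, rfl⟩ | ⟨g, rfl, h, rfl⟩, hw⟩
        · simp
        · exact List.cons_prefix_cons.2 ⟨rfl, hw⟩

/-- words avoiding a finite set of factors -/
def Irr {γ : Type} (F : List (List γ)) (w : List γ) : Prop := ∀ f ∈ F, ¬ f <:+: w

theorem isReg_irr {γ : Type} (F : List (List γ)) : IsReg {w | Irr F w} := by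
  induction F with
  | nil => exact (isReg_empty.compl').congr (by simp [Irr])
  | cons f F ih => exact ((isReg_facs f).compl'.inter ih).congr (by simp [Irr])

/-- shift by one letter -/
theorem IsReg.shift1 {γ : Type} {Z : Set (List (γ × γ))} [Finite γ] (h : IsReg Z) (p q : γ) :
    IsReg {w | ∃ z ∈ Z, w = (z.map Prod.fst ++ [p]).zip (q :: z.map Prod.snd)} := by
  obtain ⟨Q, _, step, Lang, q0, rfl, h1⟩ := h.family
  refine isReg_family (Q := Option (Q × γ))
    (fun s d s' => match s with
      | none => False
      | some (s, y) => d.2 = y ∧ ((s' = none ∧ d.1 = p ∧ [] ∈ Lang s) ∨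
          ∃ y', s' = some (step s (d.1, y'), y')))
    (fun s => s = none)
    (fun s => match s with
      | none => {[]}
      | some (s, y) => {w | ∃ z ∈ Lang s, w = (z.map Prod.fst ++ [p]).zip (y :: z.map Prod.snd)})
    ?_ ?_ (some (q0, q))
  · rintro (_ | ⟨s, y⟩)
    · simp
    · simp only [Set.mem_ofPred_eq, reduceCtorEq, iff_false, not_exists, not_and]
      intro z hz
      cases z <;> simp
  · rintro (_ | ⟨s, y⟩) ⟨d1, d2⟩ w
    · simp
    · simp only [Set.mem_ofPred_eq]
      constructor
      · rintro ⟨z, hz, hw⟩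
        cases z with
        | nil =>
          simp only [List.map_nil, List.nil_append, List.zip_cons_cons, List.zip_nil_right,
            List.cons.injEq, Prod.mk.injEq] at hw
          obtain ⟨⟨rfl, rfl⟩, rfl⟩ := hw
          exact ⟨none, ⟨rfl, Or.inl ⟨rfl, rfl, hz⟩⟩, rfl⟩
        | cons x z =>
          obtain ⟨x1, x2⟩ := x
          simp only [List.map_cons, List.cons_append, List.zip_cons_cons,
            List.cons.injEq, Prod.mk.injEq] at hw
          obtain ⟨⟨rfl, rfl⟩, rfl⟩ := hw
          exact ⟨some (step s (d1, x2), x2), ⟨rfl, Or.inr ⟨x2, rfl⟩⟩, z, (h1 _ _ _).1 hz, rfl⟩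
      · rintro ⟨s', ⟨rfl, ⟨rfl, rfl, hn⟩ | ⟨y', rfl⟩⟩, hw⟩
        · have : w = [] := hw
          subst this
          exact ⟨[], hn, rfl⟩
        · obtain ⟨z, hz, rfl⟩ := hw
          exact ⟨(d1, y') :: z, (h1 _ _ _).2 hz, rfl⟩

theorem IsReg.shift {γ : Type} [Finite γ] {Z : Set (List (γ × γ))} (h : IsReg Z)
    (p q : List γ) (hpq : p.length = q.length) :
    IsReg {w | ∃ z ∈ Z, w = (z.map Prod.fst ++ p).zip (q ++ z.map Prod.snd)} := by
  induction q generalizing p with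
  | nil =>
    have : p = [] := by simpa using hpq
    subst this
    refine h.congr fun w => ?_
    have hz : ∀ z : List (γ × γ), (z.map Prod.fst).zip (z.map Prod.snd) = z := by
      intro z
      induction z with
      | nil => rfl
      | cons a z ih => simp [ih]
    simp [hz]
  | cons q0 q ih =>
    have hp : p ≠ [] := by rintro rfl; simp at hpq
    obtain ⟨p', p0, rfl⟩ : ∃ p' p0, p = p' ++ [p0] :=
      ⟨p.dropLast, p.getLast hp, (List.dropLast_append_getLast hp).symm⟩
    have hl : p'.length = q.length := by simpa using hpq
    refine ((ih p' hl).shift1 p0 q0).congr fun w => ?_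
    have key : ∀ z : List (γ × γ),
        (z.map Prod.fst ++ (p' ++ [p0])).zip (q0 :: q ++ z.map Prod.snd) =
        ((((z.map Prod.fst ++ p').zip (q ++ z.map Prod.snd)).map Prod.fst) ++ [p0]).zip
          (q0 :: (((z.map Prod.fst ++ p').zip (q ++ z.map Prod.snd)).map Prod.snd)) := by
      intro z
      rw [List.map_fst_zip (by simp [hl, add_comm]), List.map_snd_zip (by simp [hl, add_comm])]
      simp
    constructor
    · rintro ⟨z, hz, rfl⟩
      exact ⟨_, ⟨z, hz, rfl⟩, key z⟩
    · rintro ⟨_, ⟨z, hz, rfl⟩, rfl⟩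
      exact ⟨z, hz, (key z).symm⟩

/-! ## Padding -/

theorem padR_fst {γ : Type} (x y : List γ) : (padR x y).filterMap Prod.fst = x := by
  have : (padR x y).filterMap Prod.fst = ((padR x y).map Prod.fst).filterMap id := by
    simp [List.filterMap_map]
  rw [this, padR, List.map_fst_zip (by simp; omega)]
  simp [List.filterMap_append, List.filterMap_map]

theorem padR_snd {γ : Type} (x y : List γ) : (padR x y).filterMap Prod.snd = y := by
  have : (padR x y).filterMap Prod.snd = ((padR x y).map Prod.snd).filterMap id := by
    simp [List.filterMap_map]
  rw [this, padR, List.map_snd_zip (by simp; omega)]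
  simp [List.filterMap_append, List.filterMap_map]

theorem zip_reverse {γ δ : Type} : ∀ (x : List γ) (y : List δ), x.length = y.length →
    (x.zip y).reverse = x.reverse.zip y.reverse := by
  intro x
  induction x with
  | nil => intro y h; simp
  | cons a x ih =>
    intro y h
    cases y with
    | nil => simp at h
    | cons b y =>
      simp only [List.length_cons, Nat.add_right_cancel_iff] at h
      simp only [List.zip_cons_cons, List.reverse_cons, ih y h]
      rw [List.zip_append (by simp [h])]
      simp

theorem padL_eq_rev {γ : Type} (x y : List γ) :
    padL x y = (padR x.reverse y.reverse).reverse := by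
  unfold padL padR
  rw [zip_reverse _ _ (by simp; omega)]
  simp

theorem padR_eq_rev {γ : Type} (x y : List γ) :
    padR x y = (padL x.reverse y.reverse).reverse := by
  rw [padL_eq_rev]; simp

theorem padL_fst {γ : Type} (x y : List γ) : (padL x y).filterMap Prod.fst = x := by
  rw [padL_eq_rev, List.filterMap_reverse, padR_fst, List.reverse_reverse]

theorem padL_snd {γ : Type} (x y : List γ) : (padL x y).filterMap Prod.snd = y := by
  rw [padL_eq_rev, List.filterMap_reverse, padR_snd, List.reverse_reverse]

theorem padR_map {γ δ : Type} (f : γ → δ) (x y : List γ) :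
    padR (x.map f) (y.map f) = (padR x y).map (Prod.map (Option.map f) (Option.map f)) := by
  unfold padR
  rw [← List.zip_map]
  simp

theorem padL_map {γ δ : Type} (f : γ → δ) (x y : List γ) :
    padL (x.map f) (y.map f) = (padL x y).map (Prod.map (Option.map f) (Option.map f)) := by
  unfold padL
  rw [← List.zip_map]
  simp

theorem padR_self {γ : Type} (x : List γ) :
    padR x x = x.map (fun c => (some c, some c)) := by
  unfold padR
  simp [List.zip_map']

theorem padL_self {γ : Type} (x : List γ) :
    padL x x = x.map (fun c => (some c, some c)) := by
  unfold padL
  simp [List.zip_map']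

/-! ## Sweeps -/

structure Cong {γ : Type} (E : List γ → List γ → Prop) : Prop where
  refl : ∀ x, E x x
  symm : ∀ x y, E x y → E y x
  trans : ∀ x y z, E x y → E y z → E x z
  app : ∀ p s x y, E x y → E (p ++ x ++ s) (p ++ y ++ s)

inductive SwR {γ : Type} (E : List γ → List γ → Prop) (k : ℕ) (t : γ) :
    List γ → List γ → Prop
  | base (w y : List γ) : w.length < k → y.length = w.length + 1 → E (w ++ [t]) y →
      SwR E k t w y
  | step (c : γ) (w σ d τ : List γ) : SwR E k t w (σ ++ d) → σ.length = k →
      τ.length = k + 1 → E (c :: σ) τ → SwR E k t (c :: w) (τ ++ d)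

theorem Cong.right {γ : Type} {E : List γ → List γ → Prop} (hE : Cong E) {x y : List γ}
    (h : E x y) (s : List γ) : E (x ++ s) (y ++ s) := by
  simpa using hE.app [] s x y h

theorem Cong.left {γ : Type} {E : List γ → List γ → Prop} (hE : Cong E) {x y : List γ}
    (h : E x y) (p : List γ) : E (p ++ x) (p ++ y) := by
  simpa using hE.app p [] x y h

theorem SwR.sound {γ : Type} {E : List γ → List γ → Prop} (hE : Cong E) {k : ℕ} {t : γ}
    {w y : List γ} (h : SwR E k t w y) : E (w ++ [t]) y ∧ y.length = w.length + 1 := by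
  induction h with
  | base w y h1 h2 h3 => exact ⟨h3, h2⟩
  | step c w σ d τ h h1 h2 h3 ih =>
    refine ⟨?_, ?_⟩
    · have := hE.left ih.1 [c]
      refine hE.trans _ _ _ (by simpa using this) ?_
      have := hE.right h3 d
      simpa using this
    · have := ih.2
      simp only [List.length_append, List.length_cons] at *
      omega

/-- flexible step -/
theorem SwR.step' {γ : Type} {E : List γ → List γ → Prop} (hE : Cong E) {k : ℕ} {t : γ}
    {w : List γ} (c : γ) (σ d τ : List γ) (h : SwR E k t w (σ ++ d)) (hσ : σ.length ≤ k)
    (hτ : τ.length = σ.length + 1) (he : E (c :: σ) τ) : SwR E k t (c :: w) (τ ++ d) := by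
  by_cases hk : k ≤ (σ ++ d).length
  · have e1 : d = d.take (k - σ.length) ++ d.drop (k - σ.length) := by simp
    rw [e1, ← List.append_assoc] at h
    rw [e1, ← List.append_assoc]
    simp only [List.length_append] at hk
    refine SwR.step c w _ _ _ h ?_ ?_ ?_
    · simp; omega
    · simp; omega
    · simpa using hE.right he (d.take (k - σ.length))
  · obtain ⟨h1, h2⟩ := h.sound hE
    refine SwR.base _ _ ?_ ?_ ?_
    · simp only [List.length_cons]; omega
    · simp only [List.length_append, List.length_cons] at *; omega
    · refine hE.trans _ _ _ (by simpa using hE.left h1 [c]) ?_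
      simpa using hE.right he d

theorem SwR.copy {γ : Type} {E : List γ → List γ → Prop} (hE : Cong E) {k : ℕ} {t : γ}
    {w y : List γ} (p : List γ) (h : SwR E k t w y) : SwR E k t (p ++ w) (p ++ y) := by
  induction p with
  | nil => exact h
  | cons c p ih => exact SwR.step' hE c [] (p ++ y) [c] ih (by simp) (by simp) (hE.refl _)

theorem SwR.init {γ : Type} {E : List γ → List γ → Prop} (hE : Cong E) {k : ℕ} (hk : 0 < k)
    (t : γ) (w : List γ) : SwR E k t w (w ++ [t]) := by
  have : SwR E k t [] [t] := SwR.base _ _ (by simpa) (by simp) (hE.refl _)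
  simpa using this.copy hE w

/-- block step -/
theorem SwR.block {γ : Type} {E : List γ → List γ → Prop} (hE : Cong E) {k : ℕ} {t : γ}
    {w : List γ} (z σ d τ : List γ) (h : SwR E k t w (σ ++ d)) (hz : z ≠ [])
    (hσ : z.length + σ.length ≤ k + 1)
    (hτ : τ.length = z.length + σ.length) (he : E (z ++ σ) τ) :
    SwR E k t (z ++ w) (τ ++ d) := by
  cases z with
  | nil => exact absurd rfl hz
  | cons c z =>
    have := h.copy hE z
    rw [← List.append_assoc] at this
    simp only [List.length_cons] at *
    exact SwR.step' hE c (z ++ σ) d τ this (by simp; omega) (by simp; omega) he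

def Run {γ : Type} (E : List γ → List γ → Prop) (k : ℕ) (b : List γ) :
    List γ → List (γ × γ) → Prop
  | σ, [] => E b σ
  | σ, (c, e) :: z => ∃ σ', σ'.length = k ∧ E (c :: σ') (σ ++ [e]) ∧ Run E k b σ' z

theorem finite_len (γ : Type) [Finite γ] (k : ℕ) : {σ : List γ | σ.length = k}.Finite :=
  List.finite_length_eq γ k

theorem finite_lt (γ : Type) [Finite γ] (k : ℕ) : {σ : List γ | σ.length < k}.Finite :=
  List.finite_length_lt γ k

theorem isReg_run {γ : Type} [Finite γ] (E : List γ → List γ → Prop) (k : ℕ) (b σ : List γ)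
    (hσ : σ.length = k) : IsReg {z | Run E k b σ z} := by
  have : Finite {σ : List γ // σ.length = k} := (finite_len γ k).to_subtype
  refine isReg_family (Q := {σ : List γ // σ.length = k})
    (fun s ce s' => E (ce.1 :: s'.1) (s.1 ++ [ce.2])) (fun s => E b s.1)
    (fun s => {z | Run E k b s.1 z}) ?_ ?_ ⟨σ, hσ⟩
  · intro q; rfl
  · rintro q ⟨c, e⟩ z
    simp only [Set.mem_ofPred_eq, Run]
    constructor
    · rintro ⟨s, h1, h2, h3⟩; exact ⟨⟨s, h1⟩, h2, h3⟩
    · rintro ⟨⟨s, h1⟩, h2, h3⟩; exact ⟨s, h1, h2, h3⟩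

theorem swR_iff {γ : Type} (E : List γ → List γ → Prop) (k : ℕ) (t : γ)
    (w y : List γ) : SwR E k t w y ↔
      (w.length < k ∧ y.length = w.length + 1 ∧ E (w ++ [t]) y) ∨
      ∃ w0 σ z, w0.length + 1 = k ∧ σ.length = k ∧ Run E k (w0 ++ [t]) σ z ∧
        w = z.map Prod.fst ++ w0 ∧ y = σ ++ z.map Prod.snd := by
  constructor
  · intro h
    induction h with
    | base w y h1 h2 h3 => exact Or.inl ⟨h1, h2, h3⟩
    | step c w σ d τ h h1 h2 h3 ih =>
      right
      have hτ : τ ≠ [] := by rintro rfl; simp at h2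
      obtain ⟨τ', e, rfl⟩ : ∃ τ' e, τ = τ' ++ [e] :=
        ⟨τ.dropLast, τ.getLast hτ, (List.dropLast_append_getLast hτ).symm⟩
      have hτ' : τ'.length = k := by simpa using h2
      rcases ih with ⟨i1, i2, i3⟩ | ⟨w0, s, z, i1, i2, i3, rfl, i5⟩
      · have hd : d = [] := by
          apply List.eq_nil_of_length_eq_zero
          simp only [List.length_append] at i2
          omega
        subst hd
        simp only [List.append_nil] at i2 i3
        exact ⟨w, τ', [(c, e)], by omega, hτ', ⟨σ, h1, h3, i3⟩, by simp, by simp⟩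
      · obtain ⟨rfl, rfl⟩ := List.append_inj i5 (by omega)
        exact ⟨w0, τ', (c, e) :: z, i1, hτ', ⟨σ, h1, h3, i3⟩, by simp, by simp⟩
  · rintro (⟨h1, h2, h3⟩ | ⟨w0, σ, z, i1, i2, i3, rfl, rfl⟩)
    · exact SwR.base _ _ h1 h2 h3
    · induction z generalizing σ with
      | nil => exact SwR.base _ _ (by simp; omega) (by simp; omega) (by simpa [Run] using i3)
      | cons ce z ih =>
        obtain ⟨c, e⟩ := ce
        obtain ⟨σ', j1, j2, j3⟩ := i3
        have := SwR.step c _ _ _ (σ ++ [e]) (ih σ' j1 j3) j1 (by simp [i2]) j2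
        simpa using this

theorem padR_shift {γ : Type} (z : List (γ × γ)) (w0 σ : List γ) (h : σ.length = w0.length + 1) :
    padR (z.map Prod.fst ++ w0) (σ ++ z.map Prod.snd) =
      ((z.map (Prod.map some some)).map Prod.fst ++ (w0.map some ++ [none])).zip
        (σ.map some ++ (z.map (Prod.map some some)).map Prod.snd) := by
  unfold padR
  have e1 : (σ ++ z.map Prod.snd).length - (z.map Prod.fst ++ w0).length = 1 := by
    simp; omega
  have e2 : (z.map Prod.fst ++ w0).length - (σ ++ z.map Prod.snd).length = 0 := by
    simp; omega
  rw [e1, e2]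
  simp [List.map_map, Function.comp_def]

theorem padL_shift {γ : Type} (z : List (γ × γ)) (w0 σ : List γ) (s : γ)
    (h : σ.length = w0.length) :
    padL (z.map Prod.fst ++ w0) (s :: σ ++ z.map Prod.snd) =
      (none, some s) :: ((z.map (Prod.map some some)).map Prod.fst ++ (w0.map some)).zip
        (σ.map some ++ (z.map (Prod.map some some)).map Prod.snd) := by
  unfold padL
  have e1 : (s :: σ ++ z.map Prod.snd).length - (z.map Prod.fst ++ w0).length = 1 := by
    simp; omega
  have e2 : (z.map Prod.fst ++ w0).length - (s :: σ ++ z.map Prod.snd).length = 0 := by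
    simp; omega
  rw [e1, e2]
  simp [List.map_map, Function.comp_def]

theorem sw_reg_aux {γ : Type} [Finite γ] (E : List γ → List γ → Prop) (k : ℕ) (t : γ)
    (pad : List γ → List γ → List (Option γ × Option γ))
    (H : ∀ w0 σ : List γ, w0.length + 1 = k → σ.length = k →
      ∀ Z : Set (List (γ × γ)), IsReg Z →
      IsReg {p | ∃ z ∈ Z, p = pad (z.map Prod.fst ++ w0) (σ ++ z.map Prod.snd)}) :
    IsReg {p | ∃ w y, SwR E k t w y ∧ p = pad w y} := by
  have r1 : IsReg {p | ∃ w y, (w.length < k ∧ y.length = w.length + 1 ∧ E (w ++ [t]) y) ∧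
      p = pad w y} := by
    apply isReg_finite
    refine (((finite_lt γ k).prod (finite_lt γ (k + 1))).image (fun q => pad q.1 q.2)).subset ?_
    rintro p ⟨w, y, ⟨h1, h2, h3⟩, rfl⟩
    refine ⟨(w, y), ⟨h1, ?_⟩, rfl⟩
    show y.length < k + 1
    omega
  have r2 : IsReg {p | ∃ i ∈ {i : List γ × List γ | i.1.length + 1 = k ∧ i.2.length = k},
      p ∈ {p | i.1.length + 1 = k ∧ i.2.length = k ∧
        ∃ z ∈ {z | Run E k (i.1 ++ [t]) i.2 z},
          p = pad (z.map Prod.fst ++ i.1) (i.2 ++ z.map Prod.snd)}} := by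
    refine isReg_biUnion ?_ _ ?_
    · refine ((finite_len γ (k - 1)).prod (finite_len γ k)).subset ?_
      rintro ⟨w, y⟩ ⟨h1, h2⟩
      refine ⟨?_, h2⟩
      show w.length = k - 1
      simp only at h1
      omega
    · rintro ⟨w0, σ⟩
      by_cases h1 : w0.length + 1 = k
      · by_cases h2 : σ.length = k
        · exact (H w0 σ h1 h2 _ (isReg_run E k (w0 ++ [t]) σ h2)).congr (by simp [h1, h2])
        · exact isReg_empty.congr (by simp [h2])
      · exact isReg_empty.congr (by simp [h1])
  refine (r1.union r2).congr fun p => ?_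
  constructor
  · rintro ⟨w, y, h, rfl⟩
    rcases (swR_iff E k t w y).1 h with h | ⟨w0, σ, z, h1, h2, h3, rfl, rfl⟩
    · exact Or.inl ⟨w, y, h, rfl⟩
    · exact Or.inr ⟨(w0, σ), ⟨h1, h2⟩, h1, h2, z, h3, rfl⟩
  · rintro (⟨w, y, h, rfl⟩ | ⟨⟨w0, σ⟩, -, h1, h2, z, h3, rfl⟩)
    · exact ⟨w, y, (swR_iff E k t w y).2 (Or.inl h), rfl⟩
    · exact ⟨_, _, (swR_iff E k t _ _).2 (Or.inr ⟨w0, σ, z, h1, h2, h3, rfl, rfl⟩), rfl⟩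

theorem sw_regR {γ : Type} [Finite γ] (E : List γ → List γ → Prop) (k : ℕ) (t : γ) :
    IsReg {p | ∃ w y, SwR E k t w y ∧ p = padR w y} := by
  refine sw_reg_aux E k t padR ?_
  intro w0 σ h1 h2 Z hZ
  refine ((hZ.map (Prod.map some some)).shift (w0.map some ++ [none]) (σ.map some)
    (by simp; omega)).congr fun p => ?_
  constructor
  · rintro ⟨z, hz, rfl⟩
    exact ⟨_, ⟨z, hz, rfl⟩, padR_shift z w0 σ (by omega)⟩
  · rintro ⟨_, ⟨z, hz, rfl⟩, rfl⟩
    exact ⟨z, hz, (padR_shift z w0 σ (by omega)).symm⟩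

theorem sw_regL {γ : Type} [Finite γ] (E : List γ → List γ → Prop) (k : ℕ) (t : γ) :
    IsReg {p | ∃ w y, SwR E k t w y ∧ p = padL w y} := by
  refine sw_reg_aux E k t padL ?_
  intro w0 σ h1 h2 Z hZ
  cases σ with
  | nil => simp only [List.length_nil] at h2; omega
  | cons s σ =>
    have hl : σ.length = w0.length := by simp only [List.length_cons] at h2; omega
    refine (((hZ.map (Prod.map some some)).shift (w0.map some) (σ.map some)
      (by simp [hl])).cons (none, some s)).congr fun p => ?_
    constructor
    · rintro ⟨z, hz, rfl⟩
      exact ⟨_, ⟨_, ⟨z, hz, rfl⟩, rfl⟩, padL_shift z w0 σ s hl⟩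
    · rintro ⟨_, ⟨_, ⟨z, hz, rfl⟩, rfl⟩, rfl⟩
      exact ⟨z, hz, (padL_shift z w0 σ s hl).symm⟩

theorem pad_restrict {γ : Type} (pad : List γ → List γ → List (Option γ × Option γ))
    (h1 : ∀ x y, (pad x y).filterMap Prod.fst = x) (h2 : ∀ x y, (pad x y).filterMap Prod.snd = y)
    (P : List γ → List γ → Prop) (hP : IsReg {p | ∃ w y, P w y ∧ p = pad w y})
    (L1 L2 : Set (List γ)) (hL1 : IsReg L1) (hL2 : IsReg L2) :
    IsReg {p | ∃ w ∈ L1, ∃ y ∈ L2, P w y ∧ p = pad w y} := by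
  refine ((hP.inter (hL1.filterMap Prod.fst)).inter (hL2.filterMap Prod.snd)).congr fun p => ?_
  constructor
  · rintro ⟨w, hw, y, hy, h, rfl⟩
    refine ⟨⟨⟨w, y, h, rfl⟩, ?_⟩, ?_⟩
    · show (pad w y).filterMap Prod.fst ∈ L1
      rwa [h1]
    · show (pad w y).filterMap Prod.snd ∈ L2
      rwa [h2]
  · rintro ⟨⟨⟨w, y, h, rfl⟩, hw⟩, hy⟩
    change (pad w y).filterMap Prod.fst ∈ L1 at hw
    change (pad w y).filterMap Prod.snd ∈ L2 at hy
    rw [h1] at hw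
    rw [h2] at hy
    exact ⟨w, hw, y, hy, h, rfl⟩

/-! ## Assembly -/

def enc {γ : Type} (w : List γ) : List (Option γ) := if w = [] then [none] else w.map some

def gen {γ : Type} : Option γ → List γ
  | none => []
  | some a => [a]

theorem expandW_map_some {γ : Type} (w : List γ) : expandW gen (w.map some) = w := by
  induction w with
  | nil => rfl
  | cons c w ih =>
    have : expandW gen ((c :: w).map some) = c :: expandW gen (w.map some) := rfl
    rw [this, ih]

theorem expandW_enc {γ : Type} (w : List γ) : expandW gen (enc w) = w := by
  unfold enc
  split
  · next h => subst h; rfl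
  · exact expandW_map_some w

theorem enc_reg {γ : Type} {L : Set (List γ)} (hL : IsReg L) : IsReg (enc '' L) := by
  have h1 : IsReg (L ∩ {[]}ᶜ) := hL.inter (isReg_nil.compl')
  by_cases h : [] ∈ L
  · refine ((h1.map some).union (isReg_singleton [none])).congr fun w => ?_
    constructor
    · rintro ⟨x, hx, rfl⟩
      by_cases hx0 : x = []
      · right; subst hx0; rfl
      · left; exact ⟨x, ⟨hx, hx0⟩, by simp [enc, hx0]⟩
    · rintro (⟨x, ⟨hx, hx0⟩, rfl⟩ | rfl)
      · have : x ≠ [] := hx0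
        exact ⟨x, hx, by simp [enc, this]⟩
      · exact ⟨[], h, rfl⟩
  · refine (h1.map some).congr fun w => ?_
    constructor
    · rintro ⟨x, hx, rfl⟩
      by_cases hx0 : x = []
      · subst hx0; exact absurd hx h
      · exact ⟨x, ⟨hx, hx0⟩, by simp [enc, hx0]⟩
    · rintro ⟨x, ⟨hx, hx0⟩, rfl⟩
      have : x ≠ [] := hx0
      exact ⟨x, hx, by simp [enc, this]⟩

theorem enc_rel_reg {γ : Type} [Finite γ]
    (pad : ∀ {δ : Type}, List δ → List δ → List (Option δ × Option δ))
    (h1 : ∀ {δ : Type} (x y : List δ), (pad x y).filterMap Prod.fst = x)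
    (h2 : ∀ {δ : Type} (x y : List δ), (pad x y).filterMap Prod.snd = y)
    (hm : ∀ (x y : List γ), pad (x.map some) (y.map some) =
      (pad x y).map (Prod.map (Option.map some) (Option.map some)))
    (P : List γ → List γ → Prop) (L : Set (List γ)) (hL : IsReg L)
    (hP : IsReg {p | ∃ w y, P w y ∧ p = pad w y})
    (hlen : ∀ w y, P w y → w.length ≤ y.length ∧ y.length ≤ w.length + 1) :
    IsReg {p | ∃ w ∈ L, ∃ y ∈ L, P w y ∧ p = pad (enc w) (enc y)} := by
  have hL' : IsReg (L ∩ {[]}ᶜ) := hL.inter (isReg_nil.compl')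
  have hA := (pad_restrict pad h1 h2 P hP _ _ hL' hL').map
    (Prod.map (Option.map some) (Option.map some))
  have hF : {q : List γ × List γ | q.1 ∈ L ∧ q.2 ∈ L ∧ P q.1 q.2 ∧ q.1 = []}.Finite := by
    refine ((finite_lt γ 2).prod (finite_lt γ 2)).subset ?_
    rintro ⟨w, y⟩ ⟨_, _, h3, h4⟩
    simp only at h3 h4
    subst h4
    have := hlen _ _ h3
    simp only [List.length_nil] at this
    exact ⟨by simp, by simp; omega⟩
  refine (hA.union (isReg_finite (hF.image fun q => pad (enc q.1) (enc q.2)))).congr fun p => ?_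
  constructor
  · rintro ⟨w, hw, y, hy, h, rfl⟩
    by_cases hw0 : w = []
    · right; exact ⟨(w, y), ⟨hw, hy, h, hw0⟩, rfl⟩
    · left
      have hy0 : y ≠ [] := by
        rintro rfl
        have := (hlen _ _ h).1
        simp at this; exact hw0 this
      refine ⟨pad w y, ⟨w, ⟨hw, hw0⟩, y, ⟨hy, hy0⟩, h, rfl⟩, ?_⟩
      rw [← hm]; simp [enc, hw0, hy0]
  · rintro (⟨_, ⟨w, ⟨hw, hw0⟩, y, ⟨hy, hy0⟩, h, rfl⟩, rfl⟩ | ⟨⟨w, y⟩, ⟨hw, hy, h, _⟩, rfl⟩)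
    · refine ⟨w, hw, y, hy, h, ?_⟩
      have hw0' : w ≠ [] := hw0
      have hy0' : y ≠ [] := hy0
      rw [← hm]; simp [enc, hw0', hy0']
    · exact ⟨w, hw, y, hy, h, rfl⟩

def revE {γ : Type} (E : List γ → List γ → Prop) (x y : List γ) : Prop := E x.reverse y.reverse

theorem Cong.rev {γ : Type} {E : List γ → List γ → Prop} (h : Cong E) : Cong (revE E) where
  refl x := h.refl _
  symm x y := h.symm _ _
  trans x y z := h.trans _ _ _
  app p s x y e := by
    have := h.app s.reverse p.reverse _ _ e
    simpa [revE] using this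

structure Good {γ : Type} (E : List γ → List γ → Prop) (L : Set (List γ)) (k : ℕ) : Prop where
  reg : IsReg L
  nil : [] ∈ L
  pre : ∀ z ∈ L, ∀ y, y <+: z → y ∈ L
  uniq : ∀ x ∈ L, ∀ y ∈ L, E x y → x = y
  swr : ∀ w ∈ L, ∀ t, ∃ y ∈ L, SwR E k t w y
  swl : ∀ w ∈ L, ∀ t, ∃ y ∈ L, SwR (revE E) k t w.reverse y.reverse

theorem WordEq.cong {γ : Type} (R : Set (List γ × List γ)) : Cong (WordEq R) where
  refl x := Relation.EqvGen.refl x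
  symm x y h := Relation.EqvGen.symm _ _ h
  trans x y z h1 h2 := Relation.EqvGen.trans _ _ _ h1 h2
  app p s x y h := by
    induction h with
    | rel x y h =>
      obtain ⟨p', u, v, s', h, rfl, rfl⟩ := h
      exact Relation.EqvGen.rel _ _ ⟨p ++ p', u, v, s' ++ s, h, by simp, by simp⟩
    | refl x => exact Relation.EqvGen.refl _
    | symm x y _ ih => exact Relation.EqvGen.symm _ _ ih
    | trans x y z _ _ h1 h2 => exact Relation.EqvGen.trans _ _ _ h1 h2

theorem WordEq.len {γ : Type} {R : Set (List γ × List γ)}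
    (hR : ∀ u v, (u, v) ∈ R → u.length = v.length) {x y : List γ} (h : WordEq R x y) :
    x.length = y.length := by
  induction h with
  | rel x y h =>
    obtain ⟨p', u, v, s', h, rfl, rfl⟩ := h
    simp [hR u v h]
  | refl x => rfl
  | symm x y _ ih => exact ih.symm
  | trans x y z _ _ h1 h2 => exact h1.trans h2

theorem WordEq.rule {γ : Type} {R : Set (List γ × List γ)} {u v : List γ} (h : (u, v) ∈ R) :
    WordEq R u v := Relation.EqvGen.rel _ _ ⟨[], u, v, [], h, by simp, by simp⟩

/-- if every rule of `R` holds in a congruence, then so does `WordEq R` -/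
theorem WordEq.le {γ : Type} {R : Set (List γ × List γ)} {E : List γ → List γ → Prop}
    (hE : Cong E) (hR : ∀ u v, (u, v) ∈ R → E u v) {x y : List γ} (h : WordEq R x y) : E x y := by
  induction h with
  | rel x y h =>
    obtain ⟨p', u, v, s', h, rfl, rfl⟩ := h
    exact hE.app _ _ _ _ (hR _ _ h)
  | refl x => exact hE.refl _
  | symm x y _ ih => exact hE.symm _ _ ih
  | trans x y z _ _ h1 h2 => exact hE.trans _ _ _ h1 h2

section
variable {α : Type} [Finite α] {R : Set (List α × List α)} {L : Set (List α)} {k : ℕ}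

theorem Good.mulR (hG : Good (WordEq R) L k) (t : α) {w y : List α} (hw : w ∈ L) (hy : y ∈ L) :
    WordEq R (w ++ [t]) y ↔ SwR (WordEq R) k t w y := by
  constructor
  · intro h
    obtain ⟨y', hy', h'⟩ := hG.swr w hw t
    have := (h'.sound (WordEq.cong R)).1
    rw [hG.uniq y hy y' hy' ((WordEq.cong R).trans _ _ _ ((WordEq.cong R).symm _ _ h) this)]
    exact h'
  · intro h; exact (h.sound (WordEq.cong R)).1

theorem Good.mulL (hG : Good (WordEq R) L k) (t : α) {w y : List α} (hw : w ∈ L) (hy : y ∈ L) :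
    WordEq R ([t] ++ w) y ↔ SwR (revE (WordEq R)) k t w.reverse y.reverse := by
  have key : ∀ y', SwR (revE (WordEq R)) k t w.reverse y'.reverse → WordEq R ([t] ++ w) y' := by
    intro y' h'
    have := (h'.sound (WordEq.cong R).rev).1
    simpa [revE] using this
  constructor
  · intro h
    obtain ⟨y', hy', h'⟩ := hG.swl w hw t
    rw [hG.uniq y hy y' hy' ((WordEq.cong R).trans _ _ _ ((WordEq.cong R).symm _ _ h) (key y' h'))]
    exact h'
  · exact key y

theorem sw_regL_rev (E : List α → List α → Prop) (k : ℕ) (t : α) :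
    IsReg {p | ∃ w y, SwR E k t w.reverse y.reverse ∧ p = padL w y} := by
  refine (sw_regR E k t).rev.congr fun p => ?_
  constructor
  · rintro ⟨w, y, h, rfl⟩
    exact ⟨_, _, h, by rw [padL_eq_rev]; simp⟩
  · rintro ⟨w, y, h, e⟩
    refine ⟨w.reverse, y.reverse, by simpa using h, ?_⟩
    rw [padL_eq_rev, List.reverse_reverse, List.reverse_reverse, ← e, List.reverse_reverse]

theorem sw_regR_rev (E : List α → List α → Prop) (k : ℕ) (t : α) :
    IsReg {p | ∃ w y, SwR E k t w.reverse y.reverse ∧ p = padR w y} := by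
  refine (sw_regL E k t).rev.congr fun p => ?_
  constructor
  · rintro ⟨w, y, h, rfl⟩
    exact ⟨_, _, h, by rw [padR_eq_rev]; simp⟩
  · rintro ⟨w, y, h, e⟩
    refine ⟨w.reverse, y.reverse, by simpa using h, ?_⟩
    rw [padR_eq_rev, List.reverse_reverse, List.reverse_reverse, ← e, List.reverse_reverse]

theorem Good.eq_reg (hG : Good (WordEq R) L k)
    (pad : List (Option α) → List (Option α) → List (Option (Option α) × Option (Option α)))
    (hp : ∀ x, pad x x = x.map fun c => (some c, some c)) :
    IsReg {p | ∃ x ∈ enc '' L, ∃ y ∈ enc '' L,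
      WordEq R (expandW gen x) (expandW gen y) ∧ p = pad x y} := by
  refine ((enc_reg hG.reg).map fun c => (some c, some c)).congr fun p => ?_
  constructor
  · rintro ⟨_, ⟨w, hw, rfl⟩, _, ⟨y, hy, rfl⟩, h, rfl⟩
    rw [expandW_enc, expandW_enc] at h
    obtain rfl := hG.uniq _ hw _ hy h
    exact ⟨_, ⟨w, hw, rfl⟩, hp _⟩
  · rintro ⟨_, ⟨w, hw, rfl⟩, rfl⟩
    exact ⟨_, ⟨w, hw, rfl⟩, _, ⟨w, hw, rfl⟩, (WordEq.cong R).refl _, (hp _).symm⟩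

theorem Good.mulR_reg (hG : Good (WordEq R) L k)
    (pad : ∀ {δ : Type}, List δ → List δ → List (Option δ × Option δ))
    (h1 : ∀ {δ : Type} (x y : List δ), (pad x y).filterMap Prod.fst = x)
    (h2 : ∀ {δ : Type} (x y : List δ), (pad x y).filterMap Prod.snd = y)
    (hm : ∀ (x y : List α), pad (x.map some) (y.map some) =
      (pad x y).map (Prod.map (Option.map some) (Option.map some)))
    (hp : ∀ x : List (Option α), pad x x = x.map fun c => (some c, some c))
    (hs : ∀ t, IsReg {p | ∃ w y, SwR (WordEq R) k t w y ∧ p = pad w y}) (b : Option α) :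
    IsReg {p | ∃ x ∈ enc '' L, ∃ y ∈ enc '' L,
      WordEq R (expandW gen x ++ gen b) (expandW gen y) ∧ p = pad x y} := by
  cases b with
  | none => simpa only [gen, List.append_nil] using hG.eq_reg pad hp
  | some t =>
    refine (enc_rel_reg pad h1 h2 hm _ L hG.reg (hs t) ?_).congr fun p => ?_
    · intro w y h
      have := (h.sound (WordEq.cong R)).2
      omega
    · constructor
      · rintro ⟨_, ⟨w, hw, rfl⟩, _, ⟨y, hy, rfl⟩, h, rfl⟩
        rw [expandW_enc, expandW_enc] at h
        exact ⟨w, hw, y, hy, (hG.mulR t hw hy).1 h, rfl⟩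
      · rintro ⟨w, hw, y, hy, h, rfl⟩
        refine ⟨_, ⟨w, hw, rfl⟩, _, ⟨y, hy, rfl⟩, ?_, rfl⟩
        rw [expandW_enc, expandW_enc]
        exact (hG.mulR t hw hy).2 h

theorem Good.mulL_reg (hG : Good (WordEq R) L k)
    (pad : ∀ {δ : Type}, List δ → List δ → List (Option δ × Option δ))
    (h1 : ∀ {δ : Type} (x y : List δ), (pad x y).filterMap Prod.fst = x)
    (h2 : ∀ {δ : Type} (x y : List δ), (pad x y).filterMap Prod.snd = y)
    (hm : ∀ (x y : List α), pad (x.map some) (y.map some) =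
      (pad x y).map (Prod.map (Option.map some) (Option.map some)))
    (hp : ∀ x : List (Option α), pad x x = x.map fun c => (some c, some c))
    (hs : ∀ t, IsReg {p | ∃ w y, SwR (revE (WordEq R)) k t w.reverse y.reverse ∧ p = pad w y})
    (b : Option α) :
    IsReg {p | ∃ x ∈ enc '' L, ∃ y ∈ enc '' L,
      WordEq R (gen b ++ expandW gen x) (expandW gen y) ∧ p = pad x y} := by
  cases b with
  | none => simpa only [gen, List.nil_append] using hG.eq_reg pad hp
  | some t =>
    refine (enc_rel_reg pad h1 h2 hm _ L hG.reg (hs t) ?_).congr fun p => ?_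
    · intro w y h
      have := (h.sound (WordEq.cong R).rev).2
      simp only [List.length_reverse] at this
      omega
    · constructor
      · rintro ⟨_, ⟨w, hw, rfl⟩, _, ⟨y, hy, rfl⟩, h, rfl⟩
        rw [expandW_enc, expandW_enc] at h
        exact ⟨w, hw, y, hy, (hG.mulL t hw hy).1 h, rfl⟩
      · rintro ⟨w, hw, y, hy, h, rfl⟩
        refine ⟨_, ⟨w, hw, rfl⟩, _, ⟨y, hy, rfl⟩, ?_, rfl⟩
        rw [expandW_enc, expandW_enc]
        exact (hG.mulL t hw hy).2 h

theorem Good.onto (hG : Good (WordEq R) L k) (w : List α) : ∃ x ∈ L, WordEq R x w := by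
  induction w using List.reverseRecOn with
  | nil => exact ⟨[], hG.nil, (WordEq.cong R).refl _⟩
  | append_singleton w t ih =>
    obtain ⟨x, hx, h⟩ := ih
    obtain ⟨y, hy, h'⟩ := hG.swr x hx t
    refine ⟨y, hy, (WordEq.cong R).trans _ _ _ ((WordEq.cong R).symm _ _
      (h'.sound (WordEq.cong R)).1) ((WordEq.cong R).right h _)⟩

theorem Good.onto' (hG : Good (WordEq R) L k) (w : List α) :
    ∃ x ∈ enc '' L, WordEq R (expandW gen x) w := by
  obtain ⟨x, hx, h⟩ := hG.onto w
  exact ⟨enc x, ⟨x, hx, rfl⟩, by rwa [expandW_enc]⟩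

theorem enc_ne (L : Set (List α)) : ∀ w ∈ enc '' L, w ≠ [] := by
  rintro _ ⟨w, hw, rfl⟩
  unfold enc
  split
  · simp
  · next h => simpa using h

theorem Good.pre_reg (hG : Good (WordEq R) L k)
    (hlen : ∀ x y, WordEq R x y → x.length = y.length) :
    IsReg {p | ∃ x ∈ enc '' L, ∃ y : List (Option α), (∃ z ∈ enc '' L, y <+: z) ∧
      WordEq R (expandW gen x) (expandW gen y) ∧ p = padR x y} := by
  refine ((hG.eq_reg padR padR_self).union
    (isReg_singleton (padR [none] ([] : List (Option α))))).congr fun p => ?_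
  constructor
  · rintro ⟨_, ⟨w, hw, rfl⟩, y, ⟨_, ⟨z, hz, rfl⟩, hy⟩, h, rfl⟩
    rw [expandW_enc] at h
    by_cases hy0 : y = []
    · right
      subst hy0
      have := hlen _ _ h
      have hw0 : w = [] := List.eq_nil_of_length_eq_zero this
      subst hw0
      rfl
    · left
      by_cases hz0 : z = []
      · subst hz0
        have : y = enc [] := by
          rw [enc, if_pos rfl] at hy ⊢
          cases y with
          | nil => exact absurd rfl hy0
          | cons c y =>
            rw [List.cons_prefix_cons] at hy
            obtain ⟨rfl, hy⟩ := hy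
            rw [List.prefix_nil.1 hy]
        subst this
        refine ⟨_, ⟨w, hw, rfl⟩, _, ⟨[], hG.nil, rfl⟩, ?_, rfl⟩
        rwa [expandW_enc]
      · rw [enc, if_neg hz0] at hy
        have hy' := List.prefix_iff_eq_take.1 hy
        rw [← List.map_take] at hy'
        have hz' : z.take y.length ∈ L := hG.pre z hz _ ⟨_, List.take_append_drop _ _⟩
        have hne : z.take y.length ≠ [] := by
          intro h0; rw [h0] at hy'; exact hy0 hy'
        refine ⟨_, ⟨w, hw, rfl⟩, y, ⟨_, hz', ?_⟩, ?_, rfl⟩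
        · rw [enc, if_neg hne]; exact hy'.symm
        · rwa [expandW_enc]
  · rintro (⟨x, hx, y, hy, h, rfl⟩ | rfl)
    · exact ⟨x, hx, y, ⟨y, hy, List.prefix_refl _⟩, h, rfl⟩
    · refine ⟨_, ⟨[], hG.nil, rfl⟩, [], ⟨_, ⟨[], hG.nil, rfl⟩, ⟨_, List.nil_append _⟩⟩, ?_, rfl⟩
      exact (WordEq.cong R).refl _

theorem Good.main (hG : Good (WordEq R) L k)
    (hlen : ∀ x y, WordEq R x y → x.length = y.length) :
    MonBiautomatic R ∧ MonPrefixAutomatic R := by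
  have := Fintype.ofFinite α
  have hRR := fun b => hG.mulR_reg padR padR_fst padR_snd (padR_map some) padR_self
    (fun t => sw_regR _ k t) b
  refine ⟨⟨Option α, inferInstance, gen, enc '' L, ?_⟩, ⟨Option α, inferInstance, gen, enc '' L, ?_⟩⟩
  · exact {
      reg := enc_reg hG.reg
      ne := enc_ne L
      onto := hG.onto'
      eqR_reg := hG.eq_reg padR padR_self
      eqL_reg := hG.eq_reg padL padL_self
      mulRR_reg := hRR
      mulLR_reg := fun b => hG.mulL_reg padR padR_fst padR_snd (padR_map some) padR_self
        (fun t => sw_regR_rev _ k t) b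
      mulRL_reg := fun b => hG.mulR_reg padL padL_fst padL_snd (padL_map some) padL_self
        (fun t => sw_regL _ k t) b
      mulLL_reg := fun b => hG.mulL_reg padL padL_fst padL_snd (padL_map some) padL_self
        (fun t => sw_regL_rev _ k t) b }
  · exact {
      reg := enc_reg hG.reg
      ne := enc_ne L
      onto := hG.onto'
      eq_reg := hG.eq_reg padR padR_self
      mul_reg := hRR
      pre_reg := hG.pre_reg hlen }

end

/-! ## Rewriting systems -/

section
variable {γ : Type}

abbrev St (T : List (List γ × List γ)) (x y : List γ) : Prop := OneStep {q | q ∈ T} x y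

abbrev Sts (T : List (List γ × List γ)) : List γ → List γ → Prop := Relation.ReflTransGen (St T)

def Joinable (T : List (List γ × List γ)) (x y : List γ) : Prop := ∃ z, Sts T x z ∧ Sts T y z

theorem St.app {T : List (List γ × List γ)} {x y : List γ} (h : St T x y) (p s : List γ) :
    St T (p ++ x ++ s) (p ++ y ++ s) := by
  obtain ⟨p', l, r, s', h, rfl, rfl⟩ := h
  exact ⟨p ++ p', l, r, s' ++ s, h, by simp, by simp⟩

theorem Sts.app {T : List (List γ × List γ)} {x y : List γ} (h : Sts T x y) (p s : List γ) :
    Sts T (p ++ x ++ s) (p ++ y ++ s) := by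
  induction h with
  | refl => exact Relation.ReflTransGen.refl
  | tail _ h ih => exact ih.tail (St.app h p s)

theorem Joinable.app {T : List (List γ × List γ)} {x y : List γ} (h : Joinable T x y)
    (p s : List γ) : Joinable T (p ++ x ++ s) (p ++ y ++ s) := by
  obtain ⟨z, h1, h2⟩ := h
  exact ⟨p ++ z ++ s, Sts.app h1 p s, Sts.app h2 p s⟩

theorem Joinable.symm {T : List (List γ × List γ)} {x y : List γ} (h : Joinable T x y) :
    Joinable T y x := by
  obtain ⟨z, h1, h2⟩ := h
  exact ⟨z, h2, h1⟩

def Crit (T : List (List γ × List γ)) : Prop :=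
  ∀ l1 r1 l2 r2, (l1, r1) ∈ T → (l2, r2) ∈ T → ∀ m s1 s2, l1 ++ s1 = m ++ l2 ++ s2 →
    m.length < l1.length → Joinable T (r1 ++ s1) (m ++ r2 ++ s2)

theorem local_conf_aux {T : List (List γ × List γ)} (hT : Crit T) {p1 l1 r1 s1 p2 l2 r2 s2 : List γ}
    (h1 : (l1, r1) ∈ T) (h2 : (l2, r2) ∈ T) (e : p1 ++ l1 ++ s1 = p2 ++ l2 ++ s2)
    (hp : p1.length ≤ p2.length) : Joinable T (p1 ++ r1 ++ s1) (p2 ++ r2 ++ s2) := by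
  obtain ⟨m, rfl⟩ : ∃ m, p2 = p1 ++ m := by
    have : p1 <+: p1 ++ l1 ++ s1 := ⟨l1 ++ s1, by simp⟩
    have h' : p2 <+: p1 ++ l1 ++ s1 := by rw [e]; exact ⟨l2 ++ s2, by simp⟩
    obtain ⟨m, hm⟩ := List.prefix_of_prefix_length_le this h' hp
    exact ⟨m, hm.symm⟩
  have e' : l1 ++ s1 = m ++ l2 ++ s2 := by simpa using e
  by_cases hm : m.length < l1.length
  · have := (hT l1 r1 l2 r2 h1 h2 m s1 s2 e' hm).app p1 []
    simpa using this
  · obtain ⟨m', rfl⟩ : ∃ m', m = l1 ++ m' := by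
      have h1 : l1 <+: l1 ++ s1 := ⟨s1, by simp⟩
      have h' : m <+: l1 ++ s1 := by rw [e']; exact ⟨l2 ++ s2, by simp⟩
      obtain ⟨m', hm⟩ := List.prefix_of_prefix_length_le h1 h' (by omega)
      exact ⟨m', hm.symm⟩
    have e'' : s1 = m' ++ l2 ++ s2 := by simpa using e'
    subst e''
    refine ⟨p1 ++ r1 ++ m' ++ r2 ++ s2, ?_, ?_⟩
    · refine Relation.ReflTransGen.single ⟨p1 ++ r1 ++ m', l2, r2, s2, h2, by simp, by simp⟩
    · refine Relation.ReflTransGen.single ⟨p1, l1, r1, m' ++ r2 ++ s2, h1, by simp, by simp⟩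

theorem local_conf {T : List (List γ × List γ)} (hT : Crit T) {x y z : List γ}
    (h1 : St T x y) (h2 : St T x z) : Joinable T y z := by
  obtain ⟨p1, l1, r1, s1, h1, rfl, rfl⟩ := h1
  obtain ⟨p2, l2, r2, s2, h2, e, rfl⟩ := h2
  rcases le_total p1.length p2.length with hp | hp
  · exact local_conf_aux hT h1 h2 e hp
  · exact (local_conf_aux hT h2 h1 e.symm hp).symm

theorem newman {T : List (List γ × List γ)} (hT : Crit T) (μ : List γ → ℕ)
    (hμ : ∀ x y, St T x y → μ y < μ x) :
    ∀ (n : ℕ) (x : List γ), μ x = n → ∀ y z, Sts T x y → Sts T x z → Joinable T y z := by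
  intro n
  induction n using Nat.strong_induction_on with
  | _ n ih =>
    intro x hx y z hy hz
    rcases Relation.ReflTransGen.cases_head hy with rfl | ⟨y1, hy1, hy2⟩
    · exact ⟨z, hz, Relation.ReflTransGen.refl⟩
    rcases Relation.ReflTransGen.cases_head hz with rfl | ⟨z1, hz1, hz2⟩
    · exact ⟨y, Relation.ReflTransGen.refl, hy⟩
    obtain ⟨w, hw1, hw2⟩ := local_conf hT hy1 hz1
    obtain ⟨a, ha1, ha2⟩ := ih _ (hx ▸ hμ _ _ hy1) y1 rfl y w hy2 hw1
    obtain ⟨b, hb1, hb2⟩ := ih _ (hx ▸ hμ _ _ hz1) z1 rfl a z (hw2.trans ha2) hz2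
    exact ⟨b, ha1.trans hb1, hb2⟩

theorem church_rosser' {T : List (List γ × List γ)} (hT : Crit T) (μ : List γ → ℕ)
    (hμ : ∀ x y, St T x y → μ y < μ x) {x y : List γ} (h : WordEq {q | q ∈ T} x y) :
    Joinable T x y := by
  induction h with
  | rel x y h => exact ⟨y, Relation.ReflTransGen.single h, Relation.ReflTransGen.refl⟩
  | refl x => exact ⟨x, Relation.ReflTransGen.refl, Relation.ReflTransGen.refl⟩
  | symm x y _ ih => exact ih.symm
  | trans x y z _ _ h1 h2 =>
    obtain ⟨a, ha1, ha2⟩ := h1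
    obtain ⟨b, hb1, hb2⟩ := h2
    obtain ⟨c, hc1, hc2⟩ := newman hT μ hμ _ y rfl a b ha2 hb1
    exact ⟨c, ha1.trans hc1, hb2.trans hc2⟩

theorem irr_sts {T : List (List γ × List γ)} {F : List (List γ)} (hF : ∀ l r, (l, r) ∈ T → l ∈ F)
    {x y : List γ} (hx : Irr F x) (h : Sts T x y) : x = y := by
  rcases Relation.ReflTransGen.cases_head h with rfl | ⟨y1, ⟨p, l, r, s, hl, rfl, _⟩, _⟩
  · rfl
  · exact absurd ⟨p, s, rfl⟩ (hx l (hF _ _ hl))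

/-- binary value of a word -/
def bval [DecidableEq γ] (z : γ) : List γ → ℕ
  | [] => 0
  | c :: w => (if c = z then 2 ^ w.length else 0) + bval z w

theorem bval_append [DecidableEq γ] (z : γ) (x y : List γ) :
    bval z (x ++ y) = bval z x * 2 ^ y.length + bval z y := by
  induction x with
  | nil => simp [bval]
  | cons c x ih =>
    simp only [List.cons_append, bval, ih, List.length_append]
    split
    · ring
    · ring

theorem rw_uniq [DecidableEq γ] {T : List (List γ × List γ)} {F : List (List γ)}
    (hF : ∀ l r, (l, r) ∈ T → l ∈ F) (hT : Crit T) (z : γ)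
    (hlen : ∀ l r, (l, r) ∈ T → l.length = r.length)
    (hz : ∀ l r, (l, r) ∈ T → bval z r < bval z l) {x y : List γ} (hx : Irr F x) (hy : Irr F y)
    (h : WordEq {q | q ∈ T} x y) : x = y := by
  have hμ : ∀ x y, St T x y → bval z y < bval z x := by
    rintro _ _ ⟨p, l, r, s, hl, rfl, rfl⟩
    have h1 := hz l r hl
    have h2 := hlen l r hl
    simp only [bval_append, h2, List.length_append]
    have : bval z r * 2 ^ s.length < bval z l * 2 ^ s.length :=
      Nat.mul_lt_mul_of_pos_right h1 (by positivity)
    nlinarith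
  obtain ⟨w, h1, h2⟩ := church_rosser' hT _ hμ h
  rw [irr_sts hF hx h1, irr_sts hF hy h2]

theorem Irr.factor {F : List (List γ)} {x y : List γ} (h : Irr F x) (e : y <:+: x) : Irr F y :=
  fun f hf hy => h f hf (hy.trans e)

theorem Irr.tail {F : List (List γ)} {c : γ} {x : List γ} (h : Irr F (c :: x)) : Irr F x :=
  h.factor (List.suffix_cons c x).isInfix

theorem Irr.cons {F : List (List γ)} {c : γ} {x : List γ} (h : Irr F x)
    (h' : ∀ f ∈ F, ¬ f <+: c :: x) : Irr F (c :: x) := by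
  intro f hf e
  rw [List.infix_cons_iff] at e
  rcases e with e | e
  · exact h' f hf e
  · exact h f hf e

theorem irr_cons_iff {F : List (List γ)} {c : γ} {x : List γ} :
    Irr F (c :: x) ↔ (∀ f ∈ F, ¬ f <+: c :: x) ∧ Irr F x :=
  ⟨fun h => ⟨fun f hf e => h f hf e.isInfix, h.tail⟩, fun h => h.2.cons h.1⟩

theorem irr_rev {F : List (List γ)} {x : List γ} :
    Irr F x.reverse ↔ Irr (F.map List.reverse) x := by
  constructor
  · intro h f hf e
    simp only [List.mem_map] at hf
    obtain ⟨f, hf, rfl⟩ := hf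
    exact h f hf (by simpa using List.IsInfix.reverse e)
  · intro h f hf e
    exact h f.reverse (List.mem_map_of_mem hf) (by simpa using List.IsInfix.reverse e)

theorem good_of_rw {R : Set (List γ × List γ)} {k : ℕ}
    (T : List (List γ × List γ)) (F : List (List γ))
    (hF0 : ∀ f ∈ F, f ≠ [])
    (hF : ∀ l r, (l, r) ∈ T → l ∈ F) (hT : Crit T) (z : γ)
    (hlen : ∀ l r, (l, r) ∈ T → l.length = r.length)
    (hz : ∀ [DecidableEq γ] l r, (l, r) ∈ T → bval z r < bval z l)
    (hR : ∀ u v, (u, v) ∈ R → WordEq {q | q ∈ T} u v)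
    (hr : ∀ w, Irr F w → ∀ t, ∃ y, Irr F y ∧ SwR (WordEq R) k t w y)
    (hl : ∀ w, Irr (F.map List.reverse) w → ∀ t, ∃ y, Irr (F.map List.reverse) y ∧
      SwR (revE (WordEq R)) k t w y) :
    Good (WordEq R) {w | Irr F w} k := by
  classical
  refine ⟨isReg_irr F, ?_, ?_, ?_, hr, ?_⟩
  · intro f hf e
    exact hF0 f hf (List.infix_nil.1 e)
  · intro z hz y hy
    exact Irr.factor hz hy.isInfix
  · intro x hx y hy h
    exact rw_uniq hF hT z hlen (fun l r h => hz l r h) hx hy (h.le (WordEq.cong _) hR)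
  · intro w hw t
    obtain ⟨y, hy, h⟩ := hl w.reverse (by
      have : Irr F w.reverse.reverse := by simpa using hw
      exact irr_rev.1 this) t
    refine ⟨y.reverse, irr_rev.2 hy, by simpa using h⟩

theorem step_end {T : List (List γ × List γ)} {l r : List γ} (h : (l, r) ∈ T) (p s : List γ) :
    Sts T (p ++ l ++ s) (p ++ r ++ s) :=
  Relation.ReflTransGen.single ⟨p, l, r, s, h, rfl, rfl⟩

end

/-! ## Type I -/

section
variable {γ : Type} {E : List γ → List γ → Prop}

theorem irr3_cons {a b c d : γ} {x : List γ} : Irr [[a, b, c]] (d :: x) ↔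
    ¬ (a = d ∧ ∃ s, x = b :: c :: s) ∧ Irr [[a, b, c]] x := by
  rw [irr_cons_iff]
  refine and_congr ?_ Iff.rfl
  simp only [List.mem_singleton, forall_eq, List.cons_prefix_cons]
  refine not_congr (and_congr Iff.rfl ?_)
  constructor
  · rintro ⟨s, rfl⟩; exact ⟨s, rfl⟩
  · rintro ⟨s, rfl⟩; exact ⟨s, rfl⟩

theorem irr3_nil {a b c : γ} : Irr [[a, b, c]] [] := by simp [Irr]

theorem sweepI (hE : Cong E) {u1 u2 u3 v1 v2 v3 : γ} (he : E [u1, u2, u3] [v1, v2, v3])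
    (hu : u1 ≠ u3) (huv : [u1, u2, u3] ≠ [v1, v2, v3]) (t : γ) (w : List γ)
    (hw : Irr [[u1, u2, u3]] w) :
    ∃ x, Irr [[u1, u2, u3]] x ∧ SwR E 6 t w x ∧ (x = w ++ [t] ∨ ∃ q r w', w = q ++ w' ∧
      x = q ++ [v1, v2, v3] ++ r ∧ (r = [] ∨ (∃ s, r = v3 :: s) ∨
        (u3 = v1 ∧ ∃ s, r = v2 :: v3 :: s))) := by
  induction w with
  | nil => exact ⟨[t], by simp [irr3_cons, irr3_nil], SwR.init hE (by simp) t [], Or.inl rfl⟩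
  | cons c w ih =>
    obtain ⟨x, hx, hs, hsh⟩ := ih hw.tail
    by_cases hc : Irr [[u1, u2, u3]] (c :: x)
    · refine ⟨c :: x, hc, hs.copy hE [c], ?_⟩
      rcases hsh with rfl | ⟨q, r, w', rfl, rfl, h⟩
      · exact Or.inl rfl
      · exact Or.inr ⟨c :: q, r, w', rfl, rfl, h⟩
    · rw [irr3_cons] at hc
      simp only [hx, and_true, not_not] at hc
      obtain ⟨rfl, x', rfl⟩ := hc
      have hs' : SwR E 6 t (u1 :: w) ([v1, v2, v3] ++ x') :=
        SwR.step' hE u1 [u2, u3] x' [v1, v2, v3] hs (by simp) (by simp) he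
      simp only [irr3_cons] at hw hx ⊢
      rcases hsh with e | ⟨q, r, w', rfl, e, h⟩
      · have : x' = [] := by
          rcases w with _ | ⟨w1, _ | ⟨w2, w⟩⟩
          · simp at e
          · simp at e; exact e.2.2
          · simp at e
            obtain ⟨rfl, rfl, rfl⟩ := e
            simp at hw
        subst this
        refine ⟨_, ?_, hs', Or.inr ⟨[], [], u1 :: w, rfl, rfl, Or.inl rfl⟩⟩
        simp [irr3_cons, irr3_nil]
        grind
      · rcases q with _ | ⟨q1, _ | ⟨q2, q⟩⟩
        · simp at e
          obtain ⟨rfl, rfl, rfl⟩ := e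
          refine ⟨_, ?_, hs', Or.inr ⟨[], v3 :: r, _, rfl, rfl, Or.inr (Or.inl ⟨r, rfl⟩)⟩⟩
          simp [irr3_cons, irr3_nil] at hx ⊢
          grind
        · simp at e
          obtain ⟨rfl, rfl, rfl⟩ := e
          refine ⟨_, ?_, hs', Or.inr ⟨[], v2 :: v3 :: r, _, rfl, rfl,
            Or.inr (Or.inr ⟨rfl, r, rfl⟩)⟩⟩
          simp [irr3_cons, irr3_nil] at hx ⊢
          grind
        · simp at e
          obtain ⟨rfl, rfl, rfl⟩ := e
          simp at hw

theorem sweepII (hE : Cong E) {a b c : γ} (he : E [a, b, a] [a, c, a])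
    (hab : a ≠ b) (hbc : b ≠ c) (t : γ) (w : List γ)
    (hw : Irr [[a, b, a]] w) :
    ∃ x, Irr [[a, b, a]] x ∧ SwR E 6 t w x ∧ (x = w ++ [t] ∨ ∃ q, w = q ++ [a, b] ∧
      x = q ++ [a, c, a]) := by
  induction w with
  | nil => exact ⟨[t], by simp [irr3_cons, irr3_nil], SwR.init hE (by simp) t [], Or.inl rfl⟩
  | cons l w ih =>
    obtain ⟨x, hx, hs, hsh⟩ := ih hw.tail
    by_cases hc : Irr [[a, b, a]] (l :: x)
    · refine ⟨l :: x, hc, hs.copy hE [l], ?_⟩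
      rcases hsh with rfl | ⟨q, rfl, rfl⟩
      · exact Or.inl rfl
      · exact Or.inr ⟨l :: q, rfl, rfl⟩
    · rw [irr3_cons] at hc
      simp only [hx, and_true, not_not] at hc
      obtain ⟨rfl, x', rfl⟩ := hc
      have hs' : SwR E 6 t (a :: w) ([a, c, a] ++ x') :=
        SwR.step' hE a [b, a] x' [a, c, a] hs (by simp) (by simp) he
      simp only [irr3_cons] at hw hx ⊢
      rcases hsh with e | ⟨q, rfl, e⟩
      · rcases w with _ | ⟨w1, _ | ⟨w2, w⟩⟩
        · simp at e
        · simp at e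
          obtain ⟨rfl, rfl, rfl⟩ := e
          refine ⟨_, ?_, hs', Or.inr ⟨[], rfl, rfl⟩⟩
          simp [irr3_cons, irr3_nil]
          grind
        · simp at e
          obtain ⟨rfl, rfl, rfl⟩ := e
          simp at hw
      · rcases q with _ | ⟨q1, _ | ⟨q2, q⟩⟩
        · simp at e; grind
        · simp at e
          exfalso; obtain ⟨rfl, rfl⟩ := e; simp at hw
        · simp at e
          obtain ⟨rfl, rfl, rfl⟩ := e
          simp at hw

theorem goodI {R : Set (List γ × List γ)} {u1 u2 u3 v1 v2 v3 : γ}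
    (hu : u1 ≠ u3) (huv : [u1, u2, u3] ≠ [v1, v2, v3])
    (hR : R = {([u1, u2, u3], [v1, v2, v3])} ∨ R = {([v1, v2, v3], [u1, u2, u3])}) :
    Good (WordEq R) {w | Irr [[u1, u2, u3]] w} 6 := by
  have he : WordEq R [u1, u2, u3] [v1, v2, v3] := by
    rcases hR with rfl | rfl
    · exact WordEq.rule rfl
    · exact (WordEq.cong _).symm _ _ (WordEq.rule rfl)
  obtain ⟨z, hz⟩ : ∃ z, ∀ [DecidableEq γ], bval z [v1, v2, v3] < bval z [u1, u2, u3] := by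
    by_cases h1 : u1 = v1
    · by_cases h2 : u2 = v2
      · refine ⟨u3, ?_⟩
        intro _
        have : v3 ≠ u3 := by grind
        simp [bval, this, h1, h2]
      · refine ⟨u2, ?_⟩
        intro _
        have : v2 ≠ u2 := by grind
        simp [bval, this, h1]
        grind
    · refine ⟨u1, ?_⟩
      intro _
      have : v1 ≠ u1 := by grind
      simp [bval, this]
      grind
  refine good_of_rw [([u1, u2, u3], [v1, v2, v3])] [[u1, u2, u3]] ?_ ?_ ?_ z ?_ ?_ ?_ ?_ ?_
  · simp
  · simp
  · intro l1 r1 l2 r2 h1 h2 m s1 s2 e hm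
    simp only [List.mem_singleton, Prod.mk.injEq] at h1 h2
    obtain ⟨rfl, rfl⟩ := h1
    obtain ⟨rfl, rfl⟩ := h2
    rcases m with _ | ⟨m1, _ | ⟨m2, _ | ⟨m3, m⟩⟩⟩
    · simp at e; subst e
      exact ⟨_, Relation.ReflTransGen.refl, Relation.ReflTransGen.refl⟩
    · simp at e; grind
    · simp at e; grind
    · simp at hm; omega
  · simp
  · simpa using @hz
  · intro u v h
    rcases hR with rfl | rfl
    · simp only [Set.mem_singleton_iff, Prod.mk.injEq] at h
      obtain ⟨rfl, rfl⟩ := h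
      exact WordEq.rule (by simp)
    · simp only [Set.mem_singleton_iff, Prod.mk.injEq] at h
      obtain ⟨rfl, rfl⟩ := h
      exact (WordEq.cong _).symm _ _ (WordEq.rule (by simp))
  · intro w hw t
    obtain ⟨x, h1, h2, _⟩ := sweepI (WordEq.cong R) he hu huv t w hw
    exact ⟨x, h1, h2⟩
  · intro w hw t
    obtain ⟨x, h1, h2, _⟩ := sweepI (E := revE (WordEq R)) (u1 := u3) (u2 := u2) (u3 := u1)
      (v1 := v3) (v2 := v2) (v3 := v1) (WordEq.cong R).rev (by simpa [revE] using he) hu.symm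
      (by grind) t w (by simpa using hw)
    exact ⟨x, by simpa using h1, h2⟩

theorem goodII {R : Set (List γ × List γ)} {a b c : γ}
    (hab : a ≠ b) (hbc : b ≠ c)
    (hR : R = {([a, b, a], [a, c, a])} ∨ R = {([a, c, a], [a, b, a])}) :
    Good (WordEq R) {w | Irr [[a, b, a]] w} 6 := by
  have he : WordEq R [a, b, a] [a, c, a] := by
    rcases hR with rfl | rfl
    · exact WordEq.rule rfl
    · exact (WordEq.cong _).symm _ _ (WordEq.rule rfl)
  refine good_of_rw [([a, b, a], [a, c, a])] [[a, b, a]] ?_ ?_ ?_ b ?_ ?_ ?_ ?_ ?_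
  · simp
  · simp
  · intro l1 r1 l2 r2 h1 h2 m s1 s2 e hm
    simp only [List.mem_singleton, Prod.mk.injEq] at h1 h2
    obtain ⟨rfl, rfl⟩ := h1
    obtain ⟨rfl, rfl⟩ := h2
    rcases m with _ | ⟨m1, _ | ⟨m2, _ | ⟨m3, m⟩⟩⟩
    · simp at e; subst e
      exact ⟨_, Relation.ReflTransGen.refl, Relation.ReflTransGen.refl⟩
    · simp at e; grind
    · simp at e
      obtain ⟨rfl, rfl, rfl⟩ := e
      exact ⟨[a, c, a, c, a] ++ s2, step_end (l := [a, b, a]) (r := [a, c, a]) (by simp) [a, c] s2, step_end (l := [a, b, a]) (r := [a, c, a]) (by simp) [] (c :: a :: s2)⟩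
    · simp at hm; omega
  · simp
  · intro _ l r h
    simp only [List.mem_singleton, Prod.mk.injEq] at h
    obtain ⟨rfl, rfl⟩ := h
    simp [bval, hab, hbc.symm]
  · intro u v h
    rcases hR with rfl | rfl
    · simp only [Set.mem_singleton_iff, Prod.mk.injEq] at h
      obtain ⟨rfl, rfl⟩ := h
      exact WordEq.rule (by simp)
    · simp only [Set.mem_singleton_iff, Prod.mk.injEq] at h
      obtain ⟨rfl, rfl⟩ := h
      exact (WordEq.cong _).symm _ _ (WordEq.rule (by simp))
  · intro w hw t
    obtain ⟨x, h1, h2, _⟩ := sweepII (WordEq.cong R) he hab hbc t w hw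
    exact ⟨x, h1, h2⟩
  · intro w hw t
    obtain ⟨x, h1, h2, _⟩ := sweepII (E := revE (WordEq R)) (a := a) (b := b) (c := c)
      (WordEq.cong R).rev (by simpa [revE] using he) hab hbc t w (by simpa using hw)
    exact ⟨x, by simpa using h1, h2⟩

end

/-! ## Types III and IV -/

section
variable {γ : Type} {E : List γ → List γ → Prop}

theorem irr2_cons {f g : List γ} {d : γ} {x : List γ} : Irr [f, g] (d :: x) ↔
    ¬ f <+: d :: x ∧ ¬ g <+: d :: x ∧ Irr [f, g] x := by
  rw [irr_cons_iff]
  simp [and_assoc]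

theorem irr2_nil {f g : List γ} (hf : f ≠ []) (hg : g ≠ []) : Irr [f, g] [] := by
  simp [Irr, hf, hg]

theorem last_red {F : List (List γ)} {l t : γ} {w f : List γ} (hw : Irr F (l :: w)) (hf : f ∈ F)
    (h : f <+: l :: (w ++ [t])) : f = l :: (w ++ [t]) := by
  rw [← List.cons_append, List.prefix_concat_iff] at h
  rcases h with h | h
  · simpa using h
  · exact absurd h.isInfix (hw f hf)

theorem eqIV (hE : Cong E) {a c : γ} (he : E [a, a, a] [c, c, c]) :
    E [a, c, c, c] [c, c, c, a] :=
  hE.trans _ _ _ (hE.left (hE.symm _ _ he) [a]) (hE.right he [a])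

theorem eqIII (hE : Cong E) {a b c d : γ} (he : E [a, b, a] [c, d, c]) :
    E [a, b, c, d, c] [c, d, c, b, a] :=
  hE.trans _ _ _ (hE.left (hE.symm _ _ he) [a, b]) (hE.right he [b, a])

theorem sweepIV (hE : Cong E) {a c : γ} (he : E [a, a, a] [c, c, c]) (hac : a ≠ c)
    (t : γ) (w : List γ) (hw : Irr [[a, a, a], [a, c, c, c]] w) :
    ∃ x, Irr [[a, a, a], [a, c, c, c]] x ∧ SwR E 6 t w x ∧ (x = w ++ [t] ∨
      ∃ q r w', w = q ++ a :: w' ∧ x = q ++ [c, c, c] ++ r ∧ (r = [] ∨ ∃ s, r = a :: s ∧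
        (∀ s', s = a :: s' → ∃ w'', w' = a :: w''))) := by
  have he2 := eqIV hE he
  induction w with
  | nil =>
    exact ⟨[t], by simp [irr2_cons, irr2_nil], SwR.init hE (by simp) t [], Or.inl rfl⟩
  | cons l w ih =>
    obtain ⟨x, hx, hs, hsh⟩ := ih hw.tail
    by_cases hc : Irr [[a, a, a], [a, c, c, c]] (l :: x)
    · refine ⟨l :: x, hc, hs.copy hE [l], ?_⟩
      rcases hsh with rfl | ⟨q, r, w', rfl, rfl, h⟩
      · exact Or.inl rfl
      · exact Or.inr ⟨l :: q, r, w', rfl, rfl, h⟩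
    · rw [irr2_cons] at hc
      rcases hsh with rfl | ⟨q, r, w', rfl, rfl, h⟩
      · by_cases h1 : [a, a, a] <+: l :: (w ++ [t])
        · have := last_red hw (by simp) h1
          simp only [List.cons.injEq] at this
          obtain ⟨rfl, e⟩ := this
          rw [← e] at hs
          refine ⟨_, ?_, SwR.step' hE a [a, a] [] [c, c, c] hs (by simp) (by simp) he,
            Or.inr ⟨[], [], w, by simp, by simp, Or.inl rfl⟩⟩
          simp [irr2_cons, irr2_nil, hac]
        · have h1 : [a, c, c, c] <+: l :: (w ++ [t]) := by tauto
          have := last_red hw (by simp) h1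
          simp only [List.cons.injEq] at this
          obtain ⟨rfl, e⟩ := this
          rw [← e] at hs
          refine ⟨_, ?_, SwR.step' hE a [c, c, c] [] [c, c, c, a] hs (by simp) (by simp) he2,
            Or.inr ⟨[], [a], w, by simp, by simp, Or.inr ⟨[], by simp⟩⟩⟩
          simp [irr2_cons, irr2_nil, hac]
      · rcases q with _ | ⟨q1, _ | ⟨q2, _ | ⟨q3, q⟩⟩⟩
        · simp [irr2_cons, irr2_nil, hac] at hc hx hw hs
          obtain rfl : a = l := by grind
          refine ⟨_, ?_, SwR.step' hE a [c, c, c] r [c, c, c, a] hs (by simp) (by simp) he2,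
            Or.inr ⟨[], a :: r, _, rfl, rfl, Or.inr ⟨r, rfl, ?_⟩⟩⟩
          · rcases h with rfl | ⟨s, rfl, h⟩
            · simp [irr2_cons, irr2_nil, hac]
            · rcases s with _ | ⟨s1, s⟩
              · simp [irr2_cons, irr2_nil, hac]
              · simp [irr2_cons, irr2_nil, hac, hac.symm] at hw hx ⊢
                grind
          · rintro s' rfl; exact ⟨_, rfl⟩
        · simp [irr2_cons, irr2_nil, hac] at hc hx hw hs
          obtain ⟨rfl, rfl⟩ : a = l ∧ c = q1 := by grind
          refine ⟨_, ?_, SwR.step' hE a [c, c, c] (c :: r) [c, c, c, a] hs (by simp) (by simp) he2,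
            Or.inr ⟨[], a :: c :: r, _, rfl, rfl, Or.inr ⟨c :: r, rfl, ?_⟩⟩⟩
          · simp [irr2_cons, irr2_nil, hac, hac.symm] at hw hx ⊢
            rcases h with rfl | ⟨s, rfl, h⟩ <;> simp [irr2_nil, hac, hac.symm, hx]
          · grind
        · simp [irr2_cons, irr2_nil, hac] at hc hx hw hs
          obtain ⟨rfl, rfl, rfl⟩ : a = l ∧ c = q1 ∧ c = q2 := by grind
          refine ⟨_, ?_, SwR.step' hE a [c, c, c] (c :: c :: r) [c, c, c, a] hs (by simp) (by simp) he2,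
            Or.inr ⟨[], a :: c :: c :: r, _, rfl, rfl, Or.inr ⟨c :: c :: r, rfl, ?_⟩⟩⟩
          · simp [irr2_cons, irr2_nil, hac, hac.symm] at hw hx ⊢
            rcases h with rfl | ⟨s, rfl, h⟩ <;> simp [irr2_nil, hac, hac.symm, hx]
          · grind
        · exfalso
          simp [irr2_cons, irr2_nil, hac] at hc hx hw
          grind

theorem sweepIV' (hE : Cong E) {a c : γ} (he : E [a, a, a] [c, c, c]) (hac : a ≠ c)
    (t : γ) (w : List γ) (hw : Irr [[a, a, a], [c, c, c, a]] w) :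
    ∃ x, Irr [[a, a, a], [c, c, c, a]] x ∧ SwR E 6 t w x ∧ (x = w ++ [t] ∨
      (∃ q r w', w = q ++ w' ∧ x = q ++ [c, c, c] ++ r) ∨
      (∃ q r w', w = q ++ w' ∧ x = q ++ [a, c, c, c] ++ r)) := by
  have he2 := hE.symm _ _ (eqIV hE he)
  induction w with
  | nil =>
    exact ⟨[t], by simp [irr2_cons, irr2_nil], SwR.init hE (by simp) t [], Or.inl rfl⟩
  | cons l w ih =>
    obtain ⟨x, hx, hs, hsh⟩ := ih hw.tail
    by_cases hc : Irr [[a, a, a], [c, c, c, a]] (l :: x)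
    · refine ⟨l :: x, hc, hs.copy hE [l], ?_⟩
      rcases hsh with rfl | ⟨q, r, w', rfl, rfl⟩ | ⟨q, r, w', rfl, rfl⟩
      · exact Or.inl rfl
      · exact Or.inr (Or.inl ⟨l :: q, r, w', rfl, rfl⟩)
      · exact Or.inr (Or.inr ⟨l :: q, r, w', rfl, rfl⟩)
    · rw [irr2_cons] at hc
      rcases hsh with rfl | ⟨q, r, w', rfl, rfl⟩ | ⟨q, r, w', rfl, rfl⟩
      · by_cases h1 : [a, a, a] <+: l :: (w ++ [t])
        · have := last_red hw (by simp) h1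
          simp only [List.cons.injEq] at this
          obtain ⟨rfl, e⟩ := this
          rw [← e] at hs
          refine ⟨_, ?_, SwR.step' hE a [a, a] [] [c, c, c] hs (by simp) (by simp) he,
            Or.inr (Or.inl ⟨[], [], a :: w, by simp, by simp⟩)⟩
          simp [irr2_cons, irr2_nil, hac]
        · have h1 : [c, c, c, a] <+: l :: (w ++ [t]) := by tauto
          have := last_red hw (by simp) h1
          simp only [List.cons.injEq] at this
          obtain ⟨rfl, e⟩ := this
          rw [← e] at hs
          refine ⟨_, ?_, SwR.step' hE c [c, c, a] [] [a, c, c, c] hs (by simp) (by simp) he2,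
            Or.inr (Or.inr ⟨[], [], c :: w, by simp, by simp⟩)⟩
          simp [irr2_cons, irr2_nil, hac]
      · exfalso
        rcases q with _ | ⟨q1, _ | ⟨q2, _ | ⟨q3, q⟩⟩⟩ <;>
        · simp [irr2_cons, irr2_nil, hac] at hc hx hw
          grind
      · rcases q with _ | ⟨q1, _ | ⟨q2, _ | ⟨q3, q⟩⟩⟩
        · exfalso
          simp [irr2_cons, irr2_nil, hac, hac.symm] at hc hx hw
          grind
        · simp [irr2_cons, irr2_nil, hac, hac.symm] at hc hx hw hs
          obtain ⟨rfl, rfl⟩ : a = l ∧ a = q1 := by grind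
          refine ⟨_, ?_, SwR.step' hE a [a, a] (c :: c :: c :: r) [c, c, c] hs (by simp) (by simp) he,
            Or.inr (Or.inl ⟨[], c :: c :: c :: r, _, rfl, rfl⟩)⟩
          simp [irr2_cons, irr2_nil, hac, hac.symm] at hw hx ⊢
          grind
        · simp [irr2_cons, irr2_nil, hac, hac.symm] at hc hx hw hs
          obtain ⟨rfl, rfl, rfl⟩ : c = l ∧ c = q1 ∧ c = q2 := by grind
          refine ⟨_, ?_, SwR.step' hE c [c, c, a] (c :: c :: c :: r) [a, c, c, c] hs (by simp) (by simp) he2,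
            Or.inr (Or.inr ⟨[], c :: c :: c :: r, _, rfl, rfl⟩)⟩
          simp [irr2_cons, irr2_nil, hac, hac.symm] at hw hx ⊢
          grind
        · exfalso
          simp [irr2_cons, irr2_nil, hac, hac.symm] at hc hx hw
          grind

theorem sweepIII (hE : Cong E) {a b c d : γ} (he : E [a, b, a] [c, d, c]) (hab : a ≠ b)
    (hac : a ≠ c) (hd : ¬ (d = a ∧ c = b))
    (t : γ) (w : List γ) (hw : Irr [[a, b, a], [a, b, c, d, c]] w) :
    ∃ x, Irr [[a, b, a], [a, b, c, d, c]] x ∧ SwR E 6 t w x ∧ (x = w ++ [t] ∨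
      ∃ q r w', w = q ++ a :: w' ∧ x = q ++ [c, d, c] ++ r ∧ (r = [] ∨ ∃ s, r = b :: a :: s)) := by
  have he2 := eqIII hE he
  have red : ∀ l x, ¬ Irr [[a, b, a], [a, b, c, d, c]] (l :: x) →
      Irr [[a, b, a], [a, b, c, d, c]] x → a = l ∧ ((∃ s, x = b :: a :: s) ∨
        ∃ s, x = b :: c :: d :: c :: s) := by
    intro l x h1 h2
    rw [irr2_cons] at h1
    by_cases h3 : [a, b, a] <+: l :: x
    · obtain ⟨s, hs⟩ := h3
      simp at hs
      exact ⟨hs.1, Or.inl ⟨s, hs.2.symm⟩⟩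
    · have h3 : [a, b, c, d, c] <+: l :: x := by tauto
      obtain ⟨s, hs⟩ := h3
      simp at hs
      exact ⟨hs.1, Or.inr ⟨s, hs.2.symm⟩⟩
  have irrD : ∀ s, Irr [[a, b, a], [a, b, c, d, c]] (a :: s) →
      Irr [[a, b, a], [a, b, c, d, c]] (c :: d :: c :: b :: a :: s) := by
    intro s h
    simp [irr2_cons] at h ⊢
    grind
  induction w with
  | nil =>
    exact ⟨[t], by simp [irr2_cons, irr2_nil], SwR.init hE (by simp) t [], Or.inl rfl⟩
  | cons l w ih =>
    obtain ⟨x, hx, hs, hsh⟩ := ih hw.tail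
    by_cases hc : Irr [[a, b, a], [a, b, c, d, c]] (l :: x)
    · refine ⟨l :: x, hc, hs.copy hE [l], ?_⟩
      rcases hsh with rfl | ⟨q, r, w', rfl, rfl, h⟩
      · exact Or.inl rfl
      · exact Or.inr ⟨l :: q, r, w', rfl, rfl, h⟩
    · rcases hsh with rfl | ⟨q, r, w', rfl, rfl, h⟩
      · rw [irr2_cons] at hc
        by_cases h1 : [a, b, a] <+: l :: (w ++ [t])
        · have := last_red hw (by simp) h1
          simp only [List.cons.injEq] at this
          obtain ⟨rfl, e⟩ := this
          rw [← e] at hs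
          refine ⟨_, ?_, SwR.step' hE a [b, a] [] [c, d, c] hs (by simp) (by simp) he,
            Or.inr ⟨[], [], w, by simp, by simp, Or.inl rfl⟩⟩
          simp [irr2_cons, irr2_nil, hac]
        · have h1 : [a, b, c, d, c] <+: l :: (w ++ [t]) := by tauto
          have := last_red hw (by simp) h1
          simp only [List.cons.injEq] at this
          obtain ⟨rfl, e⟩ := this
          rw [← e] at hs
          refine ⟨_, ?_, SwR.step' hE a [b, c, d, c] [] [c, d, c, b, a] hs (by simp) (by simp) he2,
            Or.inr ⟨[], [b, a], w, by simp, by simp, Or.inr ⟨[], rfl⟩⟩⟩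
          exact irrD [] (by simp [irr2_cons, irr2_nil])
      · have hc1 := red _ _ hc hx
        clear hc
        obtain ⟨rfl, hc⟩ := hc1
        have key : ∀ s, q ++ [c, d, c] ++ r = [b, c, d, c] ++ s →
            Irr [[a, b, a], [a, b, c, d, c]] (a :: s) →
            ∃ x, Irr [[a, b, a], [a, b, c, d, c]] x ∧ SwR E 6 t (a :: (q ++ a :: w')) x ∧
            (x = (a :: (q ++ a :: w')) ++ [t] ∨
            ∃ q' r w'', (a :: (q ++ a :: w')) = q' ++ a :: w'' ∧ x = q' ++ [c, d, c] ++ r ∧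
              (r = [] ∨ ∃ s, r = b :: a :: s)) := by
          intro s e hi
          rw [e] at hs
          exact ⟨_, irrD s hi,
            SwR.step' hE a [b, c, d, c] s [c, d, c, b, a] hs (by simp) (by simp) he2,
            Or.inr ⟨[], b :: a :: s, _, rfl, rfl, Or.inr ⟨s, rfl⟩⟩⟩
        rcases q with _ | ⟨q1, _ | ⟨q2, _ | ⟨q3, _ | ⟨q4, q⟩⟩⟩⟩
        · simp at hc
          rcases hc with hc | ⟨s, hc⟩
          · grind
          · rcases h with rfl | ⟨s', rfl⟩
            · simp at hc
            · simp at hc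
              refine key (a :: s') (by simp; grind) ?_
              simp [irr2_cons] at hx ⊢
              grind
        · exfalso
          simp [irr2_cons] at hc hw
          grind
        · simp at hc
          rcases hc with hc | ⟨s, hc⟩
          · exfalso; simp [irr2_cons] at hw; grind
          · refine key (c :: r) (by simp; grind) ?_
            rcases h with rfl | ⟨s', rfl⟩
            · simp [irr2_cons] at hx ⊢
              simp [hx]
            · simp [irr2_cons] at hx ⊢
              grind
        · simp at hc
          rcases hc with hc | ⟨s, hc⟩
          · exfalso; simp [irr2_cons] at hw; grind
          · refine key (d :: c :: r) (by simp; grind) ?_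
            rcases h with rfl | ⟨s', rfl⟩
            · simp [irr2_cons] at hx ⊢
              grind
            · simp [irr2_cons] at hx ⊢
              grind
        · exfalso
          simp [irr2_cons] at hc hw
          grind

theorem sweepIII' (hE : Cong E) {a b c d : γ} (he : E [a, b, a] [c, d, c]) (hab : a ≠ b)
    (hac : a ≠ c) (hd : ¬ (d = a ∧ c = b))
    (t : γ) (w : List γ) (hw : Irr [[a, b, a], [c, d, c, b, a]] w) :
    ∃ x, Irr [[a, b, a], [c, d, c, b, a]] x ∧ SwR E 6 t w x ∧ (x = w ++ [t] ∨
      (∃ q r w', w = q ++ w' ∧ x = q ++ [c, d, c] ++ r ∧ (r = [] ∨ ∃ s, r = b :: s)) ∨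
      (∃ q r w', w = q ++ w' ∧ x = q ++ [a, b, c, d, c] ++ r)) := by
  have he2 := hE.symm _ _ (eqIII hE he)
  have red : ∀ l x, ¬ Irr [[a, b, a], [c, d, c, b, a]] (l :: x) →
      Irr [[a, b, a], [c, d, c, b, a]] x → (a = l ∧ (∃ s, x = b :: a :: s)) ∨
        (c = l ∧ ∃ s, x = d :: c :: b :: a :: s) := by
    intro l x h1 h2
    rw [irr2_cons] at h1
    by_cases h3 : [a, b, a] <+: l :: x
    · obtain ⟨s, hs⟩ := h3
      simp at hs
      exact Or.inl ⟨hs.1, ⟨s, hs.2.symm⟩⟩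
    · have h3 : [c, d, c, b, a] <+: l :: x := by tauto
      obtain ⟨s, hs⟩ := h3
      simp at hs
      exact Or.inr ⟨hs.1, ⟨s, hs.2.symm⟩⟩
  induction w with
  | nil =>
    exact ⟨[t], by simp [irr2_cons, irr2_nil], SwR.init hE (by simp) t [], Or.inl rfl⟩
  | cons l w ih =>
    obtain ⟨x, hx, hs, hsh⟩ := ih hw.tail
    by_cases hc : Irr [[a, b, a], [c, d, c, b, a]] (l :: x)
    · refine ⟨l :: x, hc, hs.copy hE [l], ?_⟩
      rcases hsh with rfl | ⟨q, r, w', rfl, rfl, h⟩ | ⟨q, r, w', rfl, rfl⟩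
      · exact Or.inl rfl
      · exact Or.inr (Or.inl ⟨l :: q, r, w', rfl, rfl, h⟩)
      · exact Or.inr (Or.inr ⟨l :: q, r, w', rfl, rfl⟩)
    · rcases hsh with rfl | ⟨q, r, w', rfl, rfl, h⟩ | ⟨q, r, w', rfl, rfl⟩
      · rw [irr2_cons] at hc
        by_cases h1 : [a, b, a] <+: l :: (w ++ [t])
        · have := last_red hw (by simp) h1
          simp only [List.cons.injEq] at this
          obtain ⟨rfl, e⟩ := this
          rw [← e] at hs
          refine ⟨_, ?_, SwR.step' hE a [b, a] [] [c, d, c] hs (by simp) (by simp) he,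
            Or.inr (Or.inl ⟨[], [], a :: w, by simp, by simp, Or.inl rfl⟩)⟩
          simp [irr2_cons, irr2_nil, hac]
        · have h1 : [c, d, c, b, a] <+: l :: (w ++ [t]) := by tauto
          have := last_red hw (by simp) h1
          simp only [List.cons.injEq] at this
          obtain ⟨rfl, e⟩ := this
          rw [← e] at hs
          refine ⟨_, ?_, SwR.step' hE c [d, c, b, a] [] [a, b, c, d, c] hs (by simp) (by simp) he2,
            Or.inr (Or.inr ⟨[], [], c :: w, by simp, by simp⟩)⟩
          simp [irr2_cons, irr2_nil, hac, hab]
      · exfalso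
        have hc := red _ _ hc hx
        rcases q with _ | ⟨q1, _ | ⟨q2, _ | ⟨q3, _ | ⟨q4, q⟩⟩⟩⟩ <;>
        · simp [irr2_cons] at hc hw
          grind
      · have hc := red _ _ hc hx
        rcases q with _ | ⟨q1, _ | ⟨q2, _ | ⟨q3, _ | ⟨q4, q⟩⟩⟩⟩
        · exfalso
          simp [irr2_cons] at hc hw
          grind
        · simp at hc
          obtain ⟨rfl, rfl⟩ : a = l ∧ b = q1 := by grind
          refine ⟨_, ?_, SwR.step' hE a [b, a] (b :: c :: d :: c :: r) [c, d, c] hs (by simp) (by simp) he,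
            Or.inr (Or.inl ⟨[], b :: c :: d :: c :: r, _, rfl, rfl, Or.inr ⟨_, rfl⟩⟩)⟩
          simp [irr2_cons] at hw hx ⊢
          grind
        · exfalso
          simp [irr2_cons] at hc hw
          grind
        · simp at hc
          obtain ⟨rfl, rfl, rfl, rfl⟩ : c = l ∧ d = q1 ∧ c = q2 ∧ b = q3 := by
            simp [irr2_cons] at hw
            grind
          refine ⟨_, ?_, SwR.step' hE c [d, c, b, a] (b :: c :: d :: c :: r) [a, b, c, d, c] hs (by simp) (by simp) he2,
            Or.inr (Or.inr ⟨[], b :: c :: d :: c :: r, _, rfl, rfl⟩)⟩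
          simp [irr2_cons] at hw hx ⊢
          grind
        · exfalso
          simp [irr2_cons] at hc hw
          grind
end

section
variable {γ : Type}

theorem two_way {R : Set (List γ × List γ)} {l r : List γ} (hR : R = {(l, r)} ∨ R = {(r, l)}) :
    WordEq R l r ∧ ∀ E : List γ → List γ → Prop, Cong E → E l r → ∀ u v, (u, v) ∈ R → E u v := by
  rcases hR with rfl | rfl
  · refine ⟨WordEq.rule rfl, fun E hE h u v hu => ?_⟩
    simp only [Set.mem_singleton_iff, Prod.mk.injEq] at hu
    obtain ⟨rfl, rfl⟩ := hu
    exact h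
  · refine ⟨(WordEq.cong _).symm _ _ (WordEq.rule rfl), fun E hE h u v hu => ?_⟩
    simp only [Set.mem_singleton_iff, Prod.mk.injEq] at hu
    obtain ⟨rfl, rfl⟩ := hu
    exact hE.symm _ _ h

theorem goodIV {R : Set (List γ × List γ)} {a c : γ} (hac : a ≠ c)
    (hR : R = {([a, a, a], [c, c, c])} ∨ R = {([c, c, c], [a, a, a])}) :
    Good (WordEq R) {w | Irr [[a, a, a], [a, c, c, c]] w} 6 := by
  obtain ⟨he, hR'⟩ := two_way hR
  refine good_of_rw [([a, a, a], [c, c, c]), ([a, c, c, c], [c, c, c, a])]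
    [[a, a, a], [a, c, c, c]] ?_ ?_ ?_ a ?_ ?_ ?_ ?_ ?_
  · simp
  · intro l r h
    simp only [List.mem_cons, Prod.mk.injEq, List.not_mem_nil, or_false] at h
    rcases h with ⟨rfl, rfl⟩ | ⟨rfl, rfl⟩ <;> simp
  · have S1 : ∀ p s, Sts [([a, a, a], [c, c, c]), ([a, c, c, c], [c, c, c, a])]
      (p ++ [a, a, a] ++ s) (p ++ [c, c, c] ++ s) := fun p s => step_end (by simp) p s
    have S2 : ∀ p s, Sts [([a, a, a], [c, c, c]), ([a, c, c, c], [c, c, c, a])]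
      (p ++ [a, c, c, c] ++ s) (p ++ [c, c, c, a] ++ s) := fun p s => step_end (by simp) p s
    intro l1 r1 l2 r2 h1 h2 m s1 s2 e hm
    simp only [List.mem_cons, Prod.mk.injEq, List.not_mem_nil, or_false] at h1 h2
    rcases h1 with ⟨rfl, rfl⟩ | ⟨rfl, rfl⟩ <;> rcases h2 with ⟨rfl, rfl⟩ | ⟨rfl, rfl⟩
    · rcases m with _ | ⟨m1, _ | ⟨m2, _ | ⟨m3, m⟩⟩⟩
      · simp at e; subst e
        exact ⟨_, Relation.ReflTransGen.refl, Relation.ReflTransGen.refl⟩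
      · simp at e
        obtain ⟨rfl, rfl⟩ := e
        exact ⟨_, Relation.ReflTransGen.refl, S2 [] s2⟩
      · simp at e
        obtain ⟨rfl, rfl, rfl⟩ := e
        exact ⟨[c, c, c, a, a] ++ s2, Relation.ReflTransGen.refl,
          (S2 [a] s2).trans (S2 [] (a :: s2))⟩
      · simp at hm; omega
    · rcases m with _ | ⟨m1, _ | ⟨m2, _ | ⟨m3, m⟩⟩⟩
      · simp at e; grind
      · simp at e; grind
      · simp at e
        obtain ⟨rfl, rfl, rfl⟩ := e
        exact ⟨[c, c, c, c, c, c] ++ s2, Relation.ReflTransGen.refl,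
          ((S2 [a] (a :: s2)).trans (S2 [] (a :: a :: s2))).trans (S1 [c, c, c] s2)⟩
      · simp at hm; omega
    · rcases m with _ | ⟨m1, _ | ⟨m2, _ | ⟨m3, _ | ⟨m4, m⟩⟩⟩⟩
      · simp at e; grind
      · simp at e; grind
      · simp at e; grind
      · simp at e; grind
      · simp at hm; omega
    · rcases m with _ | ⟨m1, _ | ⟨m2, _ | ⟨m3, _ | ⟨m4, m⟩⟩⟩⟩
      · simp at e; subst e
        exact ⟨_, Relation.ReflTransGen.refl, Relation.ReflTransGen.refl⟩
      · simp at e; grind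
      · simp at e; grind
      · simp at e; grind
      · simp at hm; omega
  · intro l r h
    simp only [List.mem_cons, Prod.mk.injEq, List.not_mem_nil, or_false] at h
    rcases h with ⟨rfl, rfl⟩ | ⟨rfl, rfl⟩ <;> simp
  · intro _ l r h
    simp only [List.mem_cons, Prod.mk.injEq, List.not_mem_nil, or_false] at h
    rcases h with ⟨rfl, rfl⟩ | ⟨rfl, rfl⟩ <;> simp [bval, hac.symm]
  · exact hR' _ (WordEq.cong _) (WordEq.rule (by simp))
  · intro w hw t
    obtain ⟨x, h1, h2, _⟩ := sweepIV (WordEq.cong R) he hac t w hw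
    exact ⟨x, h1, h2⟩
  · intro w hw t
    obtain ⟨x, h1, h2, _⟩ := sweepIV' (E := revE (WordEq R)) (a := a) (c := c)
      (WordEq.cong R).rev (by simpa [revE] using he) hac t w (by simpa using hw)
    exact ⟨x, by simpa using h1, h2⟩

theorem goodIII {R : Set (List γ × List γ)} {a b c d : γ} (hab : a ≠ b) (hac : a ≠ c)
    (hd : ¬ (d = a ∧ c = b))
    (hR : R = {([a, b, a], [c, d, c])} ∨ R = {([c, d, c], [a, b, a])}) :
    Good (WordEq R) {w | Irr [[a, b, a], [a, b, c, d, c]] w} 6 := by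
  obtain ⟨he, hR'⟩ := two_way hR
  refine good_of_rw [([a, b, a], [c, d, c]), ([a, b, c, d, c], [c, d, c, b, a])]
    [[a, b, a], [a, b, c, d, c]] ?_ ?_ ?_ a ?_ ?_ ?_ ?_ ?_
  · simp
  · intro l r h
    simp only [List.mem_cons, Prod.mk.injEq, List.not_mem_nil, or_false] at h
    rcases h with ⟨rfl, rfl⟩ | ⟨rfl, rfl⟩ <;> simp
  · have S1 : ∀ p s, Sts [([a, b, a], [c, d, c]), ([a, b, c, d, c], [c, d, c, b, a])]
      (p ++ [a, b, a] ++ s) (p ++ [c, d, c] ++ s) := fun p s => step_end (by simp) p s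
    have S2 : ∀ p s, Sts [([a, b, a], [c, d, c]), ([a, b, c, d, c], [c, d, c, b, a])]
      (p ++ [a, b, c, d, c] ++ s) (p ++ [c, d, c, b, a] ++ s) := fun p s => step_end (by simp) p s
    intro l1 r1 l2 r2 h1 h2 m s1 s2 e hm
    simp only [List.mem_cons, Prod.mk.injEq, List.not_mem_nil, or_false] at h1 h2
    rcases h1 with ⟨rfl, rfl⟩ | ⟨rfl, rfl⟩ <;> rcases h2 with ⟨rfl, rfl⟩ | ⟨rfl, rfl⟩
    · rcases m with _ | ⟨m1, _ | ⟨m2, _ | ⟨m3, m⟩⟩⟩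
      · simp at e; subst e
        exact ⟨_, Relation.ReflTransGen.refl, Relation.ReflTransGen.refl⟩
      · simp at e; grind
      · simp at e
        obtain ⟨rfl, rfl, rfl⟩ := e
        exact ⟨[c, d, c, b, a] ++ s2, Relation.ReflTransGen.refl, S2 [] s2⟩
      · simp at hm; omega
    · rcases m with _ | ⟨m1, _ | ⟨m2, _ | ⟨m3, m⟩⟩⟩
      · simp at e; grind
      · simp at e; grind
      · simp at e
        obtain ⟨rfl, rfl, rfl⟩ := e
        exact ⟨[c, d, c, b, c, d, c] ++ s2, Relation.ReflTransGen.refl,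
          (S2 [] (b :: a :: s2)).trans (S1 [c, d, c, b] s2)⟩
      · simp at hm; omega
    · rcases m with _ | ⟨m1, _ | ⟨m2, _ | ⟨m3, _ | ⟨m4, _ | ⟨m5, m⟩⟩⟩⟩⟩
      · simp at e; grind
      · simp at e; grind
      · simp at e; grind
      · simp at e; grind
      · simp at e; grind
      · simp at hm; omega
    · rcases m with _ | ⟨m1, _ | ⟨m2, _ | ⟨m3, _ | ⟨m4, _ | ⟨m5, m⟩⟩⟩⟩⟩
      · simp at e; subst e
        exact ⟨_, Relation.ReflTransGen.refl, Relation.ReflTransGen.refl⟩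
      · simp at e; grind
      · simp at e; grind
      · simp at e; grind
      · simp at e; grind
      · simp at hm; omega
  · intro l r h
    simp only [List.mem_cons, Prod.mk.injEq, List.not_mem_nil, or_false] at h
    rcases h with ⟨rfl, rfl⟩ | ⟨rfl, rfl⟩ <;> simp
  · intro _ l r h
    simp only [List.mem_cons, Prod.mk.injEq, List.not_mem_nil, or_false] at h
    rcases h with ⟨rfl, rfl⟩ | ⟨rfl, rfl⟩ <;> by_cases h' : d = a <;>
      simp [bval, hac.symm, hab.symm, h']
  · exact hR' _ (WordEq.cong _) (WordEq.rule (by simp))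
  · intro w hw t
    obtain ⟨x, h1, h2, _⟩ := sweepIII (WordEq.cong R) he hab hac hd t w hw
    exact ⟨x, h1, h2⟩
  · intro w hw t
    obtain ⟨x, h1, h2, _⟩ := sweepIII' (E := revE (WordEq R)) (a := a) (b := b) (c := c) (d := d)
      (WordEq.cong R).rev (by simpa [revE] using he) hab hac hd t w (by simpa using hw)
    exact ⟨x, by simpa using h1, h2⟩

end

/-! ## Type V : the braid relation -/

section
variable {γ : Type} [DecidableEq γ] (a b : γ)

def sw (c : γ) : γ := if c = a then b else a

def VX : List (Option γ) → Prop
  | [] => True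
  | none :: x => VX x
  | some c :: x => VX x ∧ ((c = a ∨ c = b) →
      (∀ s, x ≠ none :: s) ∧ (∀ s, x ≠ some (sw a b c) :: some c :: s))

def ex : List (Option γ) → List γ
  | [] => []
  | none :: x => a :: b :: a :: ex x
  | some c :: x => c :: ex x

def lm : List (Option γ) → γ → List (Option γ)
  | none :: x, c => if c = a ∨ c = b then none :: lm x (sw a b c) else some c :: none :: x
  | some d :: some e :: x, c => if (c = a ∨ c = b) ∧ d = sw a b c ∧ e = c then none :: x
      else some c :: some d :: some e :: x
  | [some d], c => [some c, some d]
  | some d :: none :: x, c => some c :: some d :: none :: x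
  | [], c => [some c]

def nf : List γ → List (Option γ)
  | [] => []
  | c :: w => lm a b (nf w) c

variable {a b}

theorem sw_sw (hab : a ≠ b) {c : γ} (hc : c = a ∨ c = b) : sw a b (sw a b c) = c := by
  unfold sw; grind

theorem sw_ne (hab : a ≠ b) (c : γ) : sw a b c ≠ c := by
  unfold sw; grind

theorem sw_mem (c : γ) : sw a b c = a ∨ sw a b c = b := by
  unfold sw; grind

theorem lm_none {c : γ} (hc : c = a ∨ c = b) (x : List (Option γ)) :
    lm a b (none :: x) c = none :: lm a b x (sw a b c) := by
  rw [lm, if_pos hc]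

theorem lm_red {c : γ} (hc : c = a ∨ c = b) (x : List (Option γ)) :
    lm a b (some (sw a b c) :: some c :: x) c = none :: x := by
  rw [lm, if_pos ⟨hc, rfl, rfl⟩]

theorem lm_other {c : γ} (x : List (Option γ)) (h : (c = a ∨ c = b) →
      (∀ s, x ≠ none :: s) ∧ (∀ s, x ≠ some (sw a b c) :: some c :: s)) :
    lm a b x c = some c :: x := by
  match x with
  | [] => rfl
  | [some d] => rfl
  | some d :: none :: x => rfl
  | none :: x =>
    rw [lm, if_neg]
    intro hc
    exact (h hc).1 x rfl
  | some d :: some e :: x =>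
    rw [lm, if_neg]
    rintro ⟨hc, rfl, rfl⟩
    exact (h hc).2 x rfl

/-- case analysis for `lm` -/
theorem lm_cases (x : List (Option γ)) (c : γ) :
    ((c = a ∨ c = b) ∧ ∃ y, x = none :: y) ∨
    ((c = a ∨ c = b) ∧ ∃ y, x = some (sw a b c) :: some c :: y) ∨
    ((c = a ∨ c = b) →
      (∀ s, x ≠ none :: s) ∧ (∀ s, x ≠ some (sw a b c) :: some c :: s)) := by
  by_cases h1 : (c = a ∨ c = b) ∧ ∃ y, x = none :: y
  · exact Or.inl h1
  by_cases h2 : (c = a ∨ c = b) ∧ ∃ y, x = some (sw a b c) :: some c :: y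
  · exact Or.inr (Or.inl h2)
  · refine Or.inr (Or.inr fun hc => ⟨?_, ?_⟩)
    · rintro s rfl; exact h1 ⟨hc, s, rfl⟩
    · rintro s rfl; exact h2 ⟨hc, s, rfl⟩

theorem VX.lm {x : List (Option γ)} (hx : VX a b x) (c : γ) : VX a b (lm a b x c) := by
  induction x generalizing c with
  | nil => rw [lm_other _ (by simp)]; simp [VX]
  | cons d x ih =>
    rcases lm_cases (a := a) (b := b) (d :: x) c with ⟨hc, y, e⟩ | ⟨hc, y, e⟩ | h
    · obtain ⟨rfl, rfl⟩ := List.cons.inj e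
      rw [lm_none hc]
      exact ih hx _
    · rw [e] at hx ⊢
      rw [lm_red hc]
      exact hx.1.1
    · rw [lm_other _ h]
      exact ⟨hx, h⟩

theorem lm_braid (hab : a ≠ b) {x : List (Option γ)} (hx : VX a b x) {c : γ} (hc : c = a ∨ c = b) :
    lm a b (lm a b (lm a b x c) (sw a b c)) c = none :: x := by
  have hc' := sw_mem (a := a) (b := b) c
  have hcc := sw_sw hab hc
  have hne := sw_ne hab c
  induction x generalizing c with
  | nil =>
    rw [lm_other [] (by simp), lm_other [some c] (by simp), lm_red hc]
  | cons d x ih =>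
    rcases lm_cases (a := a) (b := b) (d :: x) c with ⟨_, y, e⟩ | ⟨_, y, e⟩ | h
    · obtain ⟨rfl, rfl⟩ := List.cons.inj e
      rw [lm_none hc, lm_none hc', lm_none hc, hcc]
      have := ih hx hc' (sw_mem _) (sw_sw hab hc') (sw_ne hab _)
      rw [hcc] at this
      rw [this]
    · rw [e] at hx ⊢
      obtain ⟨⟨hy, h1⟩, h2⟩ := hx
      have h1 := h1 hc
      have h2 := h2 hc'
      rw [hcc] at h2
      rw [lm_red hc, lm_none hc', lm_none hc, hcc, lm_other y (fun _ => ⟨h1.1, h1.2⟩),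
        lm_other (some c :: y)]
      intro _
      rw [hcc]
      refine ⟨by simp, ?_⟩
      rintro s e
      simp only [List.cons.injEq, true_and] at e
      exact h2.2 s (by rw [e])
    · rw [lm_other _ h]
      have h := h hc
      rcases lm_cases (a := a) (b := b) (some c :: d :: x) (sw a b c) with ⟨_, y, e⟩ | ⟨_, y, e⟩ | h'
      · simp at e
      · rw [hcc] at e
        simp only [List.cons.injEq, true_and] at e
        obtain ⟨rfl, rfl⟩ := e
        have e2 := lm_red hc' x
        rw [hcc] at e2
        rw [e2, lm_none hc, lm_other x]
        intro _
        rw [hcc]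
        obtain ⟨hx1, hx2⟩ := hx
        refine ⟨(hx2 hc').1, ?_⟩
        rintro s rfl
        exact h.2 _ rfl
      · rw [lm_other _ h', lm_red hc]

theorem VX.nf (w : List γ) : VX a b (nf a b w) := by
  induction w with
  | nil => trivial
  | cons c w ih => exact ih.lm c

theorem nf_aba (hab : a ≠ b) (s : List γ) : nf a b (a :: b :: a :: s) = none :: nf a b s := by
  have := lm_braid hab (VX.nf s) (c := a) (Or.inl rfl)
  simpa [sw, nf] using this

theorem nf_bab (hab : a ≠ b) (s : List γ) : nf a b (b :: a :: b :: s) = none :: nf a b s := by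
  have := lm_braid hab (VX.nf s) (c := b) (Or.inr rfl)
  simpa [sw, nf, hab.symm] using this

theorem nf_ex (hab : a ≠ b) {x : List (Option γ)} (hx : VX a b x) : nf a b (ex a b x) = x := by
  induction x with
  | nil => rfl
  | cons c x ih =>
    cases c with
    | none => rw [ex, nf_aba hab, ih hx]
    | some c => rw [ex, nf, ih hx.1, lm_other _ hx.2]

theorem nf_app {u v : List γ} (h : nf a b u = nf a b v) (p : List γ) :
    nf a b (p ++ u) = nf a b (p ++ v) := by
  induction p with
  | nil => exact h
  | cons c p ih => simp only [List.cons_append, nf, ih]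

theorem nf_inv (hab : a ≠ b) {R : Set (List γ × List γ)}
    (hR : R = {([a, b, a], [b, a, b])} ∨ R = {([b, a, b], [a, b, a])}) {x y : List γ}
    (h : WordEq R x y) : nf a b x = nf a b y := by
  induction h with
  | rel x y h =>
    obtain ⟨p, u, v, s, h, rfl, rfl⟩ := h
    rw [List.append_assoc, List.append_assoc]
    apply nf_app
    rcases hR with rfl | rfl
    · simp only [Set.mem_singleton_iff, Prod.mk.injEq] at h
      obtain ⟨rfl, rfl⟩ := h
      exact (nf_aba hab s).trans (nf_bab hab s).symm
    · simp only [Set.mem_singleton_iff, Prod.mk.injEq] at h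
      obtain ⟨rfl, rfl⟩ := h
      exact (nf_bab hab s).trans (nf_aba hab s).symm
  | refl x => rfl
  | symm x y _ ih => exact ih.symm
  | trans x y z _ _ h1 h2 => exact h1.trans h2

theorem ex_append (x y : List (Option γ)) : ex a b (x ++ y) = ex a b x ++ ex a b y := by
  induction x with
  | nil => rfl
  | cons c x ih => cases c <;> simp [ex, ih]

theorem VX_iff_irr (hab : a ≠ b) (x : List (Option γ)) : VX a b x ↔
    Irr [[some a, some b, some a], [some b, some a, some b], [some a, none], [some b, none]] x := by
  induction x with
  | nil => simp [VX, Irr]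
  | cons c x ih =>
    rw [irr_cons_iff]
    cases c with
    | none => rw [VX, ih]; simp
    | some c =>
      rw [VX, ih, and_comm]
      refine and_congr ?_ Iff.rfl
      have hp2 : ∀ d e : Option γ, [d, e] <+: x ↔ ∃ s, x = d :: e :: s := by
        intro d e
        constructor
        · rintro ⟨s, rfl⟩; exact ⟨s, rfl⟩
        · rintro ⟨s, rfl⟩; exact ⟨s, rfl⟩
      have hp1 : ∀ d : Option γ, [d] <+: x ↔ ∃ s, x = d :: s := by
        intro d
        constructor
        · rintro ⟨s, rfl⟩; exact ⟨s, rfl⟩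
        · rintro ⟨s, rfl⟩; exact ⟨s, rfl⟩
      simp [List.cons_prefix_cons, hp1, hp2]
      by_cases h1 : c = a
      · subst h1
        simp [sw, hab, hab.symm]
        grind
      · by_cases h2 : c = b
        · subst h2
          simp [sw, hab, hab.symm]
          grind
        · grind

theorem VX.left {x y : List (Option γ)} (hab : a ≠ b) (h : VX a b (x ++ y)) : VX a b x := by
  rw [VX_iff_irr hab] at h ⊢
  exact h.factor (List.prefix_append x y).isInfix

theorem VX.snoc (hab : a ≠ b) {x : List (Option γ)} (h : VX a b (x ++ [none])) :
    VX a b (x ++ [some a]) ∧ VX a b (x ++ [some a, some b]) := by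
  induction x with
  | nil => simp [VX]
  | cons c x ih =>
    cases c with
    | none => exact ih h
    | some c =>
      obtain ⟨i1, i2⟩ := ih h.1
      refine ⟨⟨i1, fun hc => ?_⟩, ⟨i2, fun hc => ?_⟩⟩ <;>
      · obtain ⟨h1, h2⟩ := h
        have h2 := h2 hc
        rcases x with _ | ⟨d, _ | ⟨e, x⟩⟩
        · simp at h2
        · have h3 := sw_mem (a := a) (b := b) c
          have h4 : d ≠ some (sw a b c) := by
            intro hd
            subst hd
            have h1 : VX a b [some (sw a b c), none] := h1
            exact absurd rfl ((h1.2 h3).1 [])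
          simp at h2 
          simp [h2, h4]
        · simp at h2 ⊢
          exact h2

theorem ex_pfx (x : List (Option γ)) (y : List γ) (h : y <+: ex a b x) :
    ∃ x1 s, (s = [] ∧ x1 <+: x ∨ (s = [some a] ∨ s = [some a, some b]) ∧ x1 ++ [none] <+: x) ∧
      y = ex a b (x1 ++ s) := by
  induction x generalizing y with
  | nil =>
    rw [ex, List.prefix_nil] at h
    exact ⟨[], [], Or.inl ⟨rfl, by simp⟩, h⟩
  | cons c x ih =>
    have lift : ∀ y', y' <+: ex a b x → ∃ x1 s, (s = [] ∧ x1 <+: c :: x ∨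
        (s = [some a] ∨ s = [some a, some b]) ∧ x1 ++ [none] <+: c :: x) ∧
        ex a b [c] ++ y' = ex a b (x1 ++ s) := by
      intro y' hy'
      obtain ⟨x1, s, h1, rfl⟩ := ih y' hy'
      refine ⟨c :: x1, s, ?_, by rw [← ex_append]; rfl⟩
      simpa [List.cons_prefix_cons] using h1
    rcases y with _ | ⟨y1, y⟩
    · exact ⟨[], [], Or.inl ⟨rfl, by simp⟩, rfl⟩
    cases c with
    | some c =>
      rw [ex, List.cons_prefix_cons] at h
      obtain ⟨rfl, h⟩ := h
      exact lift y h
    | none =>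
      rw [ex, List.cons_prefix_cons] at h
      obtain ⟨rfl, h⟩ := h
      rcases y with _ | ⟨y2, y⟩
      · exact ⟨[], [some y1], Or.inr ⟨Or.inl rfl, by simp⟩, rfl⟩
      rw [List.cons_prefix_cons] at h
      obtain ⟨rfl, h⟩ := h
      rcases y with _ | ⟨y3, y⟩
      · exact ⟨[], [some y1, some y2], Or.inr ⟨Or.inr rfl, by simp⟩, rfl⟩
      rw [List.cons_prefix_cons] at h
      obtain ⟨rfl, h⟩ := h
      exact lift y h

theorem ex_reg (a b : γ) {X : Set (List (Option γ))} (hX : IsReg X) :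
    IsReg {w | ∃ x ∈ X, w = ex a b x} := by
  obtain ⟨Q, _, step, Lang, q0, rfl, h1⟩ := hX.family
  refine isReg_family (Q := Q × Fin 3)
    (fun s c s' => (s.2 = 0 ∧ s' = (step s.1 (some c), 0)) ∨
      (s.2 = 0 ∧ c = a ∧ s' = (step s.1 none, 1)) ∨
      (s.2 = 1 ∧ c = b ∧ s' = (s.1, 2)) ∨ (s.2 = 2 ∧ c = a ∧ s' = (s.1, 0)))
    (fun s => s.2 = 0 ∧ [] ∈ Lang s.1)
    (fun s => {w | ∃ x ∈ Lang s.1, w = (if s.2 = 0 then [] else if s.2 = 1 then [b, a] else [a])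
      ++ ex a b x}) ?_ ?_ (q0, 0) |>.congr ?_
  · rintro ⟨q, i⟩
    simp only [Set.mem_ofPred_eq]
    fin_cases i
    · simp
      constructor
      · rintro ⟨x, hx, e⟩
        rcases x with _ | ⟨_ | c, x⟩
        · exact hx
        · simp [ex] at e
        · simp [ex] at e
      · intro h; exact ⟨[], h, rfl⟩
    · simp
    · simp
  · rintro ⟨q, i⟩ c w
    simp only [Set.mem_ofPred_eq]
    fin_cases i
    · simp
      constructor
      · rintro ⟨x, hx, e⟩
        rcases x with _ | ⟨_ | d, x⟩
        · simp [ex] at e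
        · simp [ex] at e
          obtain ⟨rfl, rfl⟩ := e
          exact Or.inr ⟨rfl, x, (h1 _ _ _).1 hx, rfl⟩
        · simp [ex] at e
          obtain ⟨rfl, rfl⟩ := e
          exact Or.inl ⟨x, (h1 _ _ _).1 hx, rfl⟩
      · rintro (⟨x, hx, rfl⟩ | ⟨rfl, x, hx, rfl⟩)
        · exact ⟨some c :: x, (h1 _ _ _).2 hx, rfl⟩
        · exact ⟨none :: x, (h1 _ _ _).2 hx, rfl⟩
    · simp
      constructor
      · rintro ⟨x, hx, rfl, rfl⟩
        exact ⟨rfl, x, hx, rfl⟩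
      · rintro ⟨rfl, x, hx, rfl⟩
        exact ⟨x, hx, rfl, rfl⟩
    · simp
      constructor
      · rintro ⟨x, hx, rfl, rfl⟩
        exact ⟨rfl, x, hx, rfl⟩
      · rintro ⟨rfl, x, hx, rfl⟩
        exact ⟨x, hx, rfl, rfl⟩
  · intro w; simp

end

section
variable {γ : Type} [DecidableEq γ] {a b : γ} {E : List γ → List γ → Prop}

theorem br_comm (hE : Cong E) (he : E [a, b, a] [b, a, b]) (hab : a ≠ b) {c : γ}
    (hc : c = a ∨ c = b) : E [c, a, b, a] [a, b, a, sw a b c] := by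
  rcases hc with rfl | rfl
  · have h := hE.left he [c]
    simpa [sw] using h
  · have h1 := hE.symm _ _ (hE.right he [a])
    simpa [sw, hab.symm] using h1

theorem br_red (hE : Cong E) (he : E [a, b, a] [b, a, b]) (hab : a ≠ b) {c : γ}
    (hc : c = a ∨ c = b) : E [c, sw a b c, c] [a, b, a] := by
  rcases hc with rfl | rfl
  · simpa [sw] using hE.refl _
  · simpa [sw, hab.symm] using hE.symm _ _ he

theorem sweepV (hE : Cong E) (he : E [a, b, a] [b, a, b]) (hab : a ≠ b) (t : γ)
    (x : List (Option γ)) (hx : VX a b x) :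
    ∃ y, VX a b y ∧ SwR E 6 t (ex a b x) (ex a b y) ∧ (y = x ++ [some t] ∨
      ((t = a ∨ t = b) ∧ ∃ (q : List (Option γ)) (s : List γ), (∀ c ∈ s, c = a ∨ c = b) ∧
        x = q ++ s.map some ++ [some t, some (sw a b t)] ∧
        y = q ++ none :: (s.map (sw a b)).map some)) := by
  induction x with
  | nil =>
    exact ⟨[some t], by simp [VX], SwR.init hE (by simp) t [], Or.inl rfl⟩
  | cons l x ih =>
    cases l with
    | none =>
      obtain ⟨y, h1, h2, h3⟩ := ih hx
      refine ⟨none :: y, h1, h2.copy hE [a, b, a], ?_⟩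
      rcases h3 with rfl | ⟨ht, q, s, hs, rfl, rfl⟩
      · exact Or.inl rfl
      · exact Or.inr ⟨ht, none :: q, s, hs, rfl, rfl⟩
    | some c =>
      obtain ⟨hx, hxc⟩ := hx
      obtain ⟨y, h1, h2, h3⟩ := ih hx
      have h4 := h1.lm c
      refine ⟨lm a b y c, h4, ?_⟩
      clear h4
      rcases lm_cases (a := a) (b := b) y c with ⟨hc, y', e⟩ | ⟨hc, y', e⟩ | h
      · have hxc := hxc hc
        rcases h3 with rfl | ⟨ht, q, s, hs, rfl, rfl⟩
        · exfalso
          rcases x with _ | ⟨d, x⟩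
          · simp at e
          · simp at e
            exact hxc.1 x (by rw [e.1])
        · rcases q with _ | ⟨d, q⟩
          · have ho : lm a b ((s.map (sw a b)).map some) (sw a b c) =
                some (sw a b c) :: (s.map (sw a b)).map some := by
              apply lm_other
              rw [sw_sw hab hc]
              intro _
              rcases s with _ | ⟨s1, _ | ⟨s2, s⟩⟩
              · simp
              · simp
              · have hh := hxc.2
                have e1 := sw_sw hab (hs s1 (by simp))
                have e2 := sw_sw hab (hs s2 (by simp))
                refine ⟨by simp, ?_⟩
                intro s' es
                simp at es
                obtain ⟨i1, i2, _⟩ := es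
                refine hh (s.map some ++ [some t, some (sw a b t)]) ?_
                rw [i1] at e1
                rw [i2, sw_sw hab hc] at e2
                rw [← e1, ← e2]; rfl
            simp only [List.nil_append]
            rw [lm_none hc, ho]
            refine ⟨?_, Or.inr ⟨ht, [], c :: s, ?_, rfl, rfl⟩⟩
            · exact SwR.step' hE c [a, b, a] _ [a, b, a, sw a b c] h2 (by simp) (by simp)
                (br_comm hE he hab hc)
            · intro d hd
              rcases List.mem_cons.1 hd with rfl | hd
              · exact hc
              · exact hs d hd
          · exfalso
            simp at e
            exact hxc.1 _ (by rw [e.1]; rfl)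
      · have hxc := hxc hc
        rcases h3 with rfl | ⟨ht, q, s, hs, rfl, rfl⟩
        · rcases x with _ | ⟨d, _ | ⟨d', x⟩⟩
          · simp at e
          · simp at e
            obtain ⟨rfl, rfl, rfl⟩ := e
            have := lm_red (a := a) (b := b) hc []
            rw [List.cons_append, List.nil_append, this]
            refine ⟨?_, Or.inr ⟨hc, [], [], by simp, rfl, rfl⟩⟩
            exact SwR.step' hE t [sw a b t, t] [] [a, b, a] h2 (by simp) (by simp)
                (br_red hE he hab hc)
          · exfalso
            simp at e
            exact hxc.2 x (by rw [e.1, e.2.1])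
        · exfalso
          rcases q with _ | ⟨d, _ | ⟨d', q⟩⟩
          · simp at e
          · simp at e
          · simp at e
            exact hxc.2 _ (by rw [e.1, e.2.1]; rfl)
      · rw [lm_other _ h]
        refine ⟨h2.copy hE [c], ?_⟩
        rcases h3 with rfl | ⟨ht, q, s, hs, rfl, rfl⟩
        · exact Or.inl rfl
        · exact Or.inr ⟨ht, some c :: q, s, hs, rfl, rfl⟩

theorem sweepV' (hE : Cong E) (he : E [a, b, a] [b, a, b]) (hab : a ≠ b) (t : γ)
    (x : List (Option γ)) (c : γ) (w d : List γ) (h : SwR E 6 t w (c :: d)) :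
    SwR E 6 t ((ex a b x).reverse ++ w) ((ex a b (lm a b x c)).reverse ++ d) := by
  induction x generalizing c w d with
  | nil => rw [lm_other _ (by simp)]; simpa [ex] using h
  | cons l x ih =>
    rcases lm_cases (a := a) (b := b) (l :: x) c with ⟨hc, y, e⟩ | ⟨hc, y, e⟩ | ho
    · obtain ⟨rfl, rfl⟩ := List.cons.inj e
      rw [lm_none hc]
      have h1 : SwR E 6 t ([a, b, a] ++ w) ([sw a b c, a, b, a] ++ d) := by
        refine SwR.block hE [a, b, a] [c] d _ h (by simp) (by simp) (by simp) ?_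
        have := br_comm hE he hab (sw_mem (a := a) (b := b) c)
        rw [sw_sw hab hc] at this
        exact hE.symm _ _ this
      have := ih (sw a b c) _ _ h1
      simpa [ex] using this
    · rw [e, lm_red hc]
      have h1 : SwR E 6 t ([c, sw a b c] ++ w) ([a, b, a] ++ d) :=
        SwR.block hE [c, sw a b c] [c] d _ h (by simp) (by simp) (by simp) (br_red hE he hab hc)
      have := h1.copy hE (ex a b y).reverse
      simpa [ex] using this
    · rw [lm_other _ ho]
      simpa [ex] using h.copy hE (ex a b (l :: x)).reverse

theorem goodV (hab : a ≠ b) {R : Set (List γ × List γ)}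
    (hR : R = {([a, b, a], [b, a, b])} ∨ R = {([b, a, b], [a, b, a])}) :
    Good (WordEq R) {w | ∃ x ∈ {x | VX a b x}, w = ex a b x} 6 := by
  have he := (two_way hR).1
  refine ⟨?_, ?_, ?_, ?_, ?_, ?_⟩
  · exact ex_reg a b ((isReg_irr _).congr (fun w => VX_iff_irr hab w))
  · exact ⟨[], trivial, rfl⟩
  · rintro _ ⟨x, hx, rfl⟩ y hy
    obtain ⟨x1, s, h, rfl⟩ := ex_pfx x y hy
    refine ⟨_, ?_, rfl⟩
    rcases h with ⟨rfl, z, rfl⟩ | ⟨hs, z, rfl⟩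
    · rw [List.append_nil]; exact VX.left hab hx
    · have := VX.snoc hab (VX.left hab hx)
      rcases hs with rfl | rfl
      · exact this.1
      · exact this.2
  · rintro _ ⟨x, hx, rfl⟩ _ ⟨y, hy, rfl⟩ h
    have := nf_inv hab hR h
    rw [nf_ex hab hx, nf_ex hab hy] at this
    rw [this]
  · rintro _ ⟨x, hx, rfl⟩ t
    obtain ⟨y, h1, h2, _⟩ := sweepV (WordEq.cong R) he hab t x hx
    exact ⟨_, ⟨y, h1, rfl⟩, h2⟩
  · rintro _ ⟨x, hx, rfl⟩ t
    refine ⟨_, ⟨lm a b x t, VX.lm hx t, rfl⟩, ?_⟩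
    have := sweepV' (E := revE (WordEq R)) (WordEq.cong R).rev
      (by simpa [revE] using he) hab t x t [] []
      (SwR.init (WordEq.cong R).rev (by simp) t [])
    simpa using this

end

/-- a one-relator monoid `S = sgp⟨α ∣ u = v⟩` with
`|u| = |v| = 3` and `u ≠ v` is biautomatic and prefix-automatic. -/
theorem statement_15 {α : Type} [Fintype α] (u v : List α)
    (hu : u.length = 3) (hv : v.length = 3) (huv : u ≠ v)
    (R : Set (List α × List α)) (hRdef : R = {(u, v)}) :
    MonBiautomatic R ∧ MonPrefixAutomatic R := by
  classical
  have hlen : ∀ x y, WordEq R x y → x.length = y.length := by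
    intro x y h
    refine WordEq.len (R := R) ?_ h
    intro u' v' h'
    rw [hRdef] at h'
    simp only [Set.mem_singleton_iff, Prod.mk.injEq] at h'
    rw [h'.1, h'.2, hu, hv]
  obtain ⟨u1, u2, u3, rfl⟩ := List.length_eq_three.1 hu
  obtain ⟨v1, v2, v3, rfl⟩ := List.length_eq_three.1 hv
  by_cases h1 : u1 ≠ u3
  · exact (goodI h1 huv (Or.inl hRdef)).main hlen
  by_cases h2 : v1 ≠ v3
  · exact (goodI h2 huv.symm (Or.inr hRdef)).main hlen
  push Not at h1 h2
  subst h1 h2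
  by_cases h3 : u1 = v1
  · subst h3
    have h4 : u2 ≠ v2 := by
      rintro rfl
      exact huv rfl
    by_cases h5 : u1 = u2
    · subst h5
      exact (goodII h4 h4.symm (Or.inr hRdef)).main hlen
    · exact (goodII h5 h4 (Or.inl hRdef)).main hlen
  · by_cases h5 : u1 = u2
    · subst h5
      by_cases h6 : v1 = v2
      · subst h6
        exact (goodIV h3 (Or.inl hRdef)).main hlen
      · exact (goodIII h6 (Ne.symm h3) (fun h => h3 h.1) (Or.inr hRdef)).main hlen
    · by_cases h6 : v2 = u1 ∧ v1 = u2
      · obtain ⟨rfl, rfl⟩ := h6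
        exact (goodV h5 (Or.inl hRdef)).main hlen
      · exact (goodIII h5 h3 h6 (Or.inl hRdef)).main hlen
end

section
/- Let S = sgp^+⟨a, b | a³ = b³⟩ with a ≠ b. Then S is biautomatic and prefix-automatic; indeed, with A = {a,b}, the language L = A^+ − A^*{aaa, abbb}A^* is a set of unique normal forms of S and (A, L) is both a biautomatic structure and a prefix-automatic structure for S. -/
namespace S19
open Language

theorem reg_of_deriv {Γ : Type} [Finite Γ] {ι : Type} [Finite ι] (X : ι → Set (List Γ))
    (h : ∀ i c, (∃ j, ∀ w, c :: w ∈ X i ↔ w ∈ X j) ∨ IsReg {w | c :: w ∈ X i}) (i : ι) :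
    IsReg (X i) := by
  classical
  let F : Set (Language Γ) := Set.range (fun i => (X i : Language Γ)) ∪
    ⋃ q : {q : ι × Γ // IsReg {w | q.2 :: w ∈ X q.1}},
      Set.range (Language.leftQuotient ({w | q.1.2 :: w ∈ X q.1.1} : Language Γ))
  have hF : F.Finite := by
    refine (Set.finite_range _).union (Set.finite_iUnion fun q => ?_)
    exact Language.IsRegular.finite_range_leftQuotient q.2
  refine Language.IsRegular.of_finite_range_leftQuotient (hF.subset ?_)
  rintro _ ⟨u, rfl⟩
  induction u generalizing i with
  | nil => exact Or.inl ⟨i, rfl⟩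
  | cons c u ih =>
    rcases h i c with ⟨j, hj⟩ | hr
    · have : Language.leftQuotient (X i : Language Γ) (c :: u) =
          Language.leftQuotient (X j : Language Γ) u := by
        ext w; exact hj (u ++ w)
      rw [this]; exact ih j
    · right
      refine Set.mem_iUnion.2 ⟨⟨(i, c), hr⟩, u, ?_⟩
      ext w; exact Iff.rfl

theorem reg_empty {Γ : Type} : IsReg (∅ : Set (List Γ)) :=
  ⟨Unit, inferInstance, ⟨fun _ _ => (), (), ∅⟩, by ext; simp [DFA.mem_accepts]; exact fun h => h⟩

theorem reg_univ {Γ : Type} : IsReg (Set.univ : Set (List Γ)) :=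
  ⟨Unit, inferInstance, ⟨fun _ _ => (), (), Set.univ⟩, by ext; simp [DFA.mem_accepts]; trivial⟩

theorem reg_union {Γ : Type} {A B : Set (List Γ)} (hA : IsReg A) (hB : IsReg B) :
    IsReg (A ∪ B) := Language.IsRegular.add hA hB

theorem reg_inter {Γ : Type} {A B : Set (List Γ)} (hA : IsReg A) (hB : IsReg B) :
    IsReg (A ∩ B) := Language.IsRegular.inf hA hB

theorem reg_compl {Γ : Type} {A : Set (List Γ)} (hA : IsReg A) :
    IsReg Aᶜ := Language.IsRegular.compl hA

theorem reg_one {Γ : Type} [Finite Γ] : IsReg ({[]} : Set (List Γ)) := by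
  refine reg_of_deriv (ι := Unit) (fun _ => {[]}) (fun _ c => Or.inr ?_) ()
  simpa using reg_empty

theorem reg_single {Γ : Type} [Finite Γ] (w : List Γ) : IsReg ({w} : Set (List Γ)) := by
  classical
  induction w with
  | nil => exact reg_one
  | cons d w ih =>
    refine reg_of_deriv (ι := Unit) (fun _ => {d :: w}) (fun _ c => Or.inr ?_) ()
    by_cases h : c = d
    · subst h; simpa using ih
    · simpa [h] using reg_empty

theorem reg_finite {Γ : Type} [Finite Γ] {A : Set (List Γ)} (hA : A.Finite) : IsReg A := by
  induction A, hA using Set.Finite.induction_on with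
  | empty => exact reg_empty
  | insert _ _ ih => exact reg_union (reg_single _) ih

theorem reg_concat {Γ : Type} {A B : Set (List Γ)} (hA : IsReg A) (hB : IsReg B) :
    IsReg {w | ∃ u ∈ A, ∃ v ∈ B, w = u ++ v} := by
  classical
  have fA := Language.IsRegular.finite_range_leftQuotient hA
  have fB := Language.IsRegular.finite_range_leftQuotient hB
  let f : Language Γ × Set (Language Γ) → Language Γ := fun q =>
    ({w | (∃ u ∈ q.1, ∃ v ∈ B, w = u ++ v) ∨ ∃ M ∈ q.2, w ∈ M} : Set (List Γ))
  refine Language.IsRegular.of_finite_range_leftQuotient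
    (((fA.prod fB.powerset).image f).subset ?_)
  rintro _ ⟨x, rfl⟩
  refine ⟨(Language.leftQuotient (A : Language Γ) x,
    {M | ∃ u v, u ∈ A ∧ x = u ++ v ∧ M = Language.leftQuotient (B : Language Γ) v}),
    ⟨⟨x, rfl⟩, ?_⟩, ?_⟩
  · rintro _ ⟨u, v, -, -, rfl⟩
    exact ⟨v, rfl⟩
  · ext w
    constructor
    · rintro (⟨u, hu, v, hv, rfl⟩ | ⟨M, ⟨u, v, hu, rfl, rfl⟩, hw⟩)
      · exact ⟨x ++ u, hu, v, hv, by simp⟩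
      · exact ⟨u, hu, v ++ w, hw, by simp⟩
    · rintro ⟨u, hu, v, hv, h⟩
      rcases List.append_eq_append_iff.1 h with ⟨z, rfl, rfl⟩ | ⟨z, rfl, rfl⟩
      · exact Or.inl ⟨z, hu, v, hv, rfl⟩
      · exact Or.inr ⟨_, ⟨u, z, hu, rfl, rfl⟩, hv⟩

theorem reg_filterMap {Γ Δ : Type} (f : Γ → Option Δ) {A : Set (List Δ)} (hA : IsReg A) :
    IsReg {w : List Γ | w.filterMap f ∈ A} := by
  obtain ⟨σ, hσ, M, rfl⟩ := hA
  let N : DFA Γ σ := ⟨fun s c => match f c with | none => s | some d => M.step s d, M.start, M.accept⟩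
  refine ⟨σ, hσ, N, ?_⟩
  have key : ∀ (w : List Γ) (s : σ), N.evalFrom s w = M.evalFrom s (w.filterMap f) := by
    intro w
    induction w with
    | nil => intro s; rfl
    | cons c w ih =>
      intro s
      rw [DFA.evalFrom_cons, ih]
      cases h : f c <;> simp [h, N]
  ext w
  show N.evalFrom M.start w ∈ M.accept ↔ M.evalFrom M.start _ ∈ M.accept
  rw [key]

theorem reg_reverse {Γ : Type} {A : Set (List Γ)} (hA : IsReg A) :
    IsReg {w | w.reverse ∈ A} := Language.IsRegular.reverse hA

theorem reg_factor {Γ : Type} [Finite Γ] (u : List Γ) : IsReg {w | u <:+: w} := by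
  have := reg_concat (reg_concat reg_univ (reg_single u)) reg_univ
  convert this using 1
  ext w
  constructor
  · rintro ⟨s, t, rfl⟩
    exact ⟨s ++ u, ⟨s, trivial, u, rfl, rfl⟩, t, trivial, rfl⟩
  · rintro ⟨_, ⟨s, -, _, rfl, rfl⟩, t, -, rfl⟩
    exact ⟨s, t, rfl⟩

section pad
variable {α : Type}

@[simp] theorem padR_nil : padR ([] : List α) [] = [] := rfl
@[simp] theorem padR_cons_cons (c e : α) (x y : List α) :
    padR (c :: x) (e :: y) = (some c, some e) :: padR x y := by
  simp [padR]
@[simp] theorem padR_cons_nil (c : α) (x : List α) :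
    padR (c :: x) [] = (some c, none) :: padR x [] := by
  simp [padR, List.replicate_succ]
@[simp] theorem padR_nil_cons (e : α) (y : List α) :
    padR [] (e :: y) = (none, some e) :: padR [] y := by
  simp [padR, List.replicate_succ]

theorem padR_fst (x y : List α) : (padR x y).filterMap Prod.fst = x := by
  induction x generalizing y with
  | nil => induction y with
    | nil => rfl
    | cons e y ih => simp [ih]
  | cons c x ih => cases y <;> simp [ih]

theorem padR_snd (x y : List α) : (padR x y).filterMap Prod.snd = y := by
  induction y generalizing x with
  | nil => induction x with
    | nil => rfl
    | cons e y ih => simp [ih]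
  | cons c y ih => cases x <;> simp [ih]

theorem padR_append {u v : List α} (h : u.length = v.length) (x y : List α) :
    padR (u ++ x) (v ++ y) = padR u v ++ padR x y := by
  induction u generalizing v with
  | nil => cases v <;> simp_all
  | cons c u ih => cases v with
    | nil => simp at h
    | cons d v => simp at h; simp [ih h]

theorem padL_eq (x y : List α) : padL x y = (padR x.reverse y.reverse).reverse := by
  unfold padL padR
  simp only [List.zip_eq_zipWith]
  rw [List.reverse_zipWith (by simp; omega)]
  simp [List.map_reverse]

/-- A relation on words is synchronously regular for right padding. -/
def RelReg (Q : List α → List α → Prop) : Prop := IsReg {p | ∃ x y, Q x y ∧ p = padR x y}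

theorem RelReg.or {Q Q' : List α → List α → Prop} (h : RelReg Q) (h' : RelReg Q') :
    RelReg (fun x y => Q x y ∨ Q' x y) := by
  unfold RelReg at *
  convert reg_union h h' using 1
  ext p
  constructor
  · rintro ⟨x, y, h | h, rfl⟩
    · exact Or.inl ⟨x, y, h, rfl⟩
    · exact Or.inr ⟨x, y, h, rfl⟩
  · rintro (⟨x, y, h, rfl⟩ | ⟨x, y, h, rfl⟩)
    · exact ⟨x, y, Or.inl h, rfl⟩
    · exact ⟨x, y, Or.inr h, rfl⟩

theorem RelReg.restrict {Q : List α → List α → Prop} (h : RelReg Q) {A B : Set (List α)}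
    (hA : IsReg A) (hB : IsReg B) :
    RelReg (fun x y => x ∈ A ∧ y ∈ B ∧ Q x y) := by
  unfold RelReg at *
  convert reg_inter (reg_inter (reg_filterMap Prod.fst hA) (reg_filterMap Prod.snd hB)) h using 1
  ext p
  constructor
  · rintro ⟨x, y, ⟨hx, hy, h⟩, rfl⟩
    refine ⟨⟨?_, ?_⟩, x, y, h, rfl⟩
    · simpa [padR_fst] using hx
    · simpa [padR_snd] using hy
  · rintro ⟨⟨hx, hy⟩, x, y, h, rfl⟩
    exact ⟨x, y, ⟨by simpa [padR_fst] using hx, by simpa [padR_snd] using hy, h⟩, rfl⟩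

theorem RelReg.concat {Q Q' : List α → List α → Prop} (h : RelReg Q) (h' : RelReg Q')
    (hl : ∀ x y, Q x y → x.length = y.length) :
    RelReg (fun x y => ∃ u v x' y', Q u v ∧ Q' x' y' ∧ x = u ++ x' ∧ y = v ++ y') := by
  unfold RelReg at *
  convert reg_concat h h' using 1
  ext p
  constructor
  · rintro ⟨_, _, ⟨u, v, x, y, h, h', rfl, rfl⟩, rfl⟩
    exact ⟨_, ⟨u, v, h, rfl⟩, _, ⟨x, y, h', rfl⟩, padR_append (hl _ _ h) _ _⟩
  · rintro ⟨_, ⟨u, v, h, rfl⟩, _, ⟨x, y, h', rfl⟩, rfl⟩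
    exact ⟨_, _, ⟨u, v, x, y, h, h', rfl, rfl⟩, (padR_append (hl _ _ h) _ _).symm⟩

theorem RelReg.single [Finite α] (u v : List α) : RelReg (fun x y => x = u ∧ y = v) := by
  unfold RelReg
  convert reg_single (padR u v) using 1
  ext p
  simp

theorem RelReg.congr {Q Q' : List α → List α → Prop} (h : RelReg Q)
    (e : ∀ x y, Q' x y ↔ Q x y) : RelReg Q' := by
  have : Q' = Q := by ext x y; exact e x y
  rwa [this]

theorem RelReg.eq [Finite α] (p q r s : List α) :
    RelReg (fun x y => p ++ x ++ q = r ++ y ++ s) := by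
  classical
  have : Finite {l : List α // l.length = p.length} := (List.finite_length_eq α p.length).to_subtype
  have : Finite {l : List α // l.length = r.length} := (List.finite_length_eq α r.length).to_subtype
  let X : {l : List α // l.length = p.length} × {l : List α // l.length = r.length} →
      Set (List (Option α × Option α)) := fun i =>
    {w | ∃ x y, i.1.1 ++ x ++ q = i.2.1 ++ y ++ s ∧ w = padR x y}
  refine reg_of_deriv X ?_ (⟨p, rfl⟩, ⟨r, rfl⟩)
  rintro ⟨⟨p, hp⟩, ⟨r, hr⟩⟩ ⟨c, e⟩
  cases c with
  | none =>
    right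
    cases e with
    | none =>
      convert reg_empty using 1
      ext w
      simp only [X, Set.mem_ofPred_eq, Set.mem_empty_iff_false, iff_false]
      rintro ⟨x, y, -, h⟩
      cases x <;> cases y <;> simp at h
    | some e =>
      refine reg_finite (((List.finite_length_le α (p ++ q).length).image
        (fun y => padR [] y)).subset ?_)
      rintro w ⟨x, y, h1, h⟩
      cases x <;> cases y <;> simp at h
      rename_i e' y
      refine ⟨y, ?_, h.2.symm⟩
      have := congrArg List.length h1
      simp at this ⊢; omega
  | some c =>
    cases e with
    | none =>
      right
      refine reg_finite (((List.finite_length_le α (r ++ s).length).image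
        (fun y => padR y [])).subset ?_)
      rintro w ⟨x, y, h1, h⟩
      cases x <;> cases y <;> simp at h
      rename_i e' y
      refine ⟨y, ?_, h.2.symm⟩
      have := congrArg List.length h1
      simp at this ⊢; omega
    | some e =>
      obtain ⟨c', p', hc⟩ := List.exists_cons_of_ne_nil (l := p ++ [c]) (by simp)
      obtain ⟨e', r', he⟩ := List.exists_cons_of_ne_nil (l := r ++ [e]) (by simp)
      have key : ∀ w, ((some c, some e) :: w ∈ X (⟨p, hp⟩, ⟨r, hr⟩)) ↔
          c' = e' ∧ ∃ x y, p' ++ x ++ q = r' ++ y ++ s ∧ w = padR x y := by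
        intro w
        have e1 : ∀ x, p ++ c :: x = c' :: (p' ++ x) := fun x => by
          rw [← List.cons_append, ← hc]; simp
        have e2 : ∀ x, r ++ e :: x = e' :: (r' ++ x) := fun x => by
          rw [← List.cons_append, ← he]; simp
        constructor
        · rintro ⟨x, y, h1, h⟩
          cases x <;> cases y <;> simp at h
          obtain ⟨⟨rfl, rfl⟩, rfl⟩ := h
          simp only [e1, e2, List.cons_append, List.cons.injEq] at h1
          exact ⟨h1.1, _, _, h1.2, rfl⟩
        · rintro ⟨rfl, x, y, h1, rfl⟩
          refine ⟨c :: x, e :: y, ?_, by simp⟩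
          simp only [e1, e2, List.cons_append, h1]
      by_cases hce : c' = e'
      · left
        have l1 := congrArg List.length hc
        have l2 := congrArg List.length he
        simp at l1 l2
        refine ⟨(⟨p', by omega⟩, ⟨r', by omega⟩), fun w => ?_⟩
        rw [key]
        simp [hce, X]
      · right
        convert reg_empty using 1
        ext w
        rw [Set.mem_ofPred_eq, key]
        simp [hce]

theorem reg_padL {Q : List α → List α → Prop} (h : RelReg (fun x y => Q x.reverse y.reverse)) :
    IsReg {p | ∃ x y, Q x y ∧ p = padL x y} := by
  convert reg_reverse h using 1
  ext p
  constructor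
  · rintro ⟨x, y, h, rfl⟩
    exact ⟨x.reverse, y.reverse, by simpa using h, by simp [padL_eq]⟩
  · rintro ⟨x, y, h, h'⟩
    exact ⟨_, _, h, by rw [padL_eq, List.reverse_reverse, List.reverse_reverse, ← h', List.reverse_reverse]⟩

/-- multiples of three of a letter -/
theorem reg_three [Finite α] (b : α) : IsReg {x : List α | ∃ k, x = List.replicate (3 * k) b} := by
  classical
  have := reg_of_deriv (ι := Fin 3)
    (fun i => {x : List α | (∀ c ∈ x, c = b) ∧ (x.length + i.1) % 3 = 0}) ?_ 0
  · convert this using 1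
    ext x
    constructor
    · rintro ⟨k, rfl⟩
      simp
    · rintro ⟨h, h'⟩
      refine ⟨x.length / 3, ?_⟩
      rw [List.eq_replicate_iff]
      refine ⟨?_, h⟩
      simp at h'; omega
  · intro i c
    by_cases hc : c = b
    · left
      refine ⟨⟨(i.1 + 1) % 3, by omega⟩, fun w => ?_⟩
      simp only [Set.mem_ofPred_eq, List.mem_cons, forall_eq_or_imp, hc, true_and, List.length_cons]
      apply and_congr_right; intro _; omega
    · right
      simpa [hc] using reg_empty
end pad

section rewriting
variable {α : Type}

theorem wordEq_refl {R : Set (List α × List α)} (x : List α) : WordEq R x x :=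
  Relation.EqvGen.refl x

theorem wordEq_symm {R : Set (List α × List α)} {x y : List α} (h : WordEq R x y) :
    WordEq R y x := Relation.EqvGen.symm _ _ h

theorem wordEq_trans {R : Set (List α × List α)} {x y z : List α} (h : WordEq R x y)
    (h' : WordEq R y z) : WordEq R x z := Relation.EqvGen.trans _ _ _ h h'

theorem wordEq_append {R : Set (List α × List α)} (p s : List α) {x y : List α}
    (h : WordEq R x y) : WordEq R (p ++ x ++ s) (p ++ y ++ s) := by
  induction h with
  | rel x y h =>
    obtain ⟨p', u, v, s', hR, rfl, rfl⟩ := h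
    exact Relation.EqvGen.rel _ _ ⟨p ++ p', u, v, s' ++ s, hR, by simp, by simp⟩
  | refl x => exact wordEq_refl _
  | symm x y _ ih => exact wordEq_symm ih
  | trans x y z _ _ ih ih' => exact wordEq_trans ih ih'

theorem wordEq_cons {R : Set (List α × List α)} (c : α) {x y : List α}
    (h : WordEq R x y) : WordEq R (c :: x) (c :: y) := by
  simpa using wordEq_append [c] [] h

/-- words avoiding the two forbidden factors -/
def Av (a b : α) (l : List α) : Prop := ¬ [a, a, a] <:+: l ∧ ¬ [a, b, b, b] <:+: l

variable {a b : α}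

theorem Av.of_factor {l l' : List α} (h : Av a b l) (hl : l' <:+: l) : Av a b l' :=
  ⟨fun h' => h.1 (h'.trans hl), fun h' => h.2 (h'.trans hl)⟩

theorem av_nil : Av a b [] := by simp [Av]

theorem av_cons_ne {c : α} (hc : c ≠ a) {l : List α} : Av a b (c :: l) ↔ Av a b l := by
  simp [Av, List.infix_cons_iff, List.cons_prefix_cons, hc.symm]

theorem av_cons_a {l : List α} : Av a b (a :: l) ↔
    Av a b l ∧ ¬ [a, a] <+: l ∧ ¬ [b, b, b] <+: l := by
  simp only [Av, List.infix_cons_iff, List.cons_prefix_cons, true_and]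
  tauto

variable [DecidableEq α]

/-- left multiplication by the letter `a` on normal forms -/
def la (a b : α) : List α → List α
  | c :: d :: e :: x =>
    if c = b ∧ d = b ∧ e = b then b :: b :: b :: la a b x
    else if c = a ∧ d = a then b :: b :: b :: e :: x
    else a :: c :: d :: e :: x
  | [c, d] => if c = a ∧ d = a then [b, b, b] else [a, c, d]
  | [c] => [a, c]
  | [] => [a]

theorem la_bbb (x : List α) : la a b (b :: b :: b :: x) = b :: b :: b :: la a b x := by
  simp [la]

theorem la_aa (hab : a ≠ b) (x : List α) : la a b (a :: a :: x) = b :: b :: b :: x := by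
  cases x <;> simp [la, hab]

theorem la_else {x : List α} (h1 : ¬ [a, a] <+: x) (h2 : ¬ [b, b, b] <+: x) :
    la a b x = a :: x := by
  match x with
  | [] => simp [la]
  | [c] => simp [la]
  | [c, d] =>
    simp [List.cons_prefix_cons] at h1
    simp only [la]
    rw [if_neg]
    rintro ⟨rfl, rfl⟩; simp at h1
  | c :: d :: e :: x =>
    simp [List.cons_prefix_cons] at h1 h2
    simp only [la]
    rw [if_neg, if_neg]
    · rintro ⟨rfl, rfl⟩; simp at h1
    · rintro ⟨rfl, rfl, rfl⟩; simp at h2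

theorem la_induction (a b : α) {P : List α → Prop} (hbbb : ∀ x, P x → P (b :: b :: b :: x))
    (haa : ∀ x, P (a :: a :: x))
    (helse : ∀ x, ¬ [a, a] <+: x → ¬ [b, b, b] <+: x → P x) (x : List α) : P x := by
  induction hn : x.length using Nat.strong_induction_on generalizing x with
  | _ n ih =>
    by_cases h1 : [a, a] <+: x
    · obtain ⟨t, rfl⟩ := h1; exact haa t
    by_cases h2 : [b, b, b] <+: x
    · obtain ⟨t, rfl⟩ := h2
      exact hbbb t (ih t.length (by simp at hn; omega) t rfl)
    exact helse x h1 h2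

theorem la_av (hab : a ≠ b) {x : List α} (h : Av a b x) : Av a b (la a b x) := by
  have hba := hab.symm
  induction x using la_induction a b with
  | hbbb x ih =>
    rw [la_bbb, av_cons_ne hba, av_cons_ne hba, av_cons_ne hba]
    rw [av_cons_ne hba, av_cons_ne hba, av_cons_ne hba] at h
    exact ih h
  | haa x =>
    rw [la_aa hab, av_cons_ne hba, av_cons_ne hba, av_cons_ne hba]
    exact h.of_factor ⟨[a, a], [], by simp⟩
  | helse x h1 h2 => rw [la_else h1 h2, av_cons_a]; exact ⟨h, h1, h2⟩

theorem la_cube (hab : a ≠ b) {x : List α} (h : Av a b x) :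
    la a b (la a b (la a b x)) = b :: b :: b :: x := by
  have hba := hab.symm
  induction x using la_induction a b with
  | hbbb x ih =>
    rw [av_cons_ne hba, av_cons_ne hba, av_cons_ne hba] at h
    simp only [la_bbb, ih h]
  | haa x =>
    rw [av_cons_a, av_cons_a] at h
    obtain ⟨⟨h0, h1, h2⟩, h3, h4⟩ := h
    have h5 : ¬ [a] <+: x := by simpa [List.cons_prefix_cons] using h3
    rw [la_aa hab, la_bbb, la_bbb, la_else h1 h2, la_else]
    · simpa [List.cons_prefix_cons] using h5
    · simp [List.cons_prefix_cons, hba]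
  | helse x h1 h2 =>
    rw [la_else h1 h2]
    by_cases h3 : [a] <+: x
    · obtain ⟨t, rfl⟩ := h3
      simp only [List.cons_append, List.nil_append] at *
      rw [la_aa hab, la_bbb, la_else]
      · exact fun h' => (av_cons_a.1 h).2.1 h'
      · exact (av_cons_a.1 h).2.2
    · rw [la_else (x := a :: x), la_aa hab]
      · simpa [List.cons_prefix_cons] using h3
      · simp [List.cons_prefix_cons, hba]

/-- normal form -/
def nf (a b : α) (w : List α) : List α :=
  w.foldr (fun c x => if c = a then la a b x else c :: x) []

theorem nf_av (hab : a ≠ b) (w : List α) : Av a b (nf a b w) := by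
  induction w with
  | nil => exact av_nil
  | cons c w ih =>
    by_cases hc : c = a
    · subst hc; simpa [nf] using la_av hab ih
    · simp only [nf, List.foldr_cons, if_neg hc]
      exact (av_cons_ne hc).2 ih

theorem nf_of_av {w : List α} (h : Av a b w) : nf a b w = w := by
  induction w with
  | nil => rfl
  | cons c w ih =>
    have ih := ih (h.of_factor ⟨[c], [], by simp⟩)
    unfold nf at ih ⊢
    rw [List.foldr_cons, ih]
    by_cases hc : c = a
    · subst hc
      rw [av_cons_a] at h
      simp [la_else h.2.1 h.2.2]
    · simp [hc]

theorem nf_eq (hab : a ≠ b) {x y : List α} (h : WordEq {([a, a, a], [b, b, b])} x y) :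
    nf a b x = nf a b y := by
  have hba := hab.symm
  induction h with
  | rel x y h =>
    obtain ⟨p, u, v, s, hR, rfl, rfl⟩ := h
    simp only [Set.mem_singleton_iff, Prod.mk.injEq] at hR
    obtain ⟨rfl, rfl⟩ := hR
    unfold nf
    simp only [List.foldr_append]
    congr 1
    have := la_cube hab (nf_av hab s)
    simpa [hba, nf] using this
  | refl x => rfl
  | symm x y _ ih => exact ih.symm
  | trans x y z _ _ ih ih' => exact ih.trans ih'

theorem av_unique (hab : a ≠ b) {x y : List α} (h : WordEq {([a, a, a], [b, b, b])} x y)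
    (hx : Av a b x) (hy : Av a b y) : x = y := by
  rw [← nf_of_av hx, ← nf_of_av hy, nf_eq hab h]

theorem wordEq_cube (p s : List α) : WordEq {([a, a, a], [b, b, b])}
    (p ++ a :: a :: a :: s) (p ++ b :: b :: b :: s) :=
  Relation.EqvGen.rel _ _ ⟨p, _, _, s, rfl, by simp, by simp⟩

theorem wordEq_abbb (s : List α) : WordEq {([a, a, a], [b, b, b])}
    (a :: b :: b :: b :: s) (b :: b :: b :: a :: s) :=
  wordEq_trans (wordEq_symm (wordEq_cube [a] s)) (wordEq_cube [] (a :: s))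

theorem la_wordEq (hab : a ≠ b) (x : List α) :
    WordEq {([a, a, a], [b, b, b])} (la a b x) (a :: x) := by
  induction x using la_induction a b with
  | hbbb x ih =>
    rw [la_bbb]
    refine wordEq_trans ?_ (wordEq_symm (wordEq_abbb x))
    exact wordEq_cons _ (wordEq_cons _ (wordEq_cons _ ih))
  | haa x => rw [la_aa hab]; exact wordEq_symm (wordEq_cube [] x)
  | helse x h1 h2 => rw [la_else h1 h2]; exact wordEq_refl _

theorem nf_wordEq (hab : a ≠ b) (w : List α) :
    WordEq {([a, a, a], [b, b, b])} (nf a b w) w := by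
  induction w with
  | nil => exact wordEq_refl _
  | cons c w ih =>
    by_cases hc : c = a
    · subst hc
      have : nf c b (c :: w) = la c b (nf c b w) := by simp [nf]
      rw [this]
      exact wordEq_trans (la_wordEq hab _) (wordEq_cons _ ih)
    · have : nf a b (c :: w) = c :: nf a b w := by simp [nf, hc]
      rw [this]
      exact wordEq_cons _ ih

theorem wordEq_length {x y : List α} (h : WordEq {([a, a, a], [b, b, b])} x y) :
    x.length = y.length := by
  induction h with
  | rel x y h =>
    obtain ⟨p, u, v, s, hR, rfl, rfl⟩ := h
    simp only [Set.mem_singleton_iff, Prod.mk.injEq] at hR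
    obtain ⟨rfl, rfl⟩ := hR
    simp
  | refl x => rfl
  | symm x y _ ih => exact ih.symm
  | trans x y z _ _ ih ih' => exact ih.trans ih'

/-- `b³` is central -/
theorem central (hA : ∀ x : α, x = a ∨ x = b) (v : List α) :
    WordEq {([a, a, a], [b, b, b])} (v ++ [b, b, b]) (b :: b :: b :: v) := by
  induction v with
  | nil => exact wordEq_refl _
  | cons c v ih =>
    refine wordEq_trans (wordEq_cons c ih) ?_
    rcases hA c with rfl | rfl
    · exact wordEq_abbb v
    · exact wordEq_refl _

theorem central_rep (k : ℕ) (v : List α) :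
    WordEq {([a, a, a], [b, b, b])} (a :: (List.replicate (3 * k) b ++ v))
      (List.replicate (3 * k) b ++ a :: v) := by
  induction k with
  | zero => exact wordEq_refl _
  | succ k ih =>
    have : 3 * (k + 1) = 3 * k + 1 + 1 + 1 := by ring
    simp only [this, List.replicate_succ, List.cons_append]
    exact wordEq_trans (wordEq_abbb _) (wordEq_cons _ (wordEq_cons _ (wordEq_cons _ ih)))

theorem la_form (hab : a ≠ b) (x : List α) :
    ∃ k, (∃ v, x = List.replicate (3 * k) b ++ v ∧ la a b x = List.replicate (3 * k) b ++ a :: v) ∨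
      (∃ v, x = List.replicate (3 * k) b ++ a :: a :: v ∧
        la a b x = List.replicate (3 * k) b ++ b :: b :: b :: v) := by
  induction x using la_induction a b with
  | hbbb x ih =>
    obtain ⟨k, h⟩ := ih
    have : 3 * (k + 1) = 3 * k + 1 + 1 + 1 := by ring
    refine ⟨k + 1, ?_⟩
    rw [la_bbb]
    simp only [this, List.replicate_succ, List.cons_append, List.cons.injEq, true_and]
    exact h
  | haa x => exact ⟨0, Or.inr ⟨x, by simp, by simp [la_aa hab]⟩⟩
  | helse x h1 h2 => exact ⟨0, Or.inl ⟨x, by simp, by simp [la_else h1 h2]⟩⟩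

theorem left_a (hab : a ≠ b) {x y : List α} (hx : Av a b x) (hy : Av a b y) :
    WordEq {([a, a, a], [b, b, b])} (a :: x) y ↔
    ∃ k v, (x = List.replicate (3 * k) b ++ v ∧ y = List.replicate (3 * k) b ++ a :: v) ∨
      (x = List.replicate (3 * k) b ++ a :: a :: v ∧
        y = List.replicate (3 * k) b ++ b :: b :: b :: v) := by
  constructor
  · intro h
    have := av_unique hab (wordEq_trans (la_wordEq hab x) h) (la_av hab hx) hy
    subst this
    obtain ⟨k, ⟨v, h1, h2⟩ | ⟨v, h1, h2⟩⟩ := la_form hab x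
    · exact ⟨k, v, Or.inl ⟨h1, h2⟩⟩
    · exact ⟨k, v, Or.inr ⟨h1, h2⟩⟩
  · rintro ⟨k, v, ⟨rfl, rfl⟩ | ⟨rfl, rfl⟩⟩
    · exact central_rep k v
    · exact wordEq_trans (central_rep k _) (wordEq_cube _ _)

theorem left_b (hab : a ≠ b) {x y : List α} (hx : Av a b x) (hy : Av a b y) :
    WordEq {([a, a, a], [b, b, b])} (b :: x) y ↔ y = b :: x := by
  constructor
  · intro h
    exact (av_unique hab h ((av_cons_ne hab.symm).2 hx) hy).symm
  · rintro rfl; exact wordEq_refl _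

theorem infix_concat_iff (u x : List α) (c : α) :
    u <:+: x ++ [c] ↔ u <:+: x ∨ u <:+ x ++ [c] := by
  rw [List.infix_concat_iff]; tauto

theorem right_a (hab : a ≠ b) (hA : ∀ x : α, x = a ∨ x = b)
    {x y : List α} (hx : Av a b x) (hy : Av a b y) :
    WordEq {([a, a, a], [b, b, b])} (x ++ [a]) y ↔
      y = x ++ [a] ∨ ∃ v, x = v ++ [a, a] ∧ y = b :: b :: b :: v := by
  have hba := hab.symm
  have key : ∀ v, WordEq {([a, a, a], [b, b, b])} ((v ++ [a, a]) ++ [a]) (b :: b :: b :: v) :=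
    fun v => wordEq_trans (by simpa using wordEq_cube v []) (central hA v)
  constructor
  · intro h
    by_cases h' : Av a b (x ++ [a])
    · exact Or.inl (av_unique hab h h' hy).symm
    · right
      have : [a, a, a] <:+ x ++ [a] := by
        unfold Av at h' hx
        rw [infix_concat_iff, infix_concat_iff] at h'
        have : ¬ [a, b, b, b] <:+ x ++ [a] := by
          rintro ⟨t, ht⟩
          have := congrArg List.getLast? ht
          simp [hba] at this
        tauto
      obtain ⟨v, hv⟩ := this
      have hv : (v ++ [a, a]) ++ [a] = x ++ [a] := by simpa using hv
      have hv := List.append_cancel_right hv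
      subst hv
      refine ⟨v, rfl, (av_unique hab (wordEq_trans (wordEq_symm (key v)) h) ?_ hy).symm⟩
      rw [av_cons_ne hba, av_cons_ne hba, av_cons_ne hba]
      exact hx.of_factor ⟨[], [a, a], by simp⟩
  · rintro (rfl | ⟨v, rfl, rfl⟩)
    · exact wordEq_refl _
    · exact key v

theorem right_b (hab : a ≠ b) (hA : ∀ x : α, x = a ∨ x = b)
    {x y : List α} (hx : Av a b x) (hy : Av a b y) :
    WordEq {([a, a, a], [b, b, b])} (x ++ [b]) y ↔
      y = x ++ [b] ∨ ∃ v, x = v ++ [b, b] ∧ y = b :: b :: b :: v := by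
  have hba := hab.symm
  have key : ∀ v, WordEq {([a, a, a], [b, b, b])} ((v ++ [b, b]) ++ [b]) (b :: b :: b :: v) :=
    fun v => by simpa using (central hA v)
  constructor
  · intro h
    by_cases h' : Av a b (x ++ [b])
    · exact Or.inl (av_unique hab h h' hy).symm
    · right
      have : [a, b, b, b] <:+ x ++ [b] := by
        unfold Av at h' hx
        rw [infix_concat_iff, infix_concat_iff] at h'
        have : ¬ [a, a, a] <:+ x ++ [b] := by
          rintro ⟨t, ht⟩
          have := congrArg List.getLast? ht
          simp [hab] at this
        tauto
      obtain ⟨v, hv⟩ := this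
      have hv : ((v ++ [a]) ++ [b, b]) ++ [b] = x ++ [b] := by simpa using hv
      have hv := List.append_cancel_right hv
      subst hv
      refine ⟨v ++ [a], rfl, (av_unique hab (wordEq_trans (wordEq_symm (key _)) h) ?_ hy).symm⟩
      rw [av_cons_ne hba, av_cons_ne hba, av_cons_ne hba]
      exact hx.of_factor ⟨[], [b, b], by simp⟩
  · rintro (rfl | ⟨v, rfl, rfl⟩)
    · exact wordEq_refl _
    · exact key v

end rewriting

section assembly
variable {α : Type} [Finite α]

theorem regR {L : Set (List α)} (hL : IsReg L) {W Q : List α → List α → Prop}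
    (hQ : RelReg Q) (e : ∀ x ∈ L, ∀ y ∈ L, (W x y ↔ Q x y)) :
    IsReg {p | ∃ x ∈ L, ∃ y ∈ L, W x y ∧ p = padR x y} := by
  have := hQ.restrict hL hL
  unfold RelReg at this
  convert this using 1
  ext p
  constructor
  · rintro ⟨x, hx, y, hy, h, rfl⟩
    exact ⟨x, y, ⟨hx, hy, (e x hx y hy).1 h⟩, rfl⟩
  · rintro ⟨x, y, ⟨hx, hy, h⟩, rfl⟩
    exact ⟨x, hx, y, hy, (e x hx y hy).2 h, rfl⟩

theorem regL {L : Set (List α)} (hL : IsReg L) {W Q : List α → List α → Prop}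
    (hQ : RelReg (fun x y => Q x.reverse y.reverse)) (e : ∀ x ∈ L, ∀ y ∈ L, (W x y ↔ Q x y)) :
    IsReg {p | ∃ x ∈ L, ∃ y ∈ L, W x y ∧ p = padL x y} := by
  have := hQ.restrict (reg_reverse hL) (reg_reverse hL)
  have := reg_padL (Q := fun x y => x ∈ L ∧ y ∈ L ∧ Q x y) this
  convert this using 1
  ext p
  constructor
  · rintro ⟨x, hx, y, hy, h, rfl⟩
    exact ⟨x, y, ⟨hx, hy, (e x hx y hy).1 h⟩, rfl⟩
  · rintro ⟨x, y, ⟨hx, hy, h⟩, rfl⟩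
    exact ⟨x, hx, y, hy, (e x hx y hy).2 h, rfl⟩

theorem rel_id : RelReg (fun x y : List α => x = y) := by
  simpa using RelReg.eq ([] : List α) [] [] []

theorem rel_pre (r : List α) : RelReg (fun x y : List α => y = r ++ x) := by
  refine (RelReg.eq r [] [] []).congr fun x y => ?_
  simp [eq_comm]

theorem rel_suf (r : List α) : RelReg (fun x y : List α => y = x ++ r) := by
  refine (RelReg.eq [] r [] []).congr fun x y => ?_
  simp [eq_comm]

theorem rel_shift (r s : List α) : RelReg (fun x y : List α => ∃ v, x = v ++ s ∧ y = r ++ v) := by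
  refine ((RelReg.eq r [] [] s).restrict (reg_concat reg_univ (reg_single s)) reg_univ).congr
    fun x y => ?_
  constructor
  · rintro ⟨v, rfl, rfl⟩
    exact ⟨⟨v, trivial, s, rfl, rfl⟩, trivial, by simp⟩
  · rintro ⟨⟨v, -, _, rfl, rfl⟩, -, h⟩
    refine ⟨v, rfl, ?_⟩
    simpa [← List.append_assoc, eq_comm] using h

theorem rel_shift' (r s : List α) : RelReg (fun x y : List α => ∃ v, x = s ++ v ∧ y = v ++ r) := by
  refine ((RelReg.eq [] r s []).restrict (reg_concat (reg_single s) reg_univ) reg_univ).congr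
    fun x y => ?_
  constructor
  · rintro ⟨v, rfl, rfl⟩
    exact ⟨⟨s, rfl, v, trivial, rfl⟩, trivial, by simp⟩
  · rintro ⟨⟨_, rfl, v, -, rfl⟩, -, h⟩
    refine ⟨v, rfl, ?_⟩
    simpa [eq_comm] using h

theorem rel_right_R (b c : α) : RelReg (fun x y : List α =>
    y = x ++ [c] ∨ ∃ v, x = v ++ [c, c] ∧ y = b :: b :: b :: v) :=
  (rel_suf [c]).or (rel_shift [b, b, b] [c, c])

theorem rel_right_L (b c : α) : RelReg (fun x y : List α =>
    y.reverse = x.reverse ++ [c] ∨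
      ∃ v, x.reverse = v ++ [c, c] ∧ y.reverse = b :: b :: b :: v) := by
  refine ((rel_pre [c]).or (rel_shift' [b, b, b] [c, c])).congr fun x y => ?_
  refine or_congr ?_ ?_
  · rw [List.reverse_eq_iff]; simp
  · constructor
    · rintro ⟨v, h1, h2⟩
      rw [List.reverse_eq_iff] at h1 h2
      exact ⟨v.reverse, by simpa using h1, by simpa using h2⟩
    · rintro ⟨v, rfl, rfl⟩
      exact ⟨v.reverse, by simp, by simp⟩

/-- equal pairs of powers of `b³` -/
theorem rel_three (b : α) : RelReg (fun x y : List α => ∃ k, x = List.replicate (3 * k) b ∧ y = x) := by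
  refine (rel_id.restrict (reg_three b) reg_univ).congr fun x y => ?_
  constructor
  · rintro ⟨k, hx, rfl⟩; exact ⟨⟨k, hx⟩, trivial, rfl⟩
  · rintro ⟨⟨k, hx⟩, -, rfl⟩; exact ⟨k, hx, rfl⟩

theorem rel_left_R (a b : α) : RelReg (fun x y : List α =>
    ∃ k v, (x = List.replicate (3 * k) b ++ v ∧ y = List.replicate (3 * k) b ++ a :: v) ∨
      (x = List.replicate (3 * k) b ++ a :: a :: v ∧
        y = List.replicate (3 * k) b ++ b :: b :: b :: v)) := by
  have h1 := RelReg.concat (RelReg.single [a, a] [b, b]) (rel_pre [b])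
    (by rintro _ _ ⟨rfl, rfl⟩; rfl)
  have h2 := RelReg.concat (rel_three b) ((rel_pre [a]).or h1) (by rintro _ _ ⟨k, rfl, rfl⟩; rfl)
  refine h2.congr fun x y => ?_
  constructor
  · rintro ⟨k, v, ⟨rfl, rfl⟩ | ⟨rfl, rfl⟩⟩
    · exact ⟨_, _, _, _, ⟨k, rfl, rfl⟩, Or.inl rfl, rfl, rfl⟩
    · exact ⟨_, _, _, _, ⟨k, rfl, rfl⟩,
        Or.inr ⟨[a, a], [b, b], v, _, ⟨rfl, rfl⟩, rfl, rfl, rfl⟩, rfl, rfl⟩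
  · rintro ⟨_, _, _, _, ⟨k, rfl, rfl⟩, rfl | ⟨_, _, v, _, ⟨rfl, rfl⟩, rfl, rfl, rfl⟩, rfl, rfl⟩
    · exact ⟨k, _, Or.inl ⟨rfl, rfl⟩⟩
    · exact ⟨k, v, Or.inr ⟨rfl, rfl⟩⟩

theorem rel_left_L (a b : α) : RelReg (fun x y : List α =>
    ∃ k v, (x.reverse = List.replicate (3 * k) b ++ v ∧
        y.reverse = List.replicate (3 * k) b ++ a :: v) ∨
      (x.reverse = List.replicate (3 * k) b ++ a :: a :: v ∧
        y.reverse = List.replicate (3 * k) b ++ b :: b :: b :: v)) := by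
  have h0 : ∀ c : α, RelReg (fun x y : List α => ∃ k, x = List.replicate (3 * k) b ∧
      y = c :: x) := fun c => by
    refine ((rel_pre [c]).restrict (reg_three b) reg_univ).congr fun x y => ?_
    constructor
    · rintro ⟨k, hx, rfl⟩; exact ⟨⟨k, hx⟩, trivial, rfl⟩
    · rintro ⟨⟨k, hx⟩, -, rfl⟩; exact ⟨k, hx, rfl⟩
  have h1 := RelReg.concat (RelReg.single [a, a] [b, b]) (h0 b)
    (by rintro _ _ ⟨rfl, rfl⟩; rfl)
  have h2 := RelReg.concat rel_id ((h0 a).or h1) (by rintro _ _ rfl; rfl)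
  refine h2.congr fun x y => ?_
  have comm : ∀ (k : ℕ) (v : List α), List.replicate (3 * k) b ++ b :: v =
      b :: (List.replicate (3 * k) b ++ v) := fun k v => by
    rw [← List.cons_append, ← List.replicate_succ, List.replicate_succ']; simp
  constructor
  · rintro ⟨k, v, ⟨h, h'⟩ | ⟨h, h'⟩⟩
    · rw [List.reverse_eq_iff] at h h'
      exact ⟨v.reverse, _, _, _, rfl, Or.inl ⟨k, rfl, rfl⟩, by simpa using h, by simpa using h'⟩
    · rw [List.reverse_eq_iff] at h h'
      refine ⟨v.reverse, _, _, _, rfl,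
        Or.inr ⟨[a, a], [b, b], _, _, ⟨rfl, rfl⟩, ⟨k, rfl, rfl⟩, rfl, rfl⟩, by simpa using h, ?_⟩
      simpa using h'
  · rintro ⟨v, _, _, _, rfl, ⟨k, rfl, rfl⟩ | ⟨_, _, _, _, ⟨rfl, rfl⟩, ⟨k, rfl, rfl⟩, rfl, rfl⟩,
      rfl, rfl⟩
    · exact ⟨k, v.reverse, Or.inl ⟨by simp, by simp⟩⟩
    · exact ⟨k, v.reverse, Or.inr ⟨by simp, by simp⟩⟩

theorem expand_id (x : List α) : expandW (fun c : α => [c]) x = x := by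
  induction x with
  | nil => rfl
  | cons c x ih => simpa [expandW] using ih

/-- the language of normal forms -/
def Lnf (a b : α) : Set (List α) := {l | l ≠ [] ∧ ¬ [a, a, a] <:+: l ∧ ¬ [a, b, b, b] <:+: l}

theorem reg_Lnf (a b : α) : IsReg (Lnf a b) := by
  have := reg_inter (reg_compl (reg_single ([] : List α)))
    (reg_inter (reg_compl (reg_factor [a, a, a])) (reg_compl (reg_factor [a, b, b, b])))
  exact this

variable {a b : α}

theorem nf_exists (hab : a ≠ b) (w : List α) (hw : w ≠ []) :
    ∃ x ∈ Lnf a b, WordEq {([a, a, a], [b, b, b])} x w := by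
  classical
  refine ⟨nf a b w, ⟨?_, nf_av hab w⟩, nf_wordEq hab w⟩
  intro h
  have := wordEq_length (nf_wordEq hab w)
  rw [h] at this
  exact hw (List.length_eq_zero_iff.1 this.symm)

theorem biauto (hab : a ≠ b) (hA : ∀ x : α, x = a ∨ x = b) :
    SgpBiautoStruct {([a, a, a], [b, b, b])} (fun x => [x]) (Lnf a b) := by
  classical
  have heq : ∀ x ∈ Lnf a b, ∀ y ∈ Lnf a b,
      (WordEq {([a, a, a], [b, b, b])} x y ↔ x = y) := fun x hx y hy =>
    ⟨fun h => av_unique hab h hx.2 hy.2, fun h => h ▸ wordEq_refl _⟩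
  constructor
  · intro b; simp
  · exact reg_Lnf a b
  · intro w hw; exact hw.1
  · intro w hw; simpa only [expand_id] using nf_exists hab w hw
  · simp only [expand_id]
    exact regR (reg_Lnf a b) rel_id heq
  · simp only [expand_id]
    exact regL (reg_Lnf a b) (by simpa using rel_id) heq
  · intro c
    simp only [expand_id]
    rcases hA c with rfl | rfl
    · exact regR (reg_Lnf _ _) (rel_right_R b c) fun x hx y hy => right_a hab hA hx.2 hy.2
    · exact regR (reg_Lnf _ _) (rel_right_R c c) fun x hx y hy => right_b hab hA hx.2 hy.2
  · intro c
    simp only [expand_id]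
    rcases hA c with rfl | rfl
    · exact regR (reg_Lnf _ _) (rel_left_R c b) fun x hx y hy => left_a hab hx.2 hy.2
    · exact regR (reg_Lnf _ _) (rel_pre [c]) fun x hx y hy => left_b hab hx.2 hy.2
  · intro c
    simp only [expand_id]
    rcases hA c with rfl | rfl
    · exact regL (reg_Lnf _ _) (rel_right_L b c) fun x hx y hy => right_a hab hA hx.2 hy.2
    · exact regL (reg_Lnf _ _) (rel_right_L c c) fun x hx y hy => right_b hab hA hx.2 hy.2
  · intro c
    simp only [expand_id]
    rcases hA c with rfl | rfl
    · exact regL (reg_Lnf _ _) (rel_left_L c b) fun x hx y hy => left_a hab hx.2 hy.2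
    · refine regL (Q := fun x y => y = c :: x) (reg_Lnf _ _) ?_
        fun x hx y hy => left_b hab hx.2 hy.2
      refine (rel_suf [c]).congr fun x y => ?_
      rw [List.reverse_eq_iff]; simp

theorem prefauto (hab : a ≠ b) (hA : ∀ x : α, x = a ∨ x = b) :
    SgpPrefixAutoStruct {([a, a, a], [b, b, b])} (fun x => [x]) (Lnf a b) := by
  have h := biauto hab hA
  refine ⟨⟨h.gen_ne, h.reg, h.ne, h.onto, h.eqR_reg, h.mulRR_reg⟩, ?_⟩
  convert h.eqR_reg using 1
  ext p
  simp only [expand_id]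
  constructor
  · rintro ⟨x, hx, y, ⟨z, hz, hyz⟩, he, rfl⟩
    refine ⟨x, hx, y, ⟨?_, Av.of_factor (a := a) (b := b) hz.2 (hyz.elim fun t ht => ⟨[], t, by simpa using ht⟩)⟩, he, rfl⟩
    rintro rfl
    exact hx.1 (List.length_eq_zero_iff.1 (by classical exact wordEq_length he))
  · rintro ⟨x, hx, y, hy, he, rfl⟩
    exact ⟨x, hx, y, ⟨y, hy, List.prefix_refl y⟩, he, rfl⟩

end assembly
end S19

/-- the semigroup `S = sgp⁺⟨a, b ∣ a³ = b³⟩` is biautomatic and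
prefix-automatic; indeed `L = A⁺ − A*{aaa, abbb}A*` is a set of unique normal
forms of `S` and `(A, L)` is both a biautomatic and a prefix-automatic
structure for `S`. -/
theorem statement_19 {α : Type} [Fintype α] (a b : α) (hab : a ≠ b)
    (hA : ∀ x : α, x = a ∨ x = b)
    (R : Set (List α × List α)) (hRdef : R = {([a, a, a], [b, b, b])}) :
    SgpBiautomatic R ∧ SgpPrefixAutomatic R ∧
    (∀ w : List α, w ≠ [] → ∃! l : List α,
      (l ≠ [] ∧ ¬ [a, a, a] <:+: l ∧ ¬ [a, b, b, b] <:+: l) ∧ WordEq R l w) ∧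
    SgpBiautoStruct R (fun x => [x])
      {l : List α | l ≠ [] ∧ ¬ [a, a, a] <:+: l ∧ ¬ [a, b, b, b] <:+: l} ∧
    SgpPrefixAutoStruct R (fun x => [x])
      {l : List α | l ≠ [] ∧ ¬ [a, a, a] <:+: l ∧ ¬ [a, b, b, b] <:+: l} := by
  subst hRdef
  have h1 := S19.biauto hab hA
  have h2 := S19.prefauto hab hA
  refine ⟨⟨α, inferInstance, _, _, h1⟩, ⟨α, inferInstance, _, _, h2⟩, ?_, h1, h2⟩
  classical
  intro w hw
  obtain ⟨x, hx, he⟩ := S19.nf_exists hab w hw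
  refine ⟨x, ⟨hx, he⟩, ?_⟩
  rintro y ⟨hy, hey⟩
  exact S19.av_unique hab (S19.wordEq_trans hey (S19.wordEq_symm he)) hy.2 hx.2
end
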